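/- There is an absolute constant K > 0 such that the following holds. Let q = (q_1,...,q_k) be any k-tuple of degree-2 polynomials over R^n with Var_{x ~ N(0,1)^n}[q_i(x)] = 1 for all i in [k], and let 0 < eps < 1/4. Then there exist a k-tuple r = (r_1,...,r_k) of degree-2 polynomials over R^n and an integer 0 <= t <= K * k * ln(1/eps) / eps^2 such that both: (i) d_K(q, r) <= K * eps, where q = (q_1(x),...,q_k(x)) with x ~ N(0,1)^n and r = (r_1(y),...,r_k(y)) with y ~ N(0,1)^n; and (ii) for every restriction rho = (rho_1,...,rho_t) in R^t, d_K(r|_rho, N(mu(r|_rho), Sigma(r|_rho))) <= eps, where r|_rho denotes the random vector (r_1|_rho(y),...,r_k|_rho(y)) with y ~ N(0,1)^n and r_i|_rho(y) := r_i(rho_1,...,rho_t, y_{t+1},...,y_n), mu(r|_rho) in R^k is the vector of means of the r_i|_rho, and Sigma(r|_rho) is the k x k covariance matrix with (i,j) entry Cov_{y ~ N(0,1)^n}(r_i|_rho(y), r_j|_rho(y)), and N(mu, Sigma) denotes the k-dimensional Gaussian with mean mu and covariance Sigma. -/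

import Mathlib

open MeasureTheory ProbabilityTheory Matrix

/-- The standard Gaussian measure `N(0,1)^n` on `ℝ^n`. -/
noncomputable def stdGaussian (n : ℕ) : Measure (Fin n → ℝ) :=
  MeasureTheory.Measure.pi fun _ => ProbabilityTheory.gaussianReal 0 1

/-- A degree-2 polynomial `x ↦ xᵀ A x + b ⬝ x + c` on `ℝ^n`. -/
noncomputable def quadPoly {n : ℕ} (A : Matrix (Fin n) (Fin n) ℝ) (b : Fin n → ℝ) (c : ℝ)
    (x : Fin n → ℝ) : ℝ :=
  x ⬝ᵥ A.mulVec x + b ⬝ᵥ x + c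

/-- Covariance of two real functions under a measure. -/
noncomputable def covar {α : Type*} [MeasurableSpace α] (μ : Measure α) (f g : α → ℝ) : ℝ :=
  (∫ x, f x * g x ∂μ) - (∫ x, f x ∂μ) * (∫ x, g x ∂μ)

/-- Restriction of the first `t` coordinates to the values of `ρ`:  the input whose `l`-th
coordinate is `ρ l` if `l < t` and `y l` otherwise. -/
noncomputable def splice {n : ℕ} (t : ℕ) (ρ y : Fin n → ℝ) : Fin n → ℝ :=
  fun l => if (l : ℕ) < t then ρ l else y l

section
/-- The standard Gaussian measure on `ι → ℝ`. -/
noncomputable abbrev gaussPi (ι : Type*) [Fintype ι] : Measure (ι → ℝ) :=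
  Measure.pi fun _ : ι => gaussianReal 0 1

theorem charFunDual_gaussPi {ι : Type*} [Fintype ι] [DecidableEq ι] (L : StrongDual ℝ (ι → ℝ)) :
    charFunDual (gaussPi ι) L = Complex.exp (-((∑ i, (L (Pi.single i 1)) ^ 2 : ℝ) : ℂ) / 2) := by
  have hL : ∀ x : ι → ℝ, L x = ∑ i, L (Pi.single i 1) * x i := by
    intro x
    conv_lhs => rw [← Finset.univ_sum_single x]
    rw [map_sum]
    refine Finset.sum_congr rfl fun i _ => ?_
    have : Pi.single i (x i) = x i • (Pi.single i (1 : ℝ) : ι → ℝ) := by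
      rw [← Pi.single_smul]; simp
    rw [this, map_smul, smul_eq_mul, mul_comm]
  rw [charFunDual_apply]
  have h1 : ∀ x : ι → ℝ, Complex.exp (L x * Complex.I)
      = ∏ i, Complex.exp ((L (Pi.single i 1) : ℝ) * (x i) * Complex.I) := by
    intro x
    rw [← Complex.exp_sum, hL x]
    push_cast
    rw [Finset.sum_mul]
  simp_rw [h1]
  rw [integral_fintype_prod_eq_prod
    (f := fun i (y : ℝ) => Complex.exp ((L (Pi.single i 1) : ℝ) * y * Complex.I))]
  have h2 : ∀ i, ∫ y : ℝ, Complex.exp ((L (Pi.single i 1) : ℝ) * y * Complex.I) ∂(gaussianReal 0 1)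
      = Complex.exp (-((L (Pi.single i 1) : ℝ) ^ 2 / 2 : ℂ)) := by
    intro i
    rw [← charFun_apply_real, charFun_gaussianReal]
    congr 1
    simp
  simp_rw [h2]
  rw [← Complex.exp_sum]
  congr 1
  push_cast
  rw [neg_div, Finset.sum_div, Finset.sum_neg_distrib]

instance isGaussian_gaussPi (ι : Type*) [Fintype ι] : IsGaussian (gaussPi ι) := by
  have h : HasGaussianLaw (fun x : ι → ℝ => fun i => x i) (gaussPi ι) := by
    refine iIndepFun.hasGaussianLaw (fun i => ?_) ?_
    · constructor
      rw [(measurePreserving_eval (fun _ : ι => gaussianReal 0 1) i).map_eq]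
      infer_instance
    · exact iIndepFun_pi (X := fun _ (x : ℝ) => x) (fun i => aemeasurable_id)
  have h2 := h.isGaussian_map
  have : (gaussPi ι).map (fun x : ι → ℝ => fun i => x i) = gaussPi ι := Measure.map_id
  rwa [this] at h2

variable {ι κ κ' : Type*} [Fintype ι] [Fintype κ] [Fintype κ']

theorem measurePreserving_mulVec_gaussPi [DecidableEq ι] (M : Matrix ι κ ℝ) (h : M * Mᵀ = 1) :
    MeasurePreserving (fun x => M *ᵥ x) (gaussPi κ) (gaussPi ι) := by
  classical
  have hc : Continuous fun x : κ → ℝ => M *ᵥ x := by fun_prop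
  refine ⟨hc.measurable, ?_⟩
  let f : (κ → ℝ) →L[ℝ] (ι → ℝ) := (Matrix.mulVecLin M).toContinuousLinearMap
  have hf : (fun x : κ → ℝ => M *ᵥ x) = f := by ext; rfl
  have : IsProbabilityMeasure ((gaussPi κ).map (fun x => M *ᵥ x)) :=
    Measure.isProbabilityMeasure_map hc.measurable.aemeasurable
  refine Measure.ext_of_charFunDual ?_
  ext L
  rw [hf, charFunDual_map, charFunDual_gaussPi, charFunDual_gaussPi]
  congr 4
  have hL : ∀ x : ι → ℝ, L x = ∑ i, L (Pi.single i 1) * x i := by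
    intro x
    conv_lhs => rw [← Finset.univ_sum_single x]
    rw [map_sum]
    refine Finset.sum_congr rfl fun i _ => ?_
    have : Pi.single i (x i) = x i • (Pi.single i (1 : ℝ) : ι → ℝ) := by
      rw [← Pi.single_smul]; simp
    rw [this, map_smul, smul_eq_mul, mul_comm]
  set l : ι → ℝ := fun i => L (Pi.single i 1) with hl
  have h1 : ∀ j, (L.comp f) (Pi.single j 1) = (l ᵥ* M) j := by
    intro j
    show L (M *ᵥ (Pi.single j 1)) = _
    rw [hL]
    simp [vecMul, dotProduct, hl]
  simp_rw [h1]
  have h2 : ∑ j, (l ᵥ* M) j ^ 2 = (l ᵥ* M) ⬝ᵥ (l ᵥ* M) := by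
    simp [dotProduct, sq]
  have h3 : ∑ i, l i ^ 2 = l ⬝ᵥ l := by
    simp [dotProduct, sq]
  rw [h2, h3, ← dotProduct_mulVec]
  congr 1
  rw [← mulVec_transpose, mulVec_mulVec, h, one_mulVec]

theorem measurePreserving_mulVec_add_gaussPi [DecidableEq ι] (M : Matrix ι κ ℝ)
    (N : Matrix ι κ' ℝ) (h : M * Mᵀ + N * Nᵀ = 1) :
    MeasurePreserving (fun p : (κ → ℝ) × (κ' → ℝ) => M *ᵥ p.1 + N *ᵥ p.2)
      ((gaussPi κ).prod (gaussPi κ')) (gaussPi ι) := by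
  have h1 := measurePreserving_mulVec_gaussPi (fromCols M N) (by
    rw [transpose_fromCols, fromCols_mul_fromRows, h])
  have h2 := measurePreserving_sumPiEquivProdPi_symm
    (X := fun _ : κ ⊕ κ' => ℝ) (fun _ => gaussianReal 0 1)
  have h3 := h1.comp h2
  convert h3 using 1
  ext p i
  simp only [Function.comp, Pi.add_apply, fromCols_mulVec]
  rfl

theorem _root_.MeasureTheory.MeasurePreserving.integral_comp_of_aestronglyMeasurable
    {α β E : Type*} {_ : MeasurableSpace α} {_ : MeasurableSpace β} [NormedAddCommGroup E]
    [NormedSpace ℝ E] {μ : Measure α} {ν : Measure β} {f : α → β} (hf : MeasurePreserving f μ ν)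
    {g : β → E} (hg : AEStronglyMeasurable g ν) : ∫ x, g (f x) ∂μ = ∫ y, g y ∂ν := by
  rw [← hf.map_eq, integral_map hf.measurable.aemeasurable (by rwa [hf.map_eq])]

end

theorem integrable_exp_quadratic_gaussianReal {p : ℝ} (q : ℝ) (hp : -1 / 2 < p) :
    Integrable (fun x => Real.exp (-p * x ^ 2 + q * x)) (gaussianReal 0 1) ∧
    ∫ x, Real.exp (-p * x ^ 2 + q * x) ∂(gaussianReal 0 1)
      = (Real.sqrt (1 + 2 * p))⁻¹ * Real.exp (q ^ 2 / (2 * (1 + 2 * p))) := by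
  have hs : 0 < 1 + 2 * p := by linarith
  set r := (1 + 2 * p) / 2 with hr
  have hr0 : 0 < r := by positivity
  have key : ∀ x : ℝ, gaussianPDFReal 0 1 x * Real.exp (-p * x ^ 2 + q * x)
      = ((Real.sqrt (2 * Real.pi))⁻¹ * Real.exp (q ^ 2 / (2 * (1 + 2 * p)))) *
        Real.exp (-r * (x - q / (1 + 2 * p)) ^ 2) := by
    intro x
    unfold gaussianPDFReal
    simp only [NNReal.coe_one, mul_one, sub_zero]
    rw [mul_assoc, mul_assoc, ← Real.exp_add, ← Real.exp_add]
    congr 2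
    rw [hr]
    field_simp
    ring
  have hInt := (integrable_exp_neg_mul_sq hr0).comp_sub_right (q / (1 + 2 * p))
  constructor
  · rw [gaussianReal_of_var_ne_zero 0 one_ne_zero, gaussianPDF_def,
      integrable_withDensity_iff_integrable_smul' (by fun_prop) (by simp)]
    have : (fun x => (ENNReal.ofReal (gaussianPDFReal 0 1 x)).toReal •
        Real.exp (-p * x ^ 2 + q * x)) = fun x =>
        ((Real.sqrt (2 * Real.pi))⁻¹ * Real.exp (q ^ 2 / (2 * (1 + 2 * p)))) *
          Real.exp (-r * (x - q / (1 + 2 * p)) ^ 2) := by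
      ext x
      rw [ENNReal.toReal_ofReal (gaussianPDFReal_nonneg _ _ _), smul_eq_mul, key]
    rw [this]
    exact hInt.const_mul _
  · rw [integral_gaussianReal_eq_integral_smul one_ne_zero]
    simp_rw [smul_eq_mul, key]
    rw [integral_const_mul, integral_sub_right_eq_self (fun x => Real.exp (-r * x ^ 2)),
      integral_gaussian]
    have : Real.sqrt (Real.pi / r) = Real.sqrt (2 * Real.pi) * (Real.sqrt (1 + 2 * p))⁻¹ := by
      rw [← Real.sqrt_inv, ← Real.sqrt_mul (by positivity)]
      congr 1
      rw [hr]; field_simp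
    rw [this]
    have : Real.sqrt (2 * Real.pi) ≠ 0 := by positivity
    field_simp

theorem inv_sqrt_one_sub_le_exp {u : ℝ} (hu : |u| ≤ 1 / 4) :
    (Real.sqrt (1 - 2 * u))⁻¹ * Real.exp (-u) ≤ Real.exp (4 * u ^ 2) := by
  have hu' := abs_le.mp hu
  have h0 : 0 < 1 - 2 * u := by linarith
  have h1 := Real.abs_log_sub_add_sum_range_le (x := 2 * u) (by
    rw [abs_lt]; constructor <;> linarith) 1
  simp only [Finset.sum_range_one] at h1
  have h2 : |2 * u| ^ (1 + 1) / (1 - |2 * u|) ≤ 8 * u ^ 2 := by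
    have : |2 * u| ≤ 1 / 2 := by rw [abs_mul, abs_two]; linarith
    rw [div_le_iff₀ (by linarith)]
    have h5 : |2 * u| ^ (1 + 1) = 4 * u ^ 2 := by rw [sq_abs]; ring
    rw [h5]
    nlinarith [sq_nonneg u]
  have h3 := (abs_le.mp (h1.trans h2)).1
  norm_num at h3
  have h4 : (Real.sqrt (1 - 2 * u))⁻¹ = Real.exp (-(Real.log (1 - 2 * u)) / 2) := by
    rw [← Real.sqrt_inv, Real.sqrt_eq_rpow, Real.rpow_def_of_pos (by positivity), Real.log_inv]
    congr 1; ring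
  rw [h4, ← Real.exp_add]
  apply Real.exp_le_exp.mpr
  linarith

theorem exists_orthogonal_diagonalization {ι : Type*} [Fintype ι] [DecidableEq ι]
    {B : Matrix ι ι ℝ} (hB : Bᵀ = B) :
    ∃ (O : Matrix ι ι ℝ) (l : ι → ℝ), O * Oᵀ = 1 ∧ Oᵀ * O = 1 ∧ B = O * diagonal l * Oᵀ := by
  have hH : B.IsHermitian := by
    rw [IsHermitian, conjTranspose_eq_transpose_of_trivial, hB]
  refine ⟨hH.eigenvectorUnitary, hH.eigenvalues, ?_, ?_, ?_⟩
  · have := (hH.eigenvectorUnitary).2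
    rw [mem_unitaryGroup_iff, star_eq_conjTranspose, conjTranspose_eq_transpose_of_trivial] at this
    exact this
  · have := (hH.eigenvectorUnitary).2
    rw [mem_unitaryGroup_iff', star_eq_conjTranspose, conjTranspose_eq_transpose_of_trivial] at this
    exact this
  · conv_lhs => rw [hH.spectral_theorem]
    rfl

section
theorem integral_pow_gaussianReal :
    (∫ x, x ∂(gaussianReal 0 1)) = 0 ∧ (∫ x, x ^ 2 ∂(gaussianReal 0 1)) = 1 ∧
    (∫ x, x ^ 3 ∂(gaussianReal 0 1)) = 0 ∧ (∫ x, x ^ 4 ∂(gaussianReal 0 1)) = 3 := by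
  have hm : mgf id (gaussianReal 0 1) = fun t => Real.exp (t ^ 2 / 2) := by
    rw [mgf_id_gaussianReal]; ext t; simp
  have h0 : (0 : ℝ) ∈ interior (integrableExpSet id (gaussianReal 0 1)) := by
    rw [integrableExpSet_id_gaussianReal]; simp
  have e : ∀ t : ℝ,
      HasDerivAt (fun t : ℝ => Real.exp (t ^ 2 / 2)) (t * Real.exp (t ^ 2 / 2)) t := by
    intro t
    have := ((hasDerivAt_pow 2 t).div_const 2).exp
    convert this using 1
    norm_num; ring
  have d1 : deriv (fun t : ℝ => Real.exp (t ^ 2 / 2)) = fun t => t * Real.exp (t ^ 2 / 2) :=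
    funext fun t => (e t).deriv
  have d2 : deriv (fun t : ℝ => t * Real.exp (t ^ 2 / 2))
      = fun t => (1 + t ^ 2) * Real.exp (t ^ 2 / 2) := by
    funext t
    have := ((hasDerivAt_id t).mul (e t)).deriv
    simp only [id] at this
    refine this.trans ?_
    ring
  have d3 : deriv (fun t : ℝ => (1 + t ^ 2) * Real.exp (t ^ 2 / 2))
      = fun t => (3 * t + t ^ 3) * Real.exp (t ^ 2 / 2) := by
    funext t
    have := (((hasDerivAt_pow 2 t).const_add 1).mul (e t)).deriv
    refine this.trans ?_
    norm_num; ring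
  have d4 : deriv (fun t : ℝ => (3 * t + t ^ 3) * Real.exp (t ^ 2 / 2))
      = fun t => (3 + 6 * t ^ 2 + t ^ 4) * Real.exp (t ^ 2 / 2) := by
    funext t
    have := ((((hasDerivAt_id t).const_mul 3).add (hasDerivAt_pow 3 t)).mul (e t)).deriv
    simp only [id] at this
    refine this.trans ?_
    norm_num; ring
  have key := fun n => iteratedDeriv_mgf_zero (X := id) (μ := gaussianReal 0 1) h0 n
  refine ⟨?_, ?_, ?_, ?_⟩
  · have := key 1
    simp [hm, iteratedDeriv_succ, d1] at this
    simp
  · have := key 2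
    simp [hm, iteratedDeriv_succ, d1, d2] at this
    exact this.symm
  · have := key 3
    simp [hm, iteratedDeriv_succ, d1, d2, d3] at this
    exact this.symm
  · have := key 4
    simp [hm, iteratedDeriv_succ, d1, d2, d3, d4] at this
    exact this.symm

theorem memLp_pow_gaussianReal (n : ℕ) : MemLp (fun x : ℝ => x ^ n) 2 (gaussianReal 0 1) := by
  refine (memLp_two_iff_integrable_sq (by fun_prop)).mpr ?_
  have h := (memLp_id_gaussianReal (μ := 0) (v := 1) (2 * n : ℕ)).integrable_norm_pow'
  refine (h.congr ?_)
  filter_upwards with x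
  simp only [id, Real.norm_eq_abs]
  rw [pow_mul, sq_abs, ← pow_mul, ← pow_mul, mul_comm]

theorem integrable_pow_gaussianReal (n : ℕ) :
    Integrable (fun x : ℝ => x ^ n) (gaussianReal 0 1) :=
  (memLp_pow_gaussianReal n).integrable one_le_two

theorem variance_quadratic_gaussianReal (l b : ℝ) :
    variance (fun x : ℝ => l * x ^ 2 + b * x) (gaussianReal 0 1) = 2 * l ^ 2 + b ^ 2 := by
  obtain ⟨m1, m2, m3, m4⟩ := integral_pow_gaussianReal
  have i1 : Integrable (fun x : ℝ => x) (gaussianReal 0 1) := by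
    simpa using integrable_pow_gaussianReal 1
  have i2 := integrable_pow_gaussianReal 2
  have i3 := integrable_pow_gaussianReal 3
  have i4 := integrable_pow_gaussianReal 4
  rw [variance_eq_integral (by fun_prop)]
  have hmean : ∫ x, l * x ^ 2 + b * x ∂(gaussianReal 0 1) = l := by
    rw [integral_add (i2.const_mul l) (i1.const_mul b), integral_const_mul, integral_const_mul,
      m1, m2]
    ring
  rw [hmean]
  have : ∀ x : ℝ, (l * x ^ 2 + b * x - l) ^ 2 = l ^ 2 * x ^ 4 + (2 * l * b) * x ^ 3
      + (b ^ 2 - 2 * l ^ 2) * x ^ 2 + (-(2 * l * b)) * x + l ^ 2 := fun x => by ring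
  simp_rw [this]
  have I4 := i4.const_mul (l ^ 2)
  have I3 := i3.const_mul (2 * l * b)
  have I2 := i2.const_mul (b ^ 2 - 2 * l ^ 2)
  have I1 := i1.const_mul (-(2 * l * b))
  rw [integral_add (by exact ((I4.add I3).add I2).add I1) (integrable_const _),
    integral_add (by exact (I4.add I3).add I2) I1, integral_add (by exact I4.add I3) I2,
    integral_add I4 I3, integral_const_mul, integral_const_mul, integral_const_mul,
    integral_const_mul, m1, m2, m3, m4]
  simp
  ring

variable {ι : Type*} [Fintype ι]

theorem variance_sum_quadratic_gaussPi (l b : ι → ℝ) :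
    variance (fun x : ι → ℝ => ∑ j, (l j * x j ^ 2 + b j * x j)) (gaussPi ι)
      = ∑ j, (2 * l j ^ 2 + b j ^ 2) := by
  have h := variance_sum_pi (μ := fun _ : ι => gaussianReal 0 1)
    (X := fun j (x : ℝ) => l j * x ^ 2 + b j * x) (fun j => by
      have h1 := (memLp_pow_gaussianReal 2).const_mul (l j)
      have h2 := (memLp_pow_gaussianReal 1).const_mul (b j)
      simp only [pow_one] at h2
      exact h1.add h2)
  simp_rw [variance_quadratic_gaussianReal] at h
  rw [← h]
  congr 1
  ext x
  simp

theorem integral_exp_quadratic_gaussPi {p : ι → ℝ} (q : ι → ℝ) (hp : ∀ j, -1 / 2 < p j) :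
    Integrable (fun x : ι → ℝ => Real.exp (∑ j, (-p j * x j ^ 2 + q j * x j))) (gaussPi ι) ∧
    ∫ x : ι → ℝ, Real.exp (∑ j, (-p j * x j ^ 2 + q j * x j)) ∂(gaussPi ι)
      = ∏ j, ((Real.sqrt (1 + 2 * p j))⁻¹ * Real.exp (q j ^ 2 / (2 * (1 + 2 * p j)))) := by
  have h : (fun x : ι → ℝ => Real.exp (∑ j, (-p j * x j ^ 2 + q j * x j)))
      = fun x => ∏ j, Real.exp (-p j * x j ^ 2 + q j * x j) := by
    ext x; rw [Real.exp_sum]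
  rw [h]
  constructor
  · exact Integrable.fintype_prod (f := fun j (y : ℝ) => Real.exp (-p j * y ^ 2 + q j * y))
      (fun j => (integrable_exp_quadratic_gaussianReal (q j) (hp j)).1)
  · rw [integral_fintype_prod_eq_prod (f := fun j (y : ℝ) => Real.exp (-p j * y ^ 2 + q j * y))]
    exact Finset.prod_congr rfl fun j _ => (integrable_exp_quadratic_gaussianReal (q j) (hp j)).2

end

section
variable {ι : Type*} [Fintype ι]

/-- Squared Frobenius norm. -/
noncomputable def frobSq (B : Matrix ι ι ℝ) : ℝ := ∑ i, ∑ j, B i j ^ 2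

/-- The operator norm of `B` is at most `a`. -/
def OpLE (B : Matrix ι ι ℝ) (a : ℝ) : Prop :=
  ∀ x, (B *ᵥ x) ⬝ᵥ (B *ᵥ x) ≤ a ^ 2 * (x ⬝ᵥ x)

/-- The centred quadratic form of `B`. -/
noncomputable def chaos (B : Matrix ι ι ℝ) (x : ι → ℝ) : ℝ := x ⬝ᵥ B *ᵥ x - B.trace

@[fun_prop]
theorem continuous_chaos (B : Matrix ι ι ℝ) : Continuous (chaos B) := by
  unfold chaos; fun_prop

theorem frobSq_nonneg (B : Matrix ι ι ℝ) : 0 ≤ frobSq B :=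
  Finset.sum_nonneg fun _ _ => Finset.sum_nonneg fun _ _ => sq_nonneg _

theorem frobSq_eq_trace (B : Matrix ι ι ℝ) : frobSq B = (B * Bᵀ).trace := by
  simp [frobSq, trace, Matrix.mul_apply, sq]

theorem dotProduct_mulVec_eq_transpose {κ : Type*} [Fintype κ] (M : Matrix ι κ ℝ) (x : ι → ℝ)
    (y : κ → ℝ) : x ⬝ᵥ M *ᵥ y = (Mᵀ *ᵥ x) ⬝ᵥ y := by
  rw [dotProduct_mulVec, mulVec_transpose]

theorem OpLE_of_frobSq_le {B : Matrix ι ι ℝ} {a : ℝ} (h : frobSq B ≤ a ^ 2) : OpLE B a := by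
  intro x
  have h1 : (B *ᵥ x) ⬝ᵥ (B *ᵥ x) ≤ frobSq B * (x ⬝ᵥ x) := by
    simp only [dotProduct, frobSq, mulVec, ← sq]
    rw [Finset.sum_mul]
    exact Finset.sum_le_sum fun i _ => Finset.sum_mul_sq_le_sq_mul_sq _ _ _
  have h2 : 0 ≤ x ⬝ᵥ x := by simpa using dotProduct_star_self_nonneg x
  nlinarith

section Diag

variable [DecidableEq ι] {O : Matrix ι ι ℝ} {l : ι → ℝ}

theorem dotProduct_diagonalized (O : Matrix ι ι ℝ) (l x : ι → ℝ) :
    x ⬝ᵥ (O * diagonal l * Oᵀ) *ᵥ x = ∑ j, l j * (Oᵀ *ᵥ x) j ^ 2 := by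
  rw [← mulVec_mulVec, ← mulVec_mulVec, dotProduct_mulVec_eq_transpose]
  simp only [dotProduct, mulVec_diagonal]
  exact Finset.sum_congr rfl fun j _ => by ring

theorem dotProduct_mulVec_orthogonal (h : Oᵀ * O = 1) (x y : ι → ℝ) :
    (O *ᵥ x) ⬝ᵥ (O *ᵥ y) = x ⬝ᵥ y := by
  rw [dotProduct_mulVec_eq_transpose, mulVec_mulVec, h, one_mulVec]

theorem trace_diagonalized (h : Oᵀ * O = 1) : (O * diagonal l * Oᵀ).trace = ∑ j, l j := by
  rw [trace_mul_comm, ← Matrix.mul_assoc, h, Matrix.one_mul, trace_diagonal]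

theorem frobSq_diagonalized (h : Oᵀ * O = 1) :
    frobSq (O * diagonal l * Oᵀ) = ∑ j, l j ^ 2 := by
  rw [frobSq_eq_trace]
  have : (O * diagonal l * Oᵀ) * (O * diagonal l * Oᵀ)ᵀ
      = O * diagonal (fun j => l j ^ 2) * Oᵀ := by
    rw [transpose_mul, transpose_mul, transpose_transpose, diagonal_transpose]
    calc O * diagonal l * Oᵀ * (O * (diagonal l * Oᵀ))
        = O * diagonal l * (Oᵀ * O) * (diagonal l * Oᵀ) := by simp only [Matrix.mul_assoc]
      _ = O * (diagonal l * diagonal l) * Oᵀ := by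
          rw [h, Matrix.mul_one]; simp only [Matrix.mul_assoc]
      _ = _ := by rw [diagonal_mul_diagonal]; simp only [sq]
  rw [this, trace_diagonalized h]

theorem abs_le_of_OpLE_diagonalized (h : Oᵀ * O = 1) {a : ℝ} (ha : 0 ≤ a)
    (hop : OpLE (O * diagonal l * Oᵀ) a) (j : ι) : |l j| ≤ a := by
  have h1 := hop (O *ᵥ Pi.single j 1)
  have h2 : (O * diagonal l * Oᵀ) *ᵥ (O *ᵥ Pi.single j 1) = O *ᵥ (diagonal l *ᵥ Pi.single j 1) := by
    rw [mulVec_mulVec, Matrix.mul_assoc, h, Matrix.mul_one, ← mulVec_mulVec]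
  rw [h2, dotProduct_mulVec_orthogonal h, dotProduct_mulVec_orthogonal h] at h1
  simp only [mulVec_single_one, dotProduct_single_one, Pi.single_eq_same] at h1
  have h3 : (diagonal l).col j ⬝ᵥ (diagonal l).col j = l j ^ 2 := by
    rw [dotProduct, Finset.sum_eq_single j]
    · simp [sq]
    · intro b _ hb; simp [diagonal_apply_ne _ hb]
    · simp
  rw [h3] at h1
  exact abs_le_of_sq_le_sq (by linarith) ha

end Diag

theorem chaos_mgf {B : Matrix ι ι ℝ} (hB : Bᵀ = B) {t a : ℝ} (ha : 0 ≤ a) (hop : OpLE B a)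
    (hta : |t| * a ≤ 1 / 4) :
    Integrable (fun x => Real.exp (t * chaos B x)) (gaussPi ι) ∧
    ∫ x, Real.exp (t * chaos B x) ∂(gaussPi ι) ≤ Real.exp (4 * t ^ 2 * frobSq B) := by
  classical
  obtain ⟨O, l, h1, h2, rfl⟩ := exists_orthogonal_diagonalization hB
  have hl := abs_le_of_OpLE_diagonalized h2 ha hop
  have hu : ∀ j, |t * l j| ≤ 1 / 4 := fun j => by
    rw [abs_mul]; exact (mul_le_mul_of_nonneg_left (hl j) (abs_nonneg _)).trans hta
  have hmp := measurePreserving_mulVec_gaussPi Oᵀ (by rw [transpose_transpose, h2])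
  have hf : (fun x => Real.exp (t * chaos (O * diagonal l * Oᵀ) x)) = fun x =>
      (fun z : ι → ℝ => Real.exp (-(∑ j, t * l j)) *
        Real.exp (∑ j, (-(-(t * l j)) * z j ^ 2 + 0 * z j))) (Oᵀ *ᵥ x) := by
    ext x
    simp only [chaos]
    rw [dotProduct_diagonalized, trace_diagonalized h2, ← Real.exp_add]
    congr 1
    rw [mul_sub, Finset.mul_sum, Finset.mul_sum]
    simp only [neg_neg, zero_mul, add_zero, mul_assoc]
    ring
  have hI := integral_exp_quadratic_gaussPi (p := fun j => -(t * l j)) (fun _ => 0)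
    (fun j => by have := abs_le.mp (hu j); linarith)
  rw [hf]
  constructor
  · exact (hmp.integrable_comp (by fun_prop)).mpr (hI.1.const_mul _)
  · rw [hmp.integral_comp_of_aestronglyMeasurable (g := fun z : ι → ℝ =>
      Real.exp (-(∑ j, t * l j)) * Real.exp (∑ j, (-(-(t * l j)) * z j ^ 2 + 0 * z j)))
      (by fun_prop), integral_const_mul, hI.2, ← Finset.sum_neg_distrib, Real.exp_sum,
      ← Finset.prod_mul_distrib,
      frobSq_diagonalized h2, Finset.mul_sum, Real.exp_sum]
    refine Finset.prod_le_prod (fun j _ => by positivity) fun j _ => ?_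
    have := inv_sqrt_one_sub_le_exp (hu j)
    simp only [mul_neg, zero_pow two_ne_zero, zero_div, Real.exp_zero, mul_one, ← sub_eq_add_neg]
    rw [mul_comm]
    refine this.trans (le_of_eq ?_)
    ring_nf

theorem chaos_tail {B : Matrix ι ι ℝ} (hB : Bᵀ = B) {t a X F : ℝ} (ha : 0 ≤ a) (hop : OpLE B a)
    (ht : 0 ≤ t) (hta : t * a ≤ 1 / 4) (hF : frobSq B ≤ F) :
    (gaussPi ι).real {x | X ≤ |chaos B x|} ≤ 2 * Real.exp (4 * t ^ 2 * F - t * X) := by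
  have key : ∀ s : ℝ, s ^ 2 = t ^ 2 → |s| = t →
      (gaussPi ι).real {x | t * X ≤ s * chaos B x} ≤ Real.exp (4 * t ^ 2 * F - t * X) := by
    intro s hs hs'
    have h := chaos_mgf hB (t := s) ha hop (by rw [hs']; exact hta)
    have h3 : ∫ x, Real.exp (s * chaos B x) ∂(gaussPi ι) ≤ Real.exp (4 * t ^ 2 * F) := by
      refine h.2.trans (Real.exp_le_exp.mpr ?_)
      rw [hs]
      exact mul_le_mul_of_nonneg_left hF (by positivity)
    have h2 := mul_meas_ge_le_integral_of_nonneg (μ := gaussPi ι)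
      (Filter.Eventually.of_forall fun x => (Real.exp_pos (s * chaos B x)).le) h.1
      (Real.exp (t * X))
    have h4 : {x | Real.exp (t * X) ≤ Real.exp (s * chaos B x)} = {x | t * X ≤ s * chaos B x} := by
      ext x; simp
    rw [h4] at h2
    rw [Real.exp_sub, le_div_iff₀ (Real.exp_pos _), mul_comm]
    exact h2.trans h3
  have hsub : {x | X ≤ |chaos B x|} ⊆
      {x | t * X ≤ t * chaos B x} ∪ {x | t * X ≤ -t * chaos B x} := by
    intro x hx
    simp only [Set.mem_ofPred_eq, le_abs, Set.mem_union] at hx ⊢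
    rcases hx with hx | hx
    · exact Or.inl (mul_le_mul_of_nonneg_left hx ht)
    · right; nlinarith [mul_le_mul_of_nonneg_left hx ht]
  refine (measureReal_mono hsub).trans ((measureReal_union_le _ _).trans ?_)
  rw [two_mul]
  exact add_le_add (key t rfl (abs_of_nonneg ht))
    (key (-t) (by ring) (by rw [abs_neg, abs_of_nonneg ht]))

theorem chaos_pow_four {B : Matrix ι ι ℝ} (hB : Bᵀ = B) {F : ℝ} (hF : 0 < F)
    (h : frobSq B ≤ F ^ 2) :
    Integrable (fun x => chaos B x ^ 4) (gaussPi ι) ∧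
    ∫ x, chaos B x ^ 4 ∂(gaussPi ι) ≤ 2 ^ 14 * F ^ 4 := by
  have hop := OpLE_of_frobSq_le h
  set t := 1 / (4 * F) with ht
  have ht0 : 0 < t := by positivity
  have htF : t * F = 1 / 4 := by rw [ht]; field_simp
  have e1 := chaos_mgf hB (t := t) hF.le hop (by rw [abs_of_pos ht0, htF])
  have e2 := chaos_mgf hB (t := -t) hF.le hop (by rw [abs_neg, abs_of_pos ht0, htF])
  have hpt : ∀ y : ℝ, y ^ 4 ≤ 24 * (Real.exp y + Real.exp (-y)) := by
    intro y
    have h1 : ∀ z : ℝ, 0 ≤ z → z ^ 4 ≤ 24 * Real.exp z := by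
      intro z hz
      have := Real.pow_div_factorial_le_exp z hz 4
      norm_num [Nat.factorial] at this
      linarith
    rcases le_total 0 y with hy | hy
    · have := h1 y hy; have := Real.exp_pos (-y); linarith
    · have := h1 (-y) (by linarith); have := Real.exp_pos y
      have h3 : (-y) ^ 4 = y ^ 4 := by ring
      linarith
  have hdom : ∀ x, chaos B x ^ 4 ≤ 24 / t ^ 4 *
      (Real.exp (t * chaos B x) + Real.exp (-t * chaos B x)) := by
    intro x
    have := hpt (t * chaos B x)
    rw [mul_pow] at this
    rw [div_mul_eq_mul_div, le_div_iff₀ (by positivity), neg_mul]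
    linarith
  have hdi := (e1.1.add e2.1).const_mul (24 / t ^ 4)
  have hInt : Integrable (fun x => chaos B x ^ 4) (gaussPi ι) := by
    refine hdi.mono' (by fun_prop) (Filter.Eventually.of_forall fun x => ?_)
    rw [Real.norm_of_nonneg (by positivity)]
    exact hdom x
  refine ⟨hInt, (integral_mono hInt hdi hdom).trans ?_⟩
  have hb : Real.exp (4 * t ^ 2 * frobSq B) ≤ 4 / 3 := by
    have h5 : 4 * t ^ 2 * frobSq B ≤ 1 / 4 := by
      calc 4 * t ^ 2 * frobSq B ≤ 4 * t ^ 2 * F ^ 2 := by gcongr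
        _ = 4 * (t * F) ^ 2 := by ring
        _ = 1 / 4 := by rw [htF]; norm_num
    have := Real.one_sub_le_exp_neg (4 * t ^ 2 * frobSq B)
    rw [Real.exp_neg] at this
    have h6 := Real.exp_pos (4 * t ^ 2 * frobSq B)
    have h7 : (3 / 4 : ℝ) ≤ (Real.exp (4 * t ^ 2 * frobSq B))⁻¹ := by linarith
    rw [le_inv_comm₀ (by norm_num) h6] at h7
    linarith
  have e2' := e2.2
  rw [neg_sq] at e2'
  rw [integral_const_mul]
  simp only [Pi.add_apply]
  rw [integral_add e1.1 e2.1]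
  have h8 : 24 / t ^ 4 = 6144 * F ^ 4 := by rw [ht]; field_simp; norm_num
  rw [h8]
  have hF4 : 0 < F ^ 4 := by positivity
  nlinarith [e1.2]

end

section
variable {ι : Type*} [Fintype ι]

/-- The quadratic polynomial with matrix `A`, linear part `b` and constant `c`. -/
noncomputable def qf (A : Matrix ι ι ℝ) (b : ι → ℝ) (c : ℝ) (x : ι → ℝ) : ℝ :=
  x ⬝ᵥ A *ᵥ x + b ⬝ᵥ x + c

@[fun_prop]
theorem continuous_qf (A : Matrix ι ι ℝ) (b : ι → ℝ) (c : ℝ) : Continuous (qf A b c) := by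
  unfold qf; fun_prop

theorem dotProduct_self_nonneg' (x : ι → ℝ) : 0 ≤ x ⬝ᵥ x := by
  simpa using dotProduct_star_self_nonneg x

theorem variance_qf {A : Matrix ι ι ℝ} (hA : Aᵀ = A) (b : ι → ℝ) (c : ℝ) :
    variance (qf A b c) (gaussPi ι) = 2 * frobSq A + b ⬝ᵥ b := by
  classical
  obtain ⟨O, l, h1, h2, rfl⟩ := exists_orthogonal_diagonalization hA
  have hmp := measurePreserving_mulVec_gaussPi Oᵀ (by rw [transpose_transpose, h2])
  have hb : ∀ x y : ι → ℝ, x ⬝ᵥ y = (Oᵀ *ᵥ x) ⬝ᵥ (Oᵀ *ᵥ y) := fun x y =>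
    (dotProduct_mulVec_orthogonal (by rw [transpose_transpose, h1]) x y).symm
  have hq : qf (O * diagonal l * Oᵀ) b c = fun x =>
      ((fun z : ι → ℝ => ∑ j, (l j * z j ^ 2 + (Oᵀ *ᵥ b) j * z j)) ∘ fun x => Oᵀ *ᵥ x) x + c := by
    ext x
    rw [qf, dotProduct_diagonalized, hb b x, Function.comp, Finset.sum_add_distrib]
    rfl
  rw [hq, variance_add_const (by
    refine Continuous.aestronglyMeasurable ?_
    refine Continuous.comp ?_ ?_ <;> fun_prop), ← variance_map (by fun_prop) (by fun_prop),
    hmp.map_eq, variance_sum_quadratic_gaussPi, Finset.sum_add_distrib, ← Finset.mul_sum,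
    frobSq_diagonalized h2, hb b b]
  simp only [dotProduct, sq]

theorem one_add_sum_le_prod_one_add {α : Type*} (s : Finset α) {f : α → ℝ}
    (hf : ∀ j ∈ s, 0 ≤ f j) : 1 + ∑ j ∈ s, f j ≤ ∏ j ∈ s, (1 + f j) := by
  classical
  induction s using Finset.induction_on with
  | empty => simp
  | insert a s ha ih =>
    rw [Finset.sum_insert ha, Finset.prod_insert ha]
    have h1 := ih fun j hj => hf j (Finset.mem_insert_of_mem hj)
    have h2 := hf a (Finset.mem_insert_self a s)
    have h3 : 0 ≤ ∑ j ∈ s, f j := Finset.sum_nonneg fun j hj => hf j (Finset.mem_insert_of_mem hj)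
    nlinarith

theorem inv_sqrt_prod_le {h : ι → ℝ} {t : ℝ} (ht : 0 ≤ t) (hh : ∀ j, 0 ≤ h j) :
    ∏ j, (Real.sqrt (1 + 2 * (t * h j)))⁻¹ = (Real.sqrt (∏ j, (1 + 2 * (t * h j))))⁻¹ := by
  rw [Real.sqrt_prod _ (fun j _ => by have := mul_nonneg ht (hh j); linarith),
    Finset.prod_inv_distrib]

theorem quadForm_smallBall [DecidableEq ι] {O : Matrix ι ι ℝ} {h : ι → ℝ} (h2 : Oᵀ * O = 1)
    (hh : ∀ j, 0 ≤ h j) {t : ℝ} (ht : 0 ≤ t) (u : ℝ) :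
    (gaussPi ι).real {x | x ⬝ᵥ (O * diagonal h * Oᵀ) *ᵥ x ≤ u}
      ≤ Real.exp (t * u) * (Real.sqrt (∏ j, (1 + 2 * (t * h j))))⁻¹ := by
  have hmp := measurePreserving_mulVec_gaussPi Oᵀ (by rw [transpose_transpose, h2])
  have hI := integral_exp_quadratic_gaussPi (p := fun j => t * h j) (fun _ => 0)
    (fun j => by have := mul_nonneg ht (hh j); linarith)
  have hset : {x : ι → ℝ | x ⬝ᵥ (O * diagonal h * Oᵀ) *ᵥ x ≤ u} =
      (fun x => Oᵀ *ᵥ x) ⁻¹' {z | ∑ j, h j * z j ^ 2 ≤ u} := by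
    ext x; simp [dotProduct_diagonalized]
  rw [hset, hmp.measureReal_preimage (by
    exact (measurableSet_le (by fun_prop) measurable_const).nullMeasurableSet)]
  have hm := mul_meas_ge_le_integral_of_nonneg (μ := gaussPi ι)
      (Filter.Eventually.of_forall fun x => (Real.exp_pos _).le) hI.1 (Real.exp (-(t * u)))
  rw [hI.2] at hm
  have hsub : {z : ι → ℝ | ∑ j, h j * z j ^ 2 ≤ u} ⊆ {x | Real.exp (-(t * u)) ≤
      Real.exp (∑ j, (-(t * h j) * x j ^ 2 + 0 * x j))} := by
    intro z hz
    simp only [Set.mem_ofPred_eq, Real.exp_le_exp] at hz ⊢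
    have := mul_le_mul_of_nonneg_left hz ht
    rw [Finset.mul_sum] at this
    simp only [zero_mul, add_zero, neg_mul, Finset.sum_neg_distrib, mul_assoc]
    linarith
  refine (measureReal_mono hsub).trans ?_
  rw [← inv_sqrt_prod_le ht hh]
  rw [← le_div_iff₀' (Real.exp_pos _), div_eq_inv_mul, ← Real.exp_neg, neg_neg] at hm
  simpa only [zero_pow two_ne_zero, zero_div, Real.exp_zero, mul_one] using hm

theorem gradient_smallBall {A : Matrix ι ι ℝ} (hA : Aᵀ = A) {b : ι → ℝ}
    (hvar : 2 * frobSq A + b ⬝ᵥ b = 1) {s : ℝ} (hs : 0 < s) :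
    (gaussPi ι).real {x | ((2 : ℝ) • A *ᵥ x + b) ⬝ᵥ ((2 : ℝ) • A *ᵥ x + b) ≤ s ^ 4} ≤ 6 * s := by
  classical
  rcases le_or_gt 1 s with hs1 | hs1
  · exact measureReal_le_one.trans (by linarith)
  obtain ⟨O, l, h1, h2, rfl⟩ := exists_orthogonal_diagonalization hA
  have hmp := measurePreserving_mulVec_gaussPi Oᵀ (by rw [transpose_transpose, h2])
  have hb : ∀ x y : ι → ℝ, x ⬝ᵥ y = (Oᵀ *ᵥ x) ⬝ᵥ (Oᵀ *ᵥ y) := fun x y =>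
    (dotProduct_mulVec_orthogonal (by rw [transpose_transpose, h1]) x y).symm
  set t := (s ^ 4)⁻¹ with ht
  have ht0 : 0 < t := by positivity
  set β := Oᵀ *ᵥ b with hβ
  have hp : ∀ j, 0 ≤ 4 * t * l j ^ 2 := fun j => by positivity
  have hI := integral_exp_quadratic_gaussPi (p := fun j => 4 * t * l j ^ 2)
    (fun j => -(4 * t * l j * β j)) (fun j => by have := hp j; linarith)
  have hset : {x : ι → ℝ | ((2 : ℝ) • (O * diagonal l * Oᵀ) *ᵥ x + b) ⬝ᵥ
      ((2 : ℝ) • (O * diagonal l * Oᵀ) *ᵥ x + b) ≤ s ^ 4} =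
      (fun x => Oᵀ *ᵥ x) ⁻¹' {z | ∑ j, (2 * (l j * z j) + β j) ^ 2 ≤ s ^ 4} := by
    ext x
    simp only [Set.mem_ofPred_eq, Set.preimage_ofPred_eq]
    rw [hb]
    have : Oᵀ *ᵥ ((2 : ℝ) • (O * diagonal l * Oᵀ) *ᵥ x + b)
        = fun j => 2 * (l j * (Oᵀ *ᵥ x) j) + β j := by
      rw [mulVec_add, mulVec_smul, mulVec_mulVec, ← Matrix.mul_assoc, ← Matrix.mul_assoc, h2,
        Matrix.one_mul, ← mulVec_mulVec]
      ext j
      simp only [Pi.add_apply, Pi.smul_apply, smul_eq_mul, mulVec_diagonal, hβ]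
    rw [this]
    simp only [dotProduct, sq]
  rw [hset, hmp.measureReal_preimage (by
    exact (measurableSet_le (by fun_prop) measurable_const).nullMeasurableSet)]
  have hm := mul_meas_ge_le_integral_of_nonneg (μ := gaussPi ι)
      (Filter.Eventually.of_forall fun x => (Real.exp_pos _).le) hI.1
      (Real.exp (-1 + t * ∑ j, β j ^ 2))
  rw [hI.2] at hm
  have hsub : {z : ι → ℝ | ∑ j, (2 * (l j * z j) + β j) ^ 2 ≤ s ^ 4} ⊆
      {x | Real.exp (-1 + t * ∑ j, β j ^ 2) ≤
      Real.exp (∑ j, (-(4 * t * l j ^ 2) * x j ^ 2 + -(4 * t * l j * β j) * x j))} := by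
    intro z hz
    simp only [Set.mem_ofPred_eq, Real.exp_le_exp] at hz ⊢
    have h3 := mul_le_mul_of_nonneg_left hz ht0.le
    have h4 : t * s ^ 4 = 1 := by rw [ht]; field_simp
    have h5 : t * ∑ j, (2 * (l j * z j) + β j) ^ 2 = -(∑ j, (-(4 * t * l j ^ 2) * z j ^ 2
        + -(4 * t * l j * β j) * z j)) + t * ∑ j, β j ^ 2 := by
      rw [Finset.mul_sum, Finset.mul_sum, ← Finset.sum_neg_distrib, ← Finset.sum_add_distrib]
      exact Finset.sum_congr rfl fun j _ => by ring
    linarith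
  refine (measureReal_mono hsub).trans ?_
  set Y := 1 + 8 * t * ∑ j, l j ^ 2 with hY
  have hl2 : 0 ≤ ∑ j, l j ^ 2 := Finset.sum_nonneg fun j _ => sq_nonneg _
  have hY1 : 1 ≤ Y := by rw [hY]; have : 0 ≤ 8 * t * ∑ j, l j ^ 2 := by positivity
                         linarith
  rw [← le_div_iff₀' (Real.exp_pos _)] at hm
  have hE : Real.exp (-1 + t * ∑ j, β j ^ 2)
      = (Real.exp 1)⁻¹ * Real.exp (t * ∑ j, β j ^ 2) := by
    rw [Real.exp_add, Real.exp_neg]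
  have hprod : (∏ j, ((Real.sqrt (1 + 2 * (4 * t * l j ^ 2)))⁻¹ *
      Real.exp ((-(4 * t * l j * β j)) ^ 2 / (2 * (1 + 2 * (4 * t * l j ^ 2)))))) /
      Real.exp (t * ∑ j, β j ^ 2) ≤ (Real.sqrt Y)⁻¹ * Real.exp (-(t * (b ⬝ᵥ b) / Y)) := by
    rw [Finset.prod_mul_distrib, ← Real.exp_sum, mul_div_assoc, ← Real.exp_sub]
    refine mul_le_mul ?_ ?_ (Real.exp_pos _).le (by positivity)
    · rw [Finset.prod_inv_distrib, ← Real.sqrt_prod _ (fun j _ => by have := hp j; linarith)]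
      refine inv_anti₀ (by positivity) (Real.sqrt_le_sqrt ?_)
      have := one_add_sum_le_prod_one_add Finset.univ
        (f := fun j => 2 * (4 * t * l j ^ 2)) (fun j _ => by positivity)
      refine le_trans (le_of_eq ?_) this
      rw [hY, Finset.mul_sum]
      congr 1
      exact Finset.sum_congr rfl fun j _ => by ring
    · rw [Real.exp_le_exp, hb b b, ← hβ, dotProduct, Finset.mul_sum, Finset.mul_sum, Finset.sum_div,
        ← Finset.sum_sub_distrib, ← Finset.sum_neg_distrib]
      refine Finset.sum_le_sum fun j _ => ?_
      have hj : 1 + 8 * t * l j ^ 2 ≤ Y := by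
        rw [hY]
        have := Finset.single_le_sum (f := fun j => l j ^ 2) (fun j _ => sq_nonneg _)
          (Finset.mem_univ j)
        have := mul_le_mul_of_nonneg_left this (show 0 ≤ 8 * t by positivity)
        linarith
      have hj0 : 0 < 1 + 8 * t * l j ^ 2 := by positivity
      have e : (-(4 * t * l j * β j)) ^ 2 / (2 * (1 + 2 * (4 * t * l j ^ 2))) - t * β j ^ 2
          = -(t * β j ^ 2 / (1 + 8 * t * l j ^ 2)) := by
        have : 1 + 2 * (4 * t * l j ^ 2) = 1 + 8 * t * l j ^ 2 := by ring
        rw [this]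
        field_simp
        ring
      rw [e, neg_le_neg_iff, ← sq]
      exact div_le_div_of_nonneg_left (by positivity) hj0 hj
  have hexp1 : Real.exp 1 < 3 := Real.exp_one_lt_three
  have hfin : (Real.sqrt Y)⁻¹ * Real.exp (-(t * (b ⬝ᵥ b) / Y)) ≤ 2 * s := by
    have hbb := dotProduct_self_nonneg' b
    rw [frobSq_diagonalized h2] at hvar
    have hts : ∀ y, (s ^ 2)⁻¹ ≤ y → (Real.sqrt y)⁻¹ ≤ s := by
      intro y hy
      rw [inv_le_comm₀ (Real.sqrt_pos.mpr (lt_of_lt_of_le (by positivity) hy)) hs]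
      refine Real.le_sqrt_of_sq_le ?_
      rwa [inv_pow]
    have hs2 : s ^ 2 ≤ 1 := by nlinarith
    rcases le_or_gt (s ^ 2)⁻¹ Y with h6 | h6
    · have h7 := hts Y h6
      have h8 : Real.exp (-(t * (b ⬝ᵥ b) / Y)) ≤ 1 := by
        rw [Real.exp_le_one_iff, neg_nonpos]; positivity
      calc _ ≤ s * 1 := mul_le_mul h7 h8 (Real.exp_pos _).le hs.le
        _ ≤ 2 * s := by linarith
    · have ht2 : t = (s ^ 2)⁻¹ * (s ^ 2)⁻¹ := by rw [ht]; field_simp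
      have h9 : 1 ≤ (s ^ 2)⁻¹ := (one_le_inv₀ (by positivity)).mpr hs2
      have h10 : ∑ j, l j ^ 2 < 1 / 4 := by
        by_contra hcon
        push Not at hcon
        have : 2 * t ≤ Y := by rw [hY]; nlinarith
        rw [ht2] at this
        nlinarith
      have h11 : 1 / 2 ≤ b ⬝ᵥ b := by linarith
      have h12 : (s ^ 2)⁻¹ / 2 ≤ t * (b ⬝ᵥ b) / Y := by
        rw [le_div_iff₀ (by linarith)]
        calc (s ^ 2)⁻¹ / 2 * Y ≤ (s ^ 2)⁻¹ / 2 * (s ^ 2)⁻¹ := by gcongr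
          _ = t * (1 / 2) := by rw [ht2]; ring
          _ ≤ t * (b ⬝ᵥ b) := by gcongr
      have h13 : Real.exp (-(t * (b ⬝ᵥ b) / Y)) ≤ 2 * s ^ 2 := by
        rw [Real.exp_neg, inv_le_comm₀ (Real.exp_pos _) (by positivity)]
        have := Real.add_one_le_exp (t * (b ⬝ᵥ b) / Y)
        have e : (2 * s ^ 2)⁻¹ = (s ^ 2)⁻¹ / 2 := by field_simp
        rw [e]; linarith
      have h14 : (Real.sqrt Y)⁻¹ ≤ 1 := inv_le_one_of_one_le₀ (Real.one_le_sqrt.mpr hY1)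
      calc _ ≤ 1 * (2 * s ^ 2) := mul_le_mul h14 h13 (Real.exp_pos _).le zero_le_one
        _ ≤ 2 * s := by nlinarith
  refine hm.trans ?_
  rw [hE, mul_comm (Real.exp 1)⁻¹, ← div_div, div_inv_eq_mul, mul_comm]
  calc _ ≤ Real.exp 1 * (2 * s) := mul_le_mul_of_nonneg_left (hprod.trans hfin) (Real.exp_pos _).le
    _ ≤ 6 * s := by nlinarith

end

section
variable {ι : Type*} [Fintype ι]

theorem integrable_one_add_norm_pow (N : ℕ) :
    Integrable (fun x : ι → ℝ => (1 + ‖x‖) ^ N) (gaussPi ι) := by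
  have h0 : MemLp (fun _ : ι → ℝ => (1 : ℝ)) N (gaussPi ι) := memLp_const 1
  have hn : MemLp (fun x : ι → ℝ => ‖x‖) N (gaussPi ι) :=
    (IsGaussian.memLp_id (gaussPi ι) N (by simp)).norm
  have h1 : MemLp (fun x : ι → ℝ => 1 + ‖x‖) N (gaussPi ι) := h0.add hn
  refine h1.integrable_norm_pow'.congr (Filter.Eventually.of_forall fun x => ?_)
  simp only [Real.norm_eq_abs]
  rw [abs_of_nonneg (by positivity)]

theorem integrable_of_le_one_add_norm_pow {f : (ι → ℝ) → ℝ} (hf : Continuous f) {C : ℝ} {N : ℕ}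
    (h : ∀ x, |f x| ≤ C * (1 + ‖x‖) ^ N) : Integrable f (gaussPi ι) :=
  ((integrable_one_add_norm_pow N).const_mul C).mono' hf.aestronglyMeasurable
    (Filter.Eventually.of_forall h)

theorem exists_mulVec_norm_le {κ : Type*} [Fintype κ] (M : Matrix ι κ ℝ) :
    ∃ C : ℝ, 0 ≤ C ∧ ∀ x, ‖M *ᵥ x‖ ≤ C * ‖x‖ :=
  ⟨‖(Matrix.mulVecLin M).toContinuousLinearMap‖, norm_nonneg _,
    fun x => (Matrix.mulVecLin M).toContinuousLinearMap.le_opNorm x⟩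

theorem abs_dotProduct_le (x y : ι → ℝ) : |x ⬝ᵥ y| ≤ Fintype.card ι * (‖x‖ * ‖y‖) := by
  rw [dotProduct]
  refine (Finset.abs_sum_le_sum_abs _ _).trans ?_
  refine (Finset.sum_le_card_nsmul _ _ (‖x‖ * ‖y‖) fun i _ => ?_).trans (by simp)
  rw [abs_mul]
  exact mul_le_mul (norm_le_pi_norm x i) (norm_le_pi_norm y i) (abs_nonneg _) (norm_nonneg _)

theorem exists_abs_qf_le (A : Matrix ι ι ℝ) (b : ι → ℝ) (c : ℝ) :
    ∃ C : ℝ, 0 ≤ C ∧ ∀ x, |qf A b c x| ≤ C * (1 + ‖x‖) ^ 2 := by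
  obtain ⟨C, hC, h⟩ := exists_mulVec_norm_le A
  refine ⟨Fintype.card ι * C + Fintype.card ι * ‖b‖ + |c|, by positivity, fun x => ?_⟩
  have h1 := abs_dotProduct_le x (A *ᵥ x)
  have h2 := abs_dotProduct_le b x
  have h3 : |qf A b c x| ≤ |x ⬝ᵥ A *ᵥ x| + |b ⬝ᵥ x| + |c| := by
    unfold qf
    exact (abs_add_le _ _).trans (add_le_add_left (abs_add_le _ _) _)
  have hx := norm_nonneg x
  have hb := norm_nonneg b
  have h4 : |x ⬝ᵥ A *ᵥ x| ≤ Fintype.card ι * C * (1 + ‖x‖) ^ 2 := by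
    refine h1.trans ?_
    rw [mul_assoc]
    refine mul_le_mul_of_nonneg_left ?_ (Nat.cast_nonneg _)
    nlinarith [mul_le_mul_of_nonneg_left (h x) hx, mul_nonneg hC hx]
  have h5 : |b ⬝ᵥ x| ≤ Fintype.card ι * ‖b‖ * (1 + ‖x‖) ^ 2 := by
    refine h2.trans ?_
    rw [mul_assoc]
    refine mul_le_mul_of_nonneg_left ?_ (Nat.cast_nonneg _)
    nlinarith [mul_nonneg hb hx, mul_nonneg hb (mul_nonneg hx hx)]
  have h6 : |c| ≤ |c| * (1 + ‖x‖) ^ 2 :=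
    le_mul_of_one_le_right (abs_nonneg c) (one_le_pow₀ (by linarith))
  rw [add_mul, add_mul]
  linarith

theorem integrable_qf (A : Matrix ι ι ℝ) (b : ι → ℝ) (c : ℝ) :
    Integrable (qf A b c) (gaussPi ι) := by
  obtain ⟨C, _, h⟩ := exists_abs_qf_le A b c
  exact integrable_of_le_one_add_norm_pow (by fun_prop) h

theorem measurePreserving_neg_gaussPi :
    MeasurePreserving (fun x : ι → ℝ => -x) (gaussPi ι) (gaussPi ι) := by
  classical
  have := measurePreserving_mulVec_gaussPi (-1 : Matrix ι ι ℝ) (by simp)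
  convert this using 2 with x
  rw [neg_mulVec, one_mulVec]

theorem integral_odd_gaussPi {f : (ι → ℝ) → ℝ} (hf : Continuous f) (h : ∀ x, f (-x) = -f x) :
    ∫ x, f x ∂(gaussPi ι) = 0 := by
  have := measurePreserving_neg_gaussPi.integral_comp_of_aestronglyMeasurable (g := f)
    (hf.aestronglyMeasurable (μ := gaussPi ι))
  simp_rw [h] at this
  rw [integral_neg] at this
  linarith

theorem integral_mul_gaussPi [DecidableEq ι] (i j : ι) :
    ∫ x : ι → ℝ, x i * x j ∂(gaussPi ι) = if i = j then 1 else 0 := by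
  split_ifs with hij
  · subst hij
    have := (measurePreserving_eval (fun _ : ι => gaussianReal 0 1)
      i).integral_comp_of_aestronglyMeasurable
      (g := fun y : ℝ => y * y) (by fun_prop)
    refine this.trans ?_
    simp_rw [← sq]
    exact integral_pow_gaussianReal.2.1
  · have h := measurePreserving_mulVec_gaussPi
      (diagonal fun a : ι => if a = i then (-1 : ℝ) else 1) (by
        rw [diagonal_transpose, diagonal_mul_diagonal]
        rw [diagonal_eq_one]; ext a; simp only [Pi.one_apply]; split_ifs <;> norm_num)
    have := h.integral_comp_of_aestronglyMeasurable (g := fun x : ι → ℝ => x i * x j) (by fun_prop)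
    simp only [mulVec_diagonal, if_true, Ne.symm hij, if_false] at this
    simp only [neg_mul, one_mul] at this
    rw [integral_neg] at this
    linarith

theorem integral_quadForm_gaussPi (B : Matrix ι ι ℝ) :
    ∫ x : ι → ℝ, x ⬝ᵥ B *ᵥ x ∂(gaussPi ι) = B.trace := by
  classical
  have hInt : ∀ i j : ι, Integrable (fun x : ι → ℝ => B i j * (x i * x j)) (gaussPi ι) := by
    intro i j
    refine (integrable_of_le_one_add_norm_pow (C := 1) (N := 2) (by fun_prop) fun x =>
      ?_).const_mul _
    rw [abs_mul]
    have h1 := norm_le_pi_norm x i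
    have h2 := norm_le_pi_norm x j
    simp only [Real.norm_eq_abs] at h1 h2
    have := mul_le_mul h1 h2 (abs_nonneg _) (norm_nonneg _)
    nlinarith [norm_nonneg x]
  have h : (fun x : ι → ℝ => x ⬝ᵥ B *ᵥ x) = fun x => ∑ i, ∑ j, B i j * (x i * x j) := by
    ext x
    simp only [dotProduct, mulVec, Finset.mul_sum]
    exact Finset.sum_congr rfl fun i _ => Finset.sum_congr rfl fun j _ => by ring
  rw [h, integral_finsetSum _ fun i _ => integrable_finsetSum _ fun j _ => hInt i j]
  simp_rw [integral_finsetSum _ fun j _ => hInt _ j, integral_const_mul, integral_mul_gaussPi]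
  simp [trace]

theorem integral_dotProduct_sq_gaussPi (v : ι → ℝ) :
    ∫ x : ι → ℝ, (v ⬝ᵥ x) ^ 2 ∂(gaussPi ι) = v ⬝ᵥ v := by
  have h : ∀ x : ι → ℝ, (v ⬝ᵥ x) ^ 2 = x ⬝ᵥ (vecMulVec v v) *ᵥ x := by
    intro x
    rw [vecMulVec_mulVec, sq]
    simp [dotProduct_comm]
  simp_rw [h]
  rw [integral_quadForm_gaussPi, trace_vecMulVec]

theorem qf_add {A : Matrix ι ι ℝ} (hA : Aᵀ = A) (b : ι → ℝ) (c : ℝ) (y z : ι → ℝ) :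
    qf A b c (y + z) = qf A b c y + ((2 : ℝ) • A *ᵥ y + b) ⬝ᵥ z + z ⬝ᵥ A *ᵥ z := by
  have h : y ⬝ᵥ A *ᵥ z = (A *ᵥ y) ⬝ᵥ z := by rw [dotProduct_mulVec_eq_transpose, hA]
  have h' : z ⬝ᵥ A *ᵥ y = (A *ᵥ y) ⬝ᵥ z := dotProduct_comm _ _
  simp only [qf, mulVec_add, dotProduct_add, add_dotProduct, smul_dotProduct, smul_eq_mul, h, h']
  ring

/-- A smooth convex increasing function with slopes between `0` and `1`. -/
noncomputable def softPlus (y : ℝ) : ℝ := (y + Real.sqrt (1 + y ^ 2)) / 2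

@[fun_prop]
theorem continuous_softPlus : Continuous softPlus := by
  unfold softPlus; fun_prop

/-- The derivative of `softPlus`. -/
noncomputable def softPlusDeriv (y : ℝ) : ℝ := (1 + y / Real.sqrt (1 + y ^ 2)) / 2

theorem abs_lt_sqrt_one_add_sq (y : ℝ) : |y| < Real.sqrt (1 + y ^ 2) := by
  rw [← Real.sqrt_sq_eq_abs]
  exact Real.sqrt_lt_sqrt (sq_nonneg _) (by linarith)

theorem softPlusDeriv_mem (y : ℝ) : 0 ≤ softPlusDeriv y ∧ softPlusDeriv y ≤ 1 := by
  have h := abs_lt_sqrt_one_add_sq y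
  have h0 : 0 < Real.sqrt (1 + y ^ 2) := (abs_nonneg y).trans_lt h
  have h1 := abs_lt.mp h
  have h2 : -1 ≤ y / Real.sqrt (1 + y ^ 2) := by rw [le_div_iff₀ h0]; linarith
  have h3 : y / Real.sqrt (1 + y ^ 2) ≤ 1 := by rw [div_le_iff₀ h0]; linarith
  unfold softPlusDeriv
  constructor <;> linarith

theorem softPlus_taylor (a b : ℝ) :
    ∃ r : ℝ, 0 ≤ r ∧ softPlus b = softPlus a + softPlusDeriv a * (b - a) + r ∧
      (|a| ≤ 1 → ((b - a) ^ 2 - |b - a| ^ 3) / 18 ≤ r) := by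
  set α := Real.sqrt (1 + a ^ 2) with hα
  set β := Real.sqrt (1 + b ^ 2) with hβ
  have ha := abs_lt_sqrt_one_add_sq a
  have hb := abs_lt_sqrt_one_add_sq b
  rw [← hα] at ha
  rw [← hβ] at hb
  have ha2 : α ^ 2 = 1 + a ^ 2 := Real.sq_sqrt (by positivity)
  have hb2 : β ^ 2 = 1 + b ^ 2 := Real.sq_sqrt (by positivity)
  have ha0 : 0 < α := (abs_nonneg a).trans_lt ha
  have hb0 : 0 < β := (abs_nonneg b).trans_lt hb
  have hden : 0 < α * β + 1 + a * b := by
    have := mul_lt_mul'' ha hb (abs_nonneg _) (abs_nonneg _)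
    rw [← abs_mul] at this
    have := neg_abs_le (a * b)
    linarith
  have key : (b - a) ^ 2 = (α * β - 1 - a * b) * (α * β + 1 + a * b) := by
    nlinarith
  refine ⟨(b - a) ^ 2 / (α * (α * β + 1 + a * b)) / 2, by positivity, ?_, ?_⟩
  · have h1 : (b - a) ^ 2 / (α * (α * β + 1 + a * b)) = (α * β - 1 - a * b) / α := by
      rw [key]; field_simp
    rw [h1, softPlus, softPlus, softPlusDeriv, ← hα, ← hβ]
    field_simp
    linear_combination (-1 : ℝ) * ha2
  · intro ha1
    rcases le_or_gt |b - a| 1 with hd | hd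
    · have h1 : α * (α * β + 1 + a * b) ≤ 9 := by
        have a1 := abs_le.mp ha1
        have d1 := abs_le.mp hd
        have hb1 : |b| ≤ 2 := by rw [abs_le]; constructor <;> linarith
        have hbb : b ^ 2 ≤ 4 := by nlinarith [sq_abs b, abs_nonneg b]
        have haa : a ^ 2 ≤ 1 := by nlinarith [sq_abs a, abs_nonneg a]
        have hβ1 : β ≤ 2.25 := by nlinarith
        have hα1 : α ≤ 1.42 := by nlinarith
        have hab : a * b ≤ 2 := by
          refine (le_abs_self _).trans ?_
          rw [abs_mul]; nlinarith [abs_nonneg a, abs_nonneg b]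
        have h2 : α * β ≤ 3.2 := by nlinarith
        nlinarith
      have h2 : (b - a) ^ 2 / 9 ≤ (b - a) ^ 2 / (α * (α * β + 1 + a * b)) :=
        div_le_div_of_nonneg_left (by positivity) (by positivity) h1
      have : 0 ≤ |b - a| ^ 3 := by positivity
      linarith
    · have h3 : (b - a) ^ 2 - |b - a| ^ 3 ≤ 0 := by
        rw [← sq_abs]
        nlinarith [sq_nonneg |b - a|]
      have : 0 ≤ (b - a) ^ 2 / (α * (α * β + 1 + a * b)) / 2 := by positivity
      linarith

theorem monotone_softPlus : Monotone softPlus := by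
  intro a b hab
  obtain ⟨r, hr, h, _⟩ := softPlus_taylor a b
  have := mul_nonneg (softPlusDeriv_mem a).1 (sub_nonneg.mpr hab)
  linarith

theorem abs_softPlus_le (y : ℝ) : |softPlus y| ≤ 1 + |y| := by
  have h := abs_lt_sqrt_one_add_sq y
  have h1 := abs_lt.mp h
  have h2 : Real.sqrt (1 + y ^ 2) ≤ 1 + |y| := by
    refine Real.sqrt_le_iff.mpr ⟨by positivity, ?_⟩
    nlinarith [sq_abs y, abs_nonneg y]
  unfold softPlus
  rw [abs_of_nonneg (by linarith)]
  have := le_abs_self y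
  linarith [abs_nonneg y]

end

section
variable {ι : Type*} [Fintype ι]

/-- The gradient of `qf A b c` at `x` projected by `P`. -/
def projGrad (A : Matrix ι ι ℝ) (b : ι → ℝ) (P : Matrix ι ι ℝ) (x : ι → ℝ) : ι → ℝ :=
  P *ᵥ ((2 : ℝ) • A *ᵥ x + b)

/-- The first-order part of the variation of `qf A b c` under rescaling along the range of `P`. -/
def linVar (A : Matrix ι ι ℝ) (b : ι → ℝ) (P : Matrix ι ι ℝ) (x : ι → ℝ) : ℝ :=
  ((2 : ℝ) • A *ᵥ x + b) ⬝ᵥ P *ᵥ x - 2 * (P *ᵥ x ⬝ᵥ A *ᵥ P *ᵥ x)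

/-- One step of the Ornstein-Uhlenbeck flow along the range of `P`. -/
noncomputable def ouStep (P : Matrix ι ι ℝ) (s : ℝ) (x z : ι → ℝ) : ι → ℝ :=
  (x - (1 - √(1 - s ^ 2)) • P *ᵥ x) + s • P *ᵥ z

theorem continuous_ouStep (P : Matrix ι ι ℝ) (s : ℝ) :
    Continuous fun p : (ι → ℝ) × (ι → ℝ) => ouStep P s p.1 p.2 := by
  unfold ouStep; fun_prop

theorem one_sub_sqrt_mem {s : ℝ} (h1 : s ^ 2 ≤ 1) :
    0 ≤ 1 - √(1 - s ^ 2) ∧ 1 - √(1 - s ^ 2) ≤ s ^ 2 ∧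
      2 * (1 - √(1 - s ^ 2)) - (1 - √(1 - s ^ 2)) ^ 2 = s ^ 2 := by
  have h := Real.sq_sqrt (sub_nonneg.mpr h1)
  have h0 := Real.sqrt_nonneg (1 - s ^ 2)
  have h2 : √(1 - s ^ 2) ≤ 1 := Real.sqrt_le_one.mpr (by linarith [sq_nonneg s])
  refine ⟨by linarith, by nlinarith, by linarith⟩

theorem measurePreserving_ouStep {P : Matrix ι ι ℝ} (hP : Pᵀ = P)
    (hPP : P * P = P) {s : ℝ} (h1 : s ^ 2 ≤ 1) :
    MeasurePreserving (fun p : (ι → ℝ) × (ι → ℝ) => ouStep P s p.1 p.2)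
      ((gaussPi ι).prod (gaussPi ι)) (gaussPi ι) := by
  classical
  obtain ⟨-, -, h⟩ := one_sub_sqrt_mem h1
  set δ := 1 - √(1 - s ^ 2) with hδ
  clear_value δ
  have := measurePreserving_mulVec_add_gaussPi (1 - δ • P) (s • P) (by
    simp only [transpose_sub, transpose_one, transpose_smul, hP, sub_mul, mul_sub, one_mul, mul_one,
      Matrix.smul_mul, Matrix.mul_smul, hPP, smul_smul]
    have : s * s = 2 * δ - δ * δ := by rw [← sq, ← h, sq]
    rw [this]
    module)
  convert this using 2 with p
  simp only [ouStep, sub_mulVec, one_mulVec, smul_mulVec, hδ]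

theorem qf_ouStep {A : Matrix ι ι ℝ} (hA : Aᵀ = A) (b : ι → ℝ) (c : ℝ) {P : Matrix ι ι ℝ}
    (hP : Pᵀ = P) {s : ℝ} (h1 : s ^ 2 ≤ 1) (x z : ι → ℝ) :
    qf A b c (ouStep P s x z) - qf A b c x =
      (-(1 - √(1 - s ^ 2)) * linVar A b P x - s ^ 2 * (P *ᵥ x ⬝ᵥ A *ᵥ P *ᵥ x)) +
      s * (projGrad A b P (x - (1 - √(1 - s ^ 2)) • P *ᵥ x) ⬝ᵥ z) +
      s ^ 2 * (z ⬝ᵥ (P * A * P) *ᵥ z) := by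
  obtain ⟨-, -, h⟩ := one_sub_sqrt_mem h1
  set δ := 1 - √(1 - s ^ 2) with hδ
  have e1 : ∀ v : ι → ℝ, v ⬝ᵥ P *ᵥ z = P *ᵥ v ⬝ᵥ z := fun v => by
    rw [dotProduct_mulVec_eq_transpose, hP]
  have e2 : z ⬝ᵥ (P * A * P) *ᵥ z = P *ᵥ z ⬝ᵥ A *ᵥ P *ᵥ z := by
    rw [← mulVec_mulVec, ← mulVec_mulVec, dotProduct_mulVec_eq_transpose, hP]
  have e3 : x - δ • P *ᵥ x = x + (-δ) • P *ᵥ x := by rw [neg_smul, sub_eq_add_neg]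
  rw [ouStep, ← hδ, qf_add hA, dotProduct_smul, e1, e2, projGrad]
  have e4 := qf_add hA b c x ((-δ) • P *ᵥ x)
  rw [← e3] at e4
  rw [e4, linVar]
  simp only [mulVec_smul, dotProduct_smul, smul_dotProduct, smul_eq_mul]
  linear_combination (P *ᵥ x ⬝ᵥ A *ᵥ P *ᵥ x) * (-h)

theorem integral_ouStep_sub {A : Matrix ι ι ℝ} (hA : Aᵀ = A) (b : ι → ℝ) (c : ℝ)
    {P : Matrix ι ι ℝ} (hP : Pᵀ = P) {s : ℝ} (h1 : s ^ 2 ≤ 1) (x : ι → ℝ) :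
    ∫ z, (qf A b c (ouStep P s x z) - qf A b c x) ∂(gaussPi ι) =
      -(1 - √(1 - s ^ 2)) * linVar A b P x - s ^ 2 * chaos (P * A * P) x := by
  simp_rw [qf_ouStep hA b c hP h1 x]
  set u := projGrad A b P (x - (1 - √(1 - s ^ 2)) • P *ᵥ x)
  have i1 : Integrable (fun z : ι → ℝ => u ⬝ᵥ z) (gaussPi ι) :=
    (integrable_qf (0 : Matrix ι ι ℝ) u 0).congr (Filter.Eventually.of_forall fun z => by simp [qf])
  have i2 : Integrable (fun z : ι → ℝ => z ⬝ᵥ (P * A * P) *ᵥ z) (gaussPi ι) :=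
    (integrable_qf (P * A * P) 0 0).congr (Filter.Eventually.of_forall fun z => by simp [qf])
  set a := -(1 - √(1 - s ^ 2)) * linVar A b P x - s ^ 2 * (P *ᵥ x ⬝ᵥ A *ᵥ P *ᵥ x) with ha
  have i3 : Integrable (fun z : ι → ℝ => a + s * (u ⬝ᵥ z)) (gaussPi ι) :=
    (integrable_const _).add (i1.const_mul s)
  rw [integral_add i3 (i2.const_mul _),
    integral_add (integrable_const _) (i1.const_mul s), integral_const_mul, integral_const_mul,
    integral_quadForm_gaussPi, integral_odd_gaussPi (f := fun z => u ⬝ᵥ z) (by fun_prop) (by simp)]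
  have e2 : x ⬝ᵥ (P * A * P) *ᵥ x = P *ᵥ x ⬝ᵥ A *ᵥ P *ᵥ x := by
    rw [← mulVec_mulVec, ← mulVec_mulVec, dotProduct_mulVec_eq_transpose, hP]
  simp only [chaos, e2, integral_const, probReal_univ, one_smul, ha]
  ring

theorem integrable_quad_sq (a t r : ℝ) (u : ι → ℝ) (B : Matrix ι ι ℝ) (N : ℕ) :
    Integrable (fun z : ι → ℝ => |a + t * (u ⬝ᵥ z) + r * (z ⬝ᵥ B *ᵥ z)| ^ N) (gaussPi ι) := by
  obtain ⟨C, hC, h⟩ := exists_abs_qf_le (r • B) (t • u) a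
  refine integrable_of_le_one_add_norm_pow (C := C ^ N) (N := 2 * N) (by fun_prop) fun z => ?_
  rw [abs_pow, abs_abs, pow_mul, ← mul_pow]
  refine pow_le_pow_left₀ (abs_nonneg _) ?_ _
  have := h z
  simp only [qf, smul_mulVec, dotProduct_smul, smul_dotProduct, smul_eq_mul] at this
  refine le_of_eq_of_le (congrArg _ ?_) this
  ring

theorem sq_le_integral_quad_sq (a t r : ℝ) (u : ι → ℝ) (B : Matrix ι ι ℝ) :
    t ^ 2 * (u ⬝ᵥ u) ≤
      ∫ z : ι → ℝ, (a + t * (u ⬝ᵥ z) + r * (z ⬝ᵥ B *ᵥ z)) ^ 2 ∂(gaussPi ι) := by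
  have e : ∀ t : ℝ, Integrable (fun z : ι → ℝ => (a + t * (u ⬝ᵥ z) + r * (z ⬝ᵥ B *ᵥ z)) ^ 2)
      (gaussPi ι) := fun t => by
    simpa only [sq_abs] using integrable_quad_sq a t r u B 2
  have hneg := measurePreserving_neg_gaussPi.integral_comp_of_aestronglyMeasurable
    (g := fun z : ι → ℝ => (a + t * (u ⬝ᵥ z) + r * (z ⬝ᵥ B *ᵥ z)) ^ 2) (e t).aestronglyMeasurable
  simp only [mulVec_neg, dotProduct_neg, neg_dotProduct, neg_neg, mul_neg] at hneg
  have e' := e (-t)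
  simp only [neg_mul] at e'
  have h2 : ∫ z : ι → ℝ, (t * (u ⬝ᵥ z)) ^ 2 ∂(gaussPi ι) = t ^ 2 * (u ⬝ᵥ u) := by
    simp_rw [mul_pow]
    rw [integral_const_mul, integral_dotProduct_sq_gaussPi]
  have h3 := integral_mono (μ := gaussPi ι)
    (f := fun z : ι → ℝ => 2 * (t * (u ⬝ᵥ z)) ^ 2)
    (g := fun z : ι → ℝ => (a + t * (u ⬝ᵥ z) + r * (z ⬝ᵥ B *ᵥ z)) ^ 2 +
      (a + -(t * (u ⬝ᵥ z)) + r * (z ⬝ᵥ B *ᵥ z)) ^ 2)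
    (by
      refine Integrable.const_mul ?_ _
      simpa only [sq_abs, zero_add, zero_mul, add_zero] using integrable_quad_sq 0 t 0 u B 2)
    ((e t).add e') fun z => by
      simp only
      nlinarith [sq_nonneg (a + r * (z ⬝ᵥ B *ᵥ z))]
  rw [integral_add (e t) e', integral_const_mul, h2, hneg] at h3
  linarith

end

section
variable {ι : Type*} [Fintype ι]

theorem linVar_eq_qf (A : Matrix ι ι ℝ) (b : ι → ℝ) (P : Matrix ι ι ℝ) (x : ι → ℝ) :
    linVar A b P x = qf ((2 : ℝ) • (Aᵀ * P) - (2 : ℝ) • (Pᵀ * A * P)) (Pᵀ *ᵥ b) 0 x := by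
  have e1 : x ⬝ᵥ (Aᵀ * P) *ᵥ x = A *ᵥ x ⬝ᵥ P *ᵥ x := by
    rw [← mulVec_mulVec, dotProduct_mulVec_eq_transpose, transpose_transpose]
  have e2 : x ⬝ᵥ (Pᵀ * A * P) *ᵥ x = P *ᵥ x ⬝ᵥ A *ᵥ P *ᵥ x := by
    rw [← mulVec_mulVec, ← mulVec_mulVec, dotProduct_mulVec_eq_transpose, transpose_transpose]
  have e3 : b ⬝ᵥ P *ᵥ x = Pᵀ *ᵥ b ⬝ᵥ x := dotProduct_mulVec_eq_transpose _ _ _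
  simp only [linVar, qf, sub_mulVec, smul_mulVec, dotProduct_sub, dotProduct_smul, add_dotProduct,
    smul_dotProduct, smul_eq_mul, e1, e2, e3]
  ring

theorem exists_norm_projGrad_le (A : Matrix ι ι ℝ) (b : ι → ℝ) (P : Matrix ι ι ℝ) :
    ∃ C : ℝ, 0 ≤ C ∧ ∀ x, ‖projGrad A b P x‖ ≤ C * (1 + ‖x‖) := by
  obtain ⟨C1, h1, h1'⟩ := exists_mulVec_norm_le A
  obtain ⟨C2, h2, h2'⟩ := exists_mulVec_norm_le P
  refine ⟨C2 * (2 * C1 + ‖b‖), by positivity, fun x => ?_⟩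
  rw [projGrad, mul_assoc]
  refine (h2' _).trans (mul_le_mul_of_nonneg_left ?_ h2)
  refine (norm_add_le _ _).trans ?_
  rw [norm_smul, Real.norm_ofNat]
  have := h1' x
  nlinarith [norm_nonneg b, norm_nonneg x, mul_nonneg (norm_nonneg b) (norm_nonneg x)]

theorem exists_abs_qf_ouStep_le {A : Matrix ι ι ℝ} (hA : Aᵀ = A) (b : ι → ℝ) (c : ℝ)
    {P : Matrix ι ι ℝ} (hP : Pᵀ = P) :
    ∃ C : ℝ, 0 ≤ C ∧ ∀ s : ℝ, 0 < s → s ≤ 1 → ∀ x z : ι → ℝ,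
      |qf A b c (ouStep P s x z) - qf A b c x| ≤ s * (C * (1 + ‖x‖) ^ 2 * (1 + ‖z‖) ^ 2) := by
  obtain ⟨C1, h1, h1'⟩ := exists_abs_qf_le ((2 : ℝ) • (Aᵀ * P) - (2 : ℝ) • (Pᵀ * A * P))
    (Pᵀ *ᵥ b) 0
  obtain ⟨C2, h2, h2'⟩ := exists_abs_qf_le (P * A * P) 0 0
  obtain ⟨C3, h3, h3'⟩ := exists_norm_projGrad_le A b P
  obtain ⟨C4, h4, h4'⟩ := exists_mulVec_norm_le P
  set n : ℝ := (Fintype.card ι : ℝ) with hn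
  have hn0 : 0 ≤ n := Nat.cast_nonneg _
  refine ⟨C1 + C2 + n * (C3 * (1 + C4)) + C2, by positivity, fun s hs hs1 x z => ?_⟩
  have hss : s ^ 2 ≤ s := by
    rw [sq]; exact mul_le_of_le_one_left hs.le hs1
  have hs2 : s ^ 2 ≤ 1 := by linarith
  obtain ⟨d0, d1, -⟩ := one_sub_sqrt_mem hs2
  have e2 : ∀ x : ι → ℝ, x ⬝ᵥ (P * A * P) *ᵥ x = P *ᵥ x ⬝ᵥ A *ᵥ P *ᵥ x := fun x => by
    rw [← mulVec_mulVec, ← mulVec_mulVec, dotProduct_mulVec_eq_transpose, hP]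
  rw [qf_ouStep hA b c hP hs2]
  set δ := 1 - √(1 - s ^ 2)
  set X := 1 + ‖x‖ with hX
  set Z := 1 + ‖z‖ with hZ
  have hX1 : 1 ≤ X := by linarith [norm_nonneg x]
  have hZ1 : 1 ≤ Z := by linarith [norm_nonneg z]
  have a1 : |linVar A b P x| ≤ C1 * X ^ 2 := by rw [linVar_eq_qf]; exact h1' x
  have a2 : ∀ x : ι → ℝ, |x ⬝ᵥ (P * A * P) *ᵥ x| ≤ C2 * (1 + ‖x‖) ^ 2 := fun x => by
    simpa [qf] using h2' x
  have a3 : |projGrad A b P (x - δ • P *ᵥ x) ⬝ᵥ z| ≤ n * (C3 * (1 + C4)) * X * Z := by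
    refine (abs_dotProduct_le _ _).trans ?_
    have b1 : ‖x - δ • P *ᵥ x‖ ≤ ‖x‖ + C4 * ‖x‖ := by
      refine (norm_sub_le _ _).trans (add_le_add le_rfl ?_)
      rw [norm_smul, Real.norm_eq_abs, abs_of_nonneg d0]
      have := norm_nonneg (P *ᵥ x)
      exact mul_le_of_le_one_left this (d1.trans hs2) |>.trans (h4' x)
    have b2 := h3' (x - δ • P *ᵥ x)
    have b3 : ‖projGrad A b P (x - δ • P *ᵥ x)‖ ≤ C3 * ((1 + C4) * X) :=
      b2.trans (mul_le_mul_of_nonneg_left (by rw [hX]; linarith) h3)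
    have b4 := mul_le_mul b3 (show ‖z‖ ≤ Z by linarith) (norm_nonneg z) (by positivity)
    calc n * (‖projGrad A b P (x - δ • P *ᵥ x)‖ * ‖z‖) ≤ n * (C3 * ((1 + C4) * X) * Z) :=
          mul_le_mul_of_nonneg_left b4 hn0
      _ = _ := by ring
  have X2 : X ≤ X ^ 2 := le_self_pow₀ hX1 two_ne_zero
  have Z2 : Z ≤ Z ^ 2 := le_self_pow₀ hZ1 two_ne_zero
  have Z3 : 1 ≤ Z ^ 2 := by linarith
  have X3 : 1 ≤ X ^ 2 := by linarith
  have hds : δ ≤ s := d1.trans hss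
  set V := X ^ 2 * Z ^ 2 with hV
  have v1 : X ^ 2 ≤ V := le_mul_of_one_le_right (by linarith) Z3
  have v2 : Z ^ 2 ≤ V := le_mul_of_one_le_left (by linarith) X3
  have v3 : X * Z ≤ V := mul_le_mul X2 Z2 (by linarith) (by linarith)
  have f1 : |-δ * linVar A b P x| ≤ s * (C1 * V) := by
    rw [abs_mul, abs_neg, abs_of_nonneg d0]
    exact mul_le_mul hds (a1.trans (mul_le_mul_of_nonneg_left v1 h1)) (abs_nonneg _) hs.le
  have f2 : |s ^ 2 * (P *ᵥ x ⬝ᵥ A *ᵥ P *ᵥ x)| ≤ s * (C2 * V) := by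
    rw [abs_mul, ← e2, abs_of_nonneg (sq_nonneg s)]
    exact mul_le_mul hss ((a2 x).trans (mul_le_mul_of_nonneg_left v1 h2)) (abs_nonneg _) hs.le
  have f3 : |s * (projGrad A b P (x - δ • P *ᵥ x) ⬝ᵥ z)| ≤ s * (n * (C3 * (1 + C4)) * V) := by
    rw [abs_mul, abs_of_pos hs]
    refine mul_le_mul_of_nonneg_left (a3.trans ?_) hs.le
    rw [mul_assoc]
    exact mul_le_mul_of_nonneg_left v3 (by positivity)
  have f4 : |s ^ 2 * (z ⬝ᵥ (P * A * P) *ᵥ z)| ≤ s * (C2 * V) := by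
    rw [abs_mul, abs_of_nonneg (sq_nonneg s)]
    exact mul_le_mul hss ((a2 z).trans (mul_le_mul_of_nonneg_left v2 h2)) (abs_nonneg _) hs.le
  have g1 := abs_add_le (-δ * linVar A b P x - s ^ 2 * (P *ᵥ x ⬝ᵥ A *ᵥ P *ᵥ x) +
      s * (projGrad A b P (x - δ • P *ᵥ x) ⬝ᵥ z)) (s ^ 2 * (z ⬝ᵥ (P * A * P) *ᵥ z))
  have g2 := abs_add_le (-δ * linVar A b P x - s ^ 2 * (P *ᵥ x ⬝ᵥ A *ᵥ P *ᵥ x))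
      (s * (projGrad A b P (x - δ • P *ᵥ x) ⬝ᵥ z))
  have g3 := abs_sub (-δ * linVar A b P x) (s ^ 2 * (P *ᵥ x ⬝ᵥ A *ᵥ P *ᵥ x))
  calc _ ≤ s * (C1 * V) + s * (C2 * V) + s * (n * (C3 * (1 + C4)) * V) + s * (C2 * V) := by
        linarith
    _ = _ := by rw [hV]; ring

theorem softPlus_ouStep {A : Matrix ι ι ℝ} (hA : Aᵀ = A) (b : ι → ℝ) (c : ℝ)
    {P : Matrix ι ι ℝ} (hP : Pᵀ = P) :
    ∃ C : ℝ, 0 ≤ C ∧ ∀ s : ℝ, 0 < s → s ≤ 1 → ∀ x w τ,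
      |chaos (P * A * P) x| + |linVar A b P x| ≤ w →
      Integrable (fun z => softPlus (qf A b c (ouStep P s x z))) (gaussPi ι) ∧
      softPlus (qf A b c x) - s ^ 2 * w ≤
        ∫ z, softPlus (qf A b c (ouStep P s x z)) ∂(gaussPi ι) ∧
      (|qf A b c x| ≤ 1 → τ ≤ projGrad A b P x ⬝ᵥ projGrad A b P x →
        softPlus (qf A b c x) - s ^ 2 * w + s ^ 2 * (τ / 36) - s ^ 3 * (C * (1 + ‖x‖) ^ 6) ≤
          ∫ z, softPlus (qf A b c (ouStep P s x z)) ∂(gaussPi ι)) := by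
  obtain ⟨C1, h1, h1'⟩ := exists_mulVec_norm_le (P * A * P)
  obtain ⟨C2, h2, h2'⟩ := exists_abs_qf_ouStep_le hA b c hP
  set E := ∫ z : ι → ℝ, (1 + ‖z‖) ^ 6 ∂(gaussPi ι) with hE
  have hE0 : 0 ≤ E := integral_nonneg fun z => by positivity
  refine ⟨(8 * Fintype.card ι * C1 ^ 2 + C2 ^ 3 * E) / 18, by positivity,
    fun s hs hs1 x w τ hw => ?_⟩
  have hss : s ^ 2 ≤ s := by
    rw [sq]; exact mul_le_of_le_one_left hs.le hs1
  have hs2 : s ^ 2 ≤ 1 := by linarith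
  obtain ⟨d0, d1, -⟩ := one_sub_sqrt_mem hs2
  set δ := 1 - √(1 - s ^ 2) with hδ
  set D : (ι → ℝ) → ℝ := fun z => qf A b c (ouStep P s x z) - qf A b c x with hD
  have hDc : Continuous D := by
    have := (continuous_ouStep P s).comp (Continuous.prodMk_right x)
    simp only [hD]
    exact ((continuous_qf A b c).comp this).sub continuous_const
  have hDN : ∀ N : ℕ, Integrable (fun z => |D z| ^ N) (gaussPi ι) := fun N => by
    simp only [hD, qf_ouStep hA b c hP hs2 x]
    exact integrable_quad_sq _ _ _ _ _ _
  have hDi : Integrable D (gaussPi ι) :=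
    (hDN 1).mono' hDc.aestronglyMeasurable (Filter.Eventually.of_forall fun z => by simp)
  have hDm : -(s ^ 2 * w) ≤ softPlusDeriv (qf A b c x) * ∫ z, D z ∂(gaussPi ι) := by
    have e := integral_ouStep_sub hA b c hP hs2 x
    rw [← hδ] at e
    have hb : |∫ z, D z ∂(gaussPi ι)| ≤ s ^ 2 * w := by
      rw [show ∫ z, D z ∂(gaussPi ι) = _ from e]
      refine (abs_sub _ _).trans ?_
      rw [abs_mul, abs_mul, abs_neg, abs_of_nonneg d0, abs_of_nonneg (sq_nonneg s)]
      have e1 := mul_le_mul_of_nonneg_right d1 (abs_nonneg (linVar A b P x))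
      have e2 := mul_le_mul_of_nonneg_left hw (sq_nonneg s)
      linarith
    have h0 := softPlusDeriv_mem (qf A b c x)
    have := neg_abs_le (∫ z, D z ∂(gaussPi ι))
    have h2 := mul_le_mul_of_nonneg_left this h0.1
    have h3 := mul_le_of_le_one_left (abs_nonneg (∫ z, D z ∂(gaussPi ι))) h0.2
    linarith
  have hInt : Integrable (fun z => softPlus (qf A b c (ouStep P s x z))) (gaussPi ι) := by
    have hc : Continuous fun z => softPlus (qf A b c (ouStep P s x z)) :=
      continuous_softPlus.comp ((continuous_qf A b c).comp
        ((continuous_ouStep P s).comp (Continuous.prodMk_right x)))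
    refine ((integrable_const (1 + |qf A b c x|)).add (hDN 1)).mono' hc.aestronglyMeasurable
      (Filter.Eventually.of_forall fun z => ?_)
    rw [Real.norm_eq_abs]
    refine (abs_softPlus_le _).trans ?_
    have := abs_add_le (qf A b c x) (D z)
    rw [show qf A b c x + D z = qf A b c (ouStep P s x z) by simp [hD]] at this
    simp only [Pi.add_apply, pow_one]
    linarith
  have hi1 : Integrable (fun z => softPlus (qf A b c x) + softPlusDeriv (qf A b c x) * D z)
      (gaussPi ι) := (integrable_const _).add (hDi.const_mul _)
  have hi1' : ∫ z, (softPlus (qf A b c x) + softPlusDeriv (qf A b c x) * D z) ∂(gaussPi ι) =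
      softPlus (qf A b c x) + softPlusDeriv (qf A b c x) * ∫ z, D z ∂(gaussPi ι) := by
    rw [integral_add (integrable_const _) (hDi.const_mul _), integral_const_mul]
    simp
  refine ⟨hInt, ?_, fun hq hτ => ?_⟩
  · have := integral_mono hi1 hInt fun z => by
      obtain ⟨r, hr, h, -⟩ := softPlus_taylor (qf A b c x) (qf A b c (ouStep P s x z))
      simp only [hD]
      linarith
    rw [hi1'] at this
    linarith
  · have hD2 : Integrable (fun z => D z ^ 2) (gaussPi ι) := by simpa only [sq_abs] using hDN 2
    have hi2 : Integrable (fun z => D z ^ 2 - |D z| ^ 3) (gaussPi ι) := hD2.sub (hDN 3)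
    have m := integral_mono (hi1.add (hi2.div_const 18)) hInt fun z => by
      obtain ⟨r, hr, h, h'⟩ := softPlus_taylor (qf A b c x) (qf A b c (ouStep P s x z))
      have := h' hq
      simp only [hD, Pi.add_apply]
      linarith
    have m' := integral_add hi1 (hi2.div_const 18)
    simp only [Pi.add_apply] at m
    rw [m', hi1', integral_div, integral_sub hD2 (hDN 3)] at m
    have l2 : s ^ 2 * (projGrad A b P (x - δ • P *ᵥ x) ⬝ᵥ projGrad A b P (x - δ • P *ᵥ x)) ≤
        ∫ z, D z ^ 2 ∂(gaussPi ι) := by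
      simp only [hD, qf_ouStep hA b c hP hs2 x]
      exact sq_le_integral_quad_sq _ _ _ _ _
    have l3 : ∫ z, |D z| ^ 3 ∂(gaussPi ι) ≤ s ^ 3 * (C2 ^ 3 * (1 + ‖x‖) ^ 6 * E) := by
      rw [hE, ← integral_const_mul, ← integral_const_mul]
      refine integral_mono (hDN 3) (((integrable_one_add_norm_pow 6).const_mul _).const_mul _)
        fun z => ?_
      have := pow_le_pow_left₀ (abs_nonneg _) (h2' s hs hs1 x z) 3
      simp only [hD]
      refine this.trans (le_of_eq ?_)
      ring
    set v := (P * A * P) *ᵥ x with hv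
    have hpg : projGrad A b P (x - δ • P *ᵥ x) = projGrad A b P x - (2 * δ) • v := by
      simp only [projGrad, hv, mulVec_sub, mulVec_smul, mulVec_add, ← mulVec_mulVec,
        mul_smul, smul_sub]
      rw [smul_comm]
      abel
    have l4 : projGrad A b P x ⬝ᵥ projGrad A b P x ≤ 2 * (projGrad A b P (x - δ • P *ᵥ x) ⬝ᵥ
        projGrad A b P (x - δ • P *ᵥ x)) + 8 * δ ^ 2 * (v ⬝ᵥ v) := by
      have := dotProduct_self_nonneg' (projGrad A b P x - (2 : ℝ) • (2 * δ) • v)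
      rw [hpg]
      simp only [sub_dotProduct, dotProduct_sub, smul_dotProduct, dotProduct_smul, smul_eq_mul,
        dotProduct_comm v] at this ⊢
      linarith
    have l5 : v ⬝ᵥ v ≤ Fintype.card ι * C1 ^ 2 * (1 + ‖x‖) ^ 6 := by
      refine (le_abs_self _).trans ((abs_dotProduct_le v v).trans ?_)
      rw [mul_assoc]
      refine mul_le_mul_of_nonneg_left ?_ (Nat.cast_nonneg _)
      have b1 := h1' x
      rw [← hv] at b1
      have b2 := mul_le_mul b1 b1 (norm_nonneg v) (by positivity)
      have b3 : ‖x‖ ^ 2 ≤ (1 + ‖x‖) ^ 6 :=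
        (pow_le_pow_left₀ (norm_nonneg x) (by linarith) 2).trans
          (pow_le_pow_right₀ (by linarith [norm_nonneg x]) (by norm_num))
      calc ‖v‖ * ‖v‖ ≤ C1 ^ 2 * ‖x‖ ^ 2 := by linarith
        _ ≤ _ := mul_le_mul_of_nonneg_left b3 (sq_nonneg C1)
    have d2 : δ ^ 2 ≤ s := (pow_le_of_le_one d0 (d1.trans hs2) two_ne_zero).trans (d1.trans hss)
    have l6 : 8 * δ ^ 2 * (v ⬝ᵥ v) ≤ s * (8 * Fintype.card ι * C1 ^ 2 * (1 + ‖x‖) ^ 6) := by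
      have := dotProduct_self_nonneg' v
      have e1 := mul_le_mul_of_nonneg_left l5 (show 0 ≤ 8 * δ ^ 2 by positivity)
      refine e1.trans ?_
      rw [show s * (8 * Fintype.card ι * C1 ^ 2 * (1 + ‖x‖) ^ 6) =
        8 * s * (Fintype.card ι * C1 ^ 2 * (1 + ‖x‖) ^ 6) by ring]
      exact mul_le_mul_of_nonneg_right (by linarith) (by positivity)
    have l7 : s ^ 2 * (τ / 2) - s ^ 3 * (8 * Fintype.card ι * C1 ^ 2 * (1 + ‖x‖) ^ 6) ≤
        s ^ 2 * (projGrad A b P (x - δ • P *ᵥ x) ⬝ᵥ projGrad A b P (x - δ • P *ᵥ x)) := by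
      have hp : 0 ≤ s * (8 * Fintype.card ι * C1 ^ 2 * (1 + ‖x‖) ^ 6) := by positivity
      have : τ / 2 - s * (8 * Fintype.card ι * C1 ^ 2 * (1 + ‖x‖) ^ 6) ≤
          projGrad A b P (x - δ • P *ᵥ x) ⬝ᵥ projGrad A b P (x - δ • P *ᵥ x) := by linarith
      have := mul_le_mul_of_nonneg_left this (sq_nonneg s)
      linarith
    linarith

end

section
variable {ι : Type*} [Fintype ι]

theorem max_smallBall {I : Type*} [Fintype I] [Nonempty I] {A : I → Matrix ι ι ℝ}
    (hA : ∀ i, (A i)ᵀ = A i) (b : I → ι → ℝ) (c : I → ℝ) {P : Matrix ι ι ℝ} (hP : Pᵀ = P)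
    (hPP : P * P = P) {W : (ι → ℝ) → ℝ} (hWi : Integrable W (gaussPi ι))
    (hW : ∀ i x, |chaos (P * A i * P) x| + |linVar (A i) (b i) P x| ≤ W x) (τ : ℝ) :
    τ * (gaussPi ι).real {x | (∀ i, qf (A i) (b i) (c i) x ≤ 1) ∧
      (∃ i, -1 ≤ qf (A i) (b i) (c i) x) ∧
      ∀ i, τ ≤ projGrad (A i) (b i) P x ⬝ᵥ projGrad (A i) (b i) P x} ≤
      36 * ∫ x, W x ∂(gaussPi ι) := by
  classical
  set q : I → (ι → ℝ) → ℝ := fun i => qf (A i) (b i) (c i) with hq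
  have hqc : ∀ i, Continuous (q i) := fun i => continuous_qf _ _ _
  set F : (ι → ℝ) → ℝ := fun x => Finset.univ.sup' Finset.univ_nonempty fun i => q i x with hF
  have hFc : Continuous F := Continuous.finset_sup'_apply _ fun i _ => hqc i
  have hFge : ∀ i x, q i x ≤ F x := fun i x =>
    Finset.le_sup' (fun i => q i x) (Finset.mem_univ i)
  have hFex : ∀ x, ∃ i, F x = q i x := fun x => by
    obtain ⟨i, -, h⟩ := Finset.exists_mem_eq_sup' Finset.univ_nonempty fun i => q i x
    exact ⟨i, h⟩
  have hFi : Integrable (fun x => softPlus (F x)) (gaussPi ι) := by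
    refine (((integrable_const 1).add (integrable_finsetSum Finset.univ fun i _ =>
      (integrable_qf (A i) (b i) (c i)).abs)).mono' (continuous_softPlus.comp
      hFc).aestronglyMeasurable (Filter.Eventually.of_forall fun x => ?_))
    rw [Real.norm_eq_abs]
    refine (abs_softPlus_le _).trans ?_
    obtain ⟨i, hi⟩ := hFex x
    rw [hi]
    simp only [Pi.add_apply]
    gcongr
    exact Finset.single_le_sum (f := fun i => |q i x|) (fun i _ => abs_nonneg _)
      (Finset.mem_univ i)
  choose C hC0 hC using fun i => softPlus_ouStep (hA i) (b i) (c i) hP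
  set C' := ∑ i, C i with hC'
  have hCle : ∀ i, C i ≤ C' := fun i => Finset.single_le_sum (fun i _ => hC0 i) (Finset.mem_univ i)
  have hC'0 : 0 ≤ C' := Finset.sum_nonneg fun i _ => hC0 i
  set G : Set (ι → ℝ) := {x | (∀ i, q i x ≤ 1) ∧ (∃ i, -1 ≤ q i x) ∧
      ∀ i, τ ≤ projGrad (A i) (b i) P x ⬝ᵥ projGrad (A i) (b i) P x} with hG
  have hGc : MeasurableSet G := by
    have : G = (⋂ i, {x | q i x ≤ 1}) ∩ ((⋃ i, {x | -1 ≤ q i x}) ∩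
        ⋂ i, {x | τ ≤ projGrad (A i) (b i) P x ⬝ᵥ projGrad (A i) (b i) P x}) := by
      ext x; simp [hG]
    rw [this]
    refine (MeasurableSet.iInter fun i => measurableSet_le (hqc i).measurable
      measurable_const).inter
      ((MeasurableSet.iUnion fun i => measurableSet_le measurable_const (hqc i).measurable).inter
      (MeasurableSet.iInter fun i => measurableSet_le measurable_const ?_))
    unfold projGrad
    fun_prop
  set E := ∫ x : ι → ℝ, (1 + ‖x‖) ^ 6 ∂(gaussPi ι) with hE
  have step : ∀ s : ℝ, 0 < s → s ≤ 1 →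
      τ / 36 * (gaussPi ι).real G - ∫ x, W x ∂(gaussPi ι) ≤ s * (C' * E) := by
    intro s hs hs1
    have hs2 : s ^ 2 ≤ 1 := pow_le_one₀ hs.le hs1
    have mp := measurePreserving_ouStep hP hPP hs2
    have hi : Integrable (fun p : (ι → ℝ) × (ι → ℝ) => softPlus (F (ouStep P s p.1 p.2)))
        ((gaussPi ι).prod (gaussPi ι)) := mp.integrable_comp_of_integrable hFi
    have hii := mp.integral_comp_of_aestronglyMeasurable (g := fun x => softPlus (F x))
      hFi.aestronglyMeasurable
    rw [integral_prod _ hi] at hii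
    have i1 : Integrable (fun x => softPlus (F x) - s ^ 2 * W x) (gaussPi ι) :=
      hFi.sub (hWi.const_mul _)
    have i2 : Integrable (G.indicator fun _ => s ^ 2 * (τ / 36)) (gaussPi ι) :=
      (integrable_const _).indicator hGc
    have i3 : Integrable (fun x : ι → ℝ => s ^ 3 * (C' * (1 + ‖x‖) ^ 6)) (gaussPi ι) :=
      ((integrable_one_add_norm_pow 6).const_mul _).const_mul _
    have i4 : Integrable (fun x => softPlus (F x) - s ^ 2 * W x +
        G.indicator (fun _ => s ^ 2 * (τ / 36)) x) (gaussPi ι) := i1.add i2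
    have key := integral_mono_ae (i4.sub i3) hi.integral_prod_left (by
      filter_upwards [hi.prod_right_ae] with x hx
      obtain ⟨i, hix⟩ := hFex x
      obtain ⟨j1, j2, j3⟩ := hC i s hs hs1 x (W x) τ (hW i x)
      have hmono := integral_mono j1 hx fun z => monotone_softPlus (hFge i (ouStep P s x z))
      have h3 : s ^ 3 * (C i * (1 + ‖x‖) ^ 6) ≤ s ^ 3 * (C' * (1 + ‖x‖) ^ 6) := by
        gcongr
        exact hCle i
      have h4 : 0 ≤ s ^ 3 * (C' * (1 + ‖x‖) ^ 6) := by positivity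
      simp only [Pi.sub_apply]
      rw [hix]
      by_cases hx : x ∈ G
      · rw [Set.indicator_of_mem hx]
        obtain ⟨k, hk⟩ := hx.2.1
        have := j3 (abs_le.mpr ⟨hk.trans ((hFge k x).trans_eq hix), hx.1 i⟩) (hx.2.2 i)
        simp only [hq] at this hmono ⊢
        linarith
      · rw [Set.indicator_of_notMem hx]
        simp only [hq] at hmono ⊢
        linarith)
    have e1 := integral_sub i4 i3
    simp only [Pi.sub_apply] at key
    rw [e1, integral_add i1 i2, integral_sub hFi (hWi.const_mul _), hii, integral_const_mul,
      integral_const_mul, integral_const_mul, integral_indicator_const _ hGc, smul_eq_mul] at key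
    have hss : 0 < s ^ 2 := by positivity
    rw [← mul_le_mul_iff_right₀ hss]
    linarith
  have lim : Filter.Tendsto (fun s : ℝ => s * (C' * E)) (nhdsWithin 0 (Set.Ioi 0))
      (nhds 0) := by
    have : Filter.Tendsto (fun s : ℝ => s * (C' * E)) (nhds 0) (nhds (0 * (C' * E))) :=
      (continuous_id.mul continuous_const).tendsto 0
    rw [zero_mul] at this
    exact this.mono_left nhdsWithin_le_nhds
  have := ge_of_tendsto lim (by
    filter_upwards [Ioo_mem_nhdsGT (zero_lt_one' ℝ)] with s hs
    exact step s hs.1 hs.2.le)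
  linarith

theorem integral_chaos_sq {A : Matrix ι ι ℝ} (hA : Aᵀ = A) :
    Integrable (fun x => chaos A x ^ 2) (gaussPi ι) ∧
      ∫ x, chaos A x ^ 2 ∂(gaussPi ι) = 2 * frobSq A := by
  classical
  have e : ∀ x, chaos A x = qf A 0 (-A.trace) x := fun x => by simp [chaos, qf, sub_eq_add_neg]
  have hm : ∫ x, qf A 0 (-A.trace) x ∂(gaussPi ι) = 0 := by
    have hi : Integrable (fun x : ι → ℝ => x ⬝ᵥ A *ᵥ x) (gaussPi ι) :=
      (integrable_qf A 0 0).congr (Filter.Eventually.of_forall fun x => by simp [qf])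
    simp only [qf, zero_dotProduct, add_zero]
    rw [integral_add hi (integrable_const _), integral_quadForm_gaussPi]
    simp
  have hv := variance_qf hA 0 (-A.trace)
  rw [variance_eq_integral (by fun_prop), hm] at hv
  simp only [sub_zero, zero_dotProduct, add_zero] at hv
  refine ⟨?_, by simpa only [e] using hv⟩
  obtain ⟨C, hC, h⟩ := exists_abs_qf_le A 0 (-A.trace)
  refine integrable_of_le_one_add_norm_pow (C := C ^ 2) (N := 4)
    ((continuous_chaos A).pow 2) fun x => ?_
  rw [e, abs_pow]
  refine (pow_le_pow_left₀ (abs_nonneg _) (h x) 2).trans_eq (by ring)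

/-- A quadratic polynomial of unit variance rarely takes values in a short interval. -/
theorem smallBall_qf {A : Matrix ι ι ℝ} (hA : Aᵀ = A) (b : ι → ℝ) (c : ℝ)
    (hvar : 2 * frobSq A + b ⬝ᵥ b = 1) {δ : ℝ} (hδ : 0 < δ) :
    (gaussPi ι).real {x | |qf A b c x| ≤ δ ^ 5} ≤ 60 * δ := by
  classical
  set r := (δ ^ 5)⁻¹ with hr
  have hr0 : 0 < r := by positivity
  obtain ⟨i1, e1⟩ := integral_chaos_sq hA
  have e2 := integral_dotProduct_sq_gaussPi b
  have i2 : Integrable (fun x : ι → ℝ => (b ⬝ᵥ x) ^ 2) (gaussPi ι) := by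
    simpa only [sq_abs, zero_add, zero_mul, add_zero, one_mul] using
      integrable_quad_sq 0 1 0 b (0 : Matrix ι ι ℝ) 2
  set W : (ι → ℝ) → ℝ := fun x => r * (1 + (chaos A x ^ 2 + (b ⬝ᵥ x) ^ 2) / 2) with hWdef
  have i3 : Integrable (fun x => (chaos A x ^ 2 + (b ⬝ᵥ x) ^ 2) / 2) (gaussPi ι) :=
    (i1.add i2).div_const 2
  have hWi : Integrable W (gaussPi ι) := ((integrable_const 1).add i3).const_mul r
  have hWv : ∫ x, W x ∂(gaussPi ι) = r * (3 / 2) := by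
    rw [hWdef, integral_const_mul, integral_add (integrable_const 1) i3, integral_div,
      integral_add i1 i2, e1, e2, hvar]
    simp only [integral_const, probReal_univ, one_smul]
    norm_num
  have key := max_smallBall (I := Unit) (A := fun _ => r • A) (fun _ => by simp [hA])
    (fun _ => r • b) (fun _ => r * c) (P := 1) (by simp) (by simp) hWi (fun _ x => by
      have a1 : chaos (1 * (r • A) * 1) x = r * chaos A x := by
        simp [chaos, smul_mulVec, mul_sub]
      have a2 : linVar (r • A) (r • b) 1 x = r * (b ⬝ᵥ x) := by
        simp only [linVar, one_mulVec, smul_mulVec, add_dotProduct, smul_dotProduct,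
          smul_eq_mul, dotProduct_comm x]
        ring
      rw [a1, a2, abs_mul, abs_mul, abs_of_pos hr0, ← mul_add]
      refine mul_le_mul_of_nonneg_left ?_ hr0.le
      have b1 := sq_nonneg (|chaos A x| - 1)
      have b2 := sq_nonneg (|b ⬝ᵥ x| - 1)
      rw [sub_sq, sq_abs] at b1 b2
      linarith) (r ^ 2 * δ ^ 4)
  rw [hWv] at key
  have hgrad := gradient_smallBall hA hvar hδ
  have hq : ∀ x, qf (r • A) (r • b) (r * c) x = r * qf A b c x := fun x => by
    simp only [qf, smul_mulVec, smul_dotProduct, dotProduct_smul, smul_eq_mul]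
    ring
  have hp : ∀ x, projGrad (r • A) (r • b) 1 x = r • ((2 : ℝ) • A *ᵥ x + b) := fun x => by
    rw [projGrad, one_mulVec, smul_mulVec, smul_add, smul_comm]
  set G : Set (ι → ℝ) := {x | (∀ _ : Unit, qf (r • A) (r • b) (r * c) x ≤ 1) ∧
      (∃ _ : Unit, -1 ≤ qf (r • A) (r • b) (r * c) x) ∧
      ∀ _ : Unit, r ^ 2 * δ ^ 4 ≤ projGrad (r • A) (r • b) 1 x ⬝ᵥ projGrad (r • A) (r • b) 1 x}
  have hsub : {x | |qf A b c x| ≤ δ ^ 5} ⊆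
      G ∪ {x | ((2 : ℝ) • A *ᵥ x + b) ⬝ᵥ ((2 : ℝ) • A *ᵥ x + b) ≤ δ ^ 4} := by
    intro x hx
    simp only [Set.mem_ofPred_eq] at hx
    have hx' := abs_le.mp hx
    have hrd : r * δ ^ 5 = 1 := inv_mul_cancel₀ (by positivity)
    rcases le_total (((2 : ℝ) • A *ᵥ x + b) ⬝ᵥ ((2 : ℝ) • A *ᵥ x + b)) (δ ^ 4) with h | h
    · exact Or.inr h
    · refine Or.inl ⟨fun _ => ?_, ⟨(), ?_⟩, fun _ => ?_⟩
      · rw [hq]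
        exact (mul_le_mul_of_nonneg_left hx'.2 hr0.le).trans_eq hrd
      · rw [hq]
        have := mul_le_mul_of_nonneg_left hx'.1 hr0.le
        linarith
      · rw [hp, smul_dotProduct, dotProduct_smul, smul_eq_mul, smul_eq_mul, ← mul_assoc, ← sq]
        exact mul_le_mul_of_nonneg_left h (sq_nonneg r)
  refine (measureReal_mono hsub).trans ((measureReal_union_le _ _).trans ?_)
  have h1 : r * δ ^ 5 = 1 := inv_mul_cancel₀ (by positivity)
  have h2 : (gaussPi ι).real G ≤ 54 * δ := by
    have : r * ((gaussPi ι).real G) = (r ^ 2 * δ ^ 4 * (gaussPi ι).real G) * δ := by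
      rw [sq]
      linear_combination (-(r * (gaussPi ι).real G)) * h1
    have h3 := mul_le_mul_of_nonneg_right key hδ.le
    rw [← mul_le_mul_iff_right₀ hr0, this]
    linarith
  linarith

end

section
variable {ι : Type*} [Fintype ι]

theorem dotProduct_sq_le (x y : ι → ℝ) : (x ⬝ᵥ y) ^ 2 ≤ (x ⬝ᵥ x) * (y ⬝ᵥ y) := by
  have := Finset.sum_mul_sq_le_sq_mul_sq Finset.univ x y
  simpa only [dotProduct, ← sq] using this

theorem exists_orthonormal_columns (U : Submodule ℝ (ι → ℝ)) :
    ∃ (d : ℕ) (E : Matrix ι (Fin d) ℝ), d = Module.finrank ℝ U ∧ Eᵀ * E = 1 ∧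
      (∀ u ∈ U, (E * Eᵀ) *ᵥ u = u) ∧ ∀ x, (∀ u ∈ U, u ⬝ᵥ x = 0) → (E * Eᵀ) *ᵥ x = 0 := by
  set e := (WithLp.linearEquiv 2 ℝ (ι → ℝ)).symm with he
  set U' : Submodule ℝ (EuclideanSpace ℝ ι) := U.map e.toLinearMap with hU'
  set B := stdOrthonormalBasis ℝ U' with hB
  have hmem : ∀ l, (fun i => (B l : EuclideanSpace ℝ ι) i) ∈ U := by
    intro l
    obtain ⟨u, hu, hu'⟩ := (B l).2
    have : (fun i => (B l : EuclideanSpace ℝ ι) i) = u := by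
      rw [← hu']; rfl
    rw [this]; exact hu
  have hE : ∀ (x : ι → ℝ) l, ((Matrix.of fun i l => (B l : EuclideanSpace ℝ ι) i)ᵀ *ᵥ x) l =
      (fun i => (B l : EuclideanSpace ℝ ι) i) ⬝ᵥ x := fun x l => rfl
  refine ⟨_, Matrix.of fun i l => (B l : EuclideanSpace ℝ ι) i, ?_, ?_, ?_, ?_⟩
  · exact LinearEquiv.finrank_map_eq e U
  · ext l l'
    have := orthonormal_iff_ite.mp B.orthonormal l' l
    rw [Matrix.one_apply]
    rw [Submodule.coe_inner, PiLp.inner_apply] at this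
    simp only [eq_comm (a := l')] at this
    rw [← this]
    simp [Matrix.mul_apply]
  · intro u hu
    have := B.sum_repr' ⟨e u, ⟨u, hu, rfl⟩⟩
    have h2 := congrArg (fun v : U' => (v : EuclideanSpace ℝ ι)) this
    ext i
    have h3 := congrArg (fun v : EuclideanSpace ℝ ι => v i) h2
    simp only [Submodule.coe_sum, Submodule.coe_smul, WithLp.ofLp_sum, Finset.sum_apply,
      PiLp.smul_apply, smul_eq_mul, Submodule.coe_inner, PiLp.inner_apply] at h3
    rw [← mulVec_mulVec]
    have h4 : (e u) i = u i := rfl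
    rw [h4] at h3
    rw [← h3]
    simp only [mulVec, dotProduct, transpose_apply, Matrix.of_apply]
    refine Finset.sum_congr rfl fun l _ => ?_
    rw [mul_comm]
    congr 1
    exact Finset.sum_congr rfl fun j _ => mul_comm _ _
  · intro x hx
    rw [← mulVec_mulVec]
    have : (Matrix.of fun i l => (B l : EuclideanSpace ℝ ι) i)ᵀ *ᵥ x = 0 := by
      ext l
      rw [hE]
      exact hx _ (hmem l)
    rw [this, mulVec_zero]

/-- `A` has norm at most `a` on the orthogonal complement of `U`. -/
def OpLEOn (A : Matrix ι ι ℝ) (U : Submodule ℝ (ι → ℝ)) (a : ℝ) : Prop :=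
  ∀ x, (∀ u ∈ U, u ⬝ᵥ x = 0) → (A *ᵥ x) ⬝ᵥ (A *ᵥ x) ≤ a ^ 2 * (x ⬝ᵥ x)

theorem OpLEOn.mono {A : Matrix ι ι ℝ} {U V : Submodule ℝ (ι → ℝ)} {a : ℝ}
    (h : OpLEOn A U a) (hUV : U ≤ V) : OpLEOn A V a :=
  fun x hx => h x fun u hu => hx u (hUV hu)

theorem orthogonal_sub_proj {U : Submodule ℝ (ι → ℝ)} [DecidableEq ι] {d : ℕ}
    {E : Matrix ι (Fin d) ℝ} (h2 : ∀ u ∈ U, (E * Eᵀ) *ᵥ u = u) (x u : ι → ℝ) (hu : u ∈ U) :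
    u ⬝ᵥ (1 - E * Eᵀ) *ᵥ x = 0 := by
  rw [dotProduct_mulVec_eq_transpose, transpose_sub, transpose_one, transpose_mul,
    transpose_transpose, sub_mulVec, one_mulVec, h2 u hu, sub_self, zero_dotProduct]

theorem proj_isSymm_idem [DecidableEq ι] {d : ℕ} {E : Matrix ι (Fin d) ℝ} (h1 : Eᵀ * E = 1) :
    (1 - E * Eᵀ)ᵀ = 1 - E * Eᵀ ∧ (1 - E * Eᵀ) * (1 - E * Eᵀ) = 1 - E * Eᵀ := by
  refine ⟨by simp [transpose_mul], ?_⟩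
  have : E * Eᵀ * (E * Eᵀ) = E * Eᵀ := by
    rw [Matrix.mul_assoc, ← Matrix.mul_assoc Eᵀ, h1, Matrix.one_mul]
  rw [mul_sub, sub_mul, sub_mul, this]
  simp

theorem proj_dotProduct_le {P : Matrix ι ι ℝ} (hP : Pᵀ = P) (hPP : P * P = P) (x : ι → ℝ) :
    P *ᵥ x ⬝ᵥ P *ᵥ x ≤ x ⬝ᵥ x := by
  have h := dotProduct_self_nonneg' (x - P *ᵥ x)
  have e : x ⬝ᵥ P *ᵥ x = P *ᵥ x ⬝ᵥ P *ᵥ x := by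
    rw [dotProduct_mulVec_eq_transpose (x := P *ᵥ x), hP, mulVec_mulVec, hPP, dotProduct_comm]
  simp only [sub_dotProduct, dotProduct_sub, dotProduct_comm (P *ᵥ x) x, e] at h
  linarith

/-- If `A` restricted to the complement of `U` has few large singular values, adding the
corresponding directions to `U` makes `A` small on the complement. -/
theorem exists_enlarged_subspace [DecidableEq ι] {A : Matrix ι ι ℝ} (hA : Aᵀ = A)
    {U : Submodule ℝ (ι → ℝ)} {P O : Matrix ι ι ℝ} (hP : Pᵀ = P)
    (hPU : ∀ x, (∀ u ∈ U, u ⬝ᵥ x = 0) → P *ᵥ x = x) {h : ι → ℝ} (hPP : P * P = P)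
    (hO : O * Oᵀ = 1) (hH : A * P * A = O * diagonal h * Oᵀ) (t : ℝ) :
    ∃ V : Submodule ℝ (ι → ℝ), U ≤ V ∧
      Module.finrank ℝ V ≤ Module.finrank ℝ U + (Finset.univ.filter fun l => t ^ 2 ≤ h l).card ∧
      OpLEOn A V t := by
  set f : ι → ι → ℝ := fun l => (P * A * O) *ᵥ Pi.single l 1 with hf
  set L := Finset.univ.filter fun l => t ^ 2 ≤ h l with hL
  set S := Submodule.span ℝ ((L.image f : Finset (ι → ℝ)) : Set (ι → ℝ)) with hS
  refine ⟨U ⊔ S, le_sup_left, ?_, ?_⟩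
  · refine (Submodule.finrank_add_le_finrank_add_finrank U S).trans (Nat.add_le_add_left ?_ _)
    exact (finrank_span_finset_le_card _).trans Finset.card_image_le
  · intro x hx
    have hxU : P *ᵥ x = x := hPU x fun u hu => hx u (Submodule.mem_sup_left hu)
    have hxL : ∀ l ∈ L, (Oᵀ *ᵥ A *ᵥ x) l = 0 := by
      intro l hl
      have h1 := hx (f l) (Submodule.mem_sup_right
        (Submodule.subset_span (Finset.mem_coe.mpr (Finset.mem_image_of_mem f hl))))
      rw [hf] at h1
      simp only at h1
      rw [dotProduct_comm, dotProduct_mulVec_eq_transpose, transpose_mul, transpose_mul, hP, hA,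
        ← mulVec_mulVec, ← mulVec_mulVec, hxU, dotProduct_single_one] at h1
      exact h1
    set z := A *ᵥ x with hz
    have hzz : z ⬝ᵥ z = (P *ᵥ A *ᵥ z) ⬝ᵥ x := by
      conv_lhs => rw [hz, dotProduct_mulVec_eq_transpose, hA, ← hz, ← hxU,
        dotProduct_mulVec_eq_transpose, hP]
    have hw : (P *ᵥ A *ᵥ z) ⬝ᵥ (P *ᵥ A *ᵥ z) = ∑ l, h l * (Oᵀ *ᵥ z) l ^ 2 := by
      rw [← dotProduct_diagonalized, ← hH, dotProduct_mulVec_eq_transpose, hP, mulVec_mulVec,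
        hPP, ← mulVec_mulVec, ← mulVec_mulVec, dotProduct_mulVec_eq_transpose, hA,
        dotProduct_comm]
    have hzO : z ⬝ᵥ z = ∑ l, (Oᵀ *ᵥ z) l ^ 2 := by
      rw [← dotProduct_mulVec_orthogonal (O := Oᵀ) (by simpa using hO) z z]
      simp only [dotProduct, sq]
    have hle : (P *ᵥ A *ᵥ z) ⬝ᵥ (P *ᵥ A *ᵥ z) ≤ t ^ 2 * (z ⬝ᵥ z) := by
      rw [hw, hzO, Finset.mul_sum]
      refine Finset.sum_le_sum fun l _ => ?_
      by_cases hl : l ∈ L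
      · rw [hxL l hl]; simp
      · have : h l < t ^ 2 := by simpa [hL] using hl
        exact mul_le_mul_of_nonneg_right this.le (sq_nonneg _)
    have hcs := dotProduct_sq_le (P *ᵥ A *ᵥ z) x
    rw [← hzz] at hcs
    have hx0 := dotProduct_self_nonneg' x
    have hz0 := dotProduct_self_nonneg' z
    rcases hz0.eq_or_lt with h0 | h0
    · rw [← h0]; positivity
    · have := hcs.trans (mul_le_mul_of_nonneg_right hle hx0)
      rw [← mul_le_mul_iff_right₀ h0]
      linarith

end

section
variable {ι : Type*} [Fintype ι]

theorem eigenvalue_mem_of_OpLE [DecidableEq ι] {A P O : Matrix ι ι ℝ} (hA : Aᵀ = A)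
    (hP : Pᵀ = P) (hPP : P * P = P) {h : ι → ℝ} (hO : Oᵀ * O = 1)
    (hH : A * P * A = O * diagonal h * Oᵀ) {a : ℝ} (hop : OpLE (A * P) a) (l : ι) :
    0 ≤ h l ∧ h l ≤ a ^ 2 := by
  set f : ι → ℝ := O *ᵥ Pi.single l 1 with hf
  have e1 : h l = f ⬝ᵥ (A * P * A) *ᵥ f := by
    rw [hH, dotProduct_diagonalized, hf, mulVec_mulVec, hO, one_mulVec]
    rw [Finset.sum_eq_single l]
    · simp
    · intro j _ hj; simp [hj]
    · simp
  have hff : f ⬝ᵥ f = 1 := by rw [hf, dotProduct_mulVec_orthogonal hO]; simp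
  set g := P *ᵥ A *ᵥ f with hg
  have e2 : h l = g ⬝ᵥ g := by
    have : P *ᵥ P *ᵥ A *ᵥ f = P *ᵥ A *ᵥ f := by rw [mulVec_mulVec, hPP]
    rw [e1, hg, dotProduct_mulVec_eq_transpose (M := P), hP, this, ← mulVec_mulVec,
      ← mulVec_mulVec, dotProduct_mulVec_eq_transpose, hA, dotProduct_comm]
  have e3 : h l = f ⬝ᵥ (A * P) *ᵥ g := by
    have : P *ᵥ P *ᵥ A *ᵥ f = P *ᵥ A *ᵥ f := by rw [mulVec_mulVec, hPP]
    rw [e1, hg, ← mulVec_mulVec (M := A) (N := P), this, ← mulVec_mulVec, ← mulVec_mulVec]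
  have h0 : 0 ≤ h l := e2 ▸ dotProduct_self_nonneg' g
  refine ⟨h0, ?_⟩
  have h1 := dotProduct_sq_le f ((A * P) *ᵥ g)
  rw [← e3, hff, one_mul] at h1
  have h2 := h1.trans (hop g)
  rw [← e2] at h2
  rcases h0.eq_or_lt with h3 | h3
  · rw [← h3]; positivity
  · rw [← mul_le_mul_iff_left₀ h3]
    linarith

theorem exists_subspace [DecidableEq ι] {I : Type*} [Fintype I]
    {A : I → Matrix ι ι ℝ} (hA : ∀ i, (A i)ᵀ = A i) (hF : ∀ i, frobSq (A i) ≤ 1)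
    (b : I → ι → ℝ) {κ : ℝ} (hκ : 0 < κ) (hκ1 : κ ≤ 1) (m J : ℕ) :
    ∃ (d : ℕ) (E : Matrix ι (Fin d) ℝ), d ≤ Fintype.card I * (1 + m * J) ∧ Eᵀ * E = 1 ∧
      ∀ i, (E * Eᵀ) *ᵥ b i = b i ∧ ∃ (a : ℝ) (O : Matrix ι ι ℝ) (h : ι → ℝ), 0 < a ∧ a ≤ 1 ∧
        O * Oᵀ = 1 ∧ Oᵀ * O = 1 ∧ A i * (1 - E * Eᵀ) * A i = O * diagonal h * Oᵀ ∧
        OpLE (A i * (1 - E * Eᵀ)) a ∧ (∀ l, 0 ≤ h l ∧ h l ≤ a ^ 2) ∧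
        (m ≤ (Finset.univ.filter fun l => (κ * a) ^ 2 ≤ h l).card ∨ a ≤ κ ^ J) := by
  classical
  let valid : Submodule ℝ (ι → ℝ) → (I → ℕ) → Prop := fun U j =>
    (∀ i, j i ≤ J) ∧ (∀ i, b i ∈ U) ∧
      Module.finrank ℝ U ≤ Fintype.card I + m * ∑ i, j i ∧ ∀ i, OpLEOn (A i) U (κ ^ j i)
  have h0 : valid (Submodule.span ℝ (Set.range b)) 0 := by
    refine ⟨fun i => Nat.zero_le _, fun i => Submodule.subset_span ⟨i, rfl⟩, ?_, fun i x _ => ?_⟩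
    · exact (finrank_range_le_card b).trans (Nat.le_add_right _ _)
    · have := OpLE_of_frobSq_le (a := 1) (by simpa using hF i) x
      simpa using this
  obtain ⟨U, j, hUj, hmax⟩ : ∃ U j, valid U j ∧ ∀ U' j', valid U' j' → ∑ i, j' i ≤ ∑ i, j i := by
    let S : Set ℕ := {N | ∃ U j, valid U j ∧ ∑ i, j i = N}
    have hne : S.Nonempty := ⟨_, _, _, h0, rfl⟩
    have hbd : BddAbove S := by
      refine ⟨∑ _ : I, J, ?_⟩
      rintro N ⟨U, j, h, rfl⟩
      exact Finset.sum_le_sum fun i _ => h.1 i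
    obtain ⟨U, j, h1, h2⟩ := Nat.sSup_mem hne hbd
    exact ⟨U, j, h1, fun U' j' h' => h2 ▸ le_csSup hbd ⟨U', j', h', rfl⟩⟩
  obtain ⟨hj, hb, hd, hop⟩ := hUj
  obtain ⟨d, E, hdE, hE, hE1, hE2⟩ := exists_orthonormal_columns U
  obtain ⟨hP, hPP⟩ := proj_isSymm_idem hE
  have hPU : ∀ x, (∀ u ∈ U, u ⬝ᵥ x = 0) → (1 - E * Eᵀ) *ᵥ x = x := fun x hx => by
    rw [sub_mulVec, hE2 x hx, one_mulVec, sub_zero]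
  refine ⟨d, E, ?_, hE, fun i => ⟨hE1 _ (hb i), ?_⟩⟩
  · rw [hdE]
    have : ∑ i, j i ≤ Fintype.card I * J := by
      simpa using Finset.sum_le_sum fun i (_ : i ∈ Finset.univ) => hj i
    have := Nat.mul_le_mul_left m this
    refine hd.trans ?_
    rw [mul_add, mul_one, Nat.mul_left_comm]
    exact Nat.add_le_add_left this _
  · obtain ⟨O, h, hO, hO', hH⟩ := exists_orthogonal_diagonalization
      (B := A i * (1 - E * Eᵀ) * A i) (by
        rw [transpose_mul, transpose_mul, hA, hP, Matrix.mul_assoc])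
    have hopP : OpLE (A i * (1 - E * Eᵀ)) (κ ^ j i) := fun x => by
      rw [← mulVec_mulVec]
      exact (hop i _ fun u hu => orthogonal_sub_proj hE1 x u hu).trans
        (mul_le_mul_of_nonneg_left (proj_dotProduct_le hP hPP x) (sq_nonneg _))
    refine ⟨κ ^ j i, O, h, by positivity, pow_le_one₀ hκ.le hκ1, hO, hO', hH, hopP,
      eigenvalue_mem_of_OpLE (hA i) hP hPP hO' hH hopP, ?_⟩
    rcases (hj i).eq_or_lt with hJ | hJ
    · right; rw [hJ]
    · left
      by_contra! hcard
      obtain ⟨V, hUV, hV, hopV⟩ := exists_enlarged_subspace (hA i) hP hPU hPP hO hH (κ * κ ^ j i)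
      have hsum : ∑ i', Function.update j i (j i + 1) i' = ∑ i, j i + 1 := by
        rw [Finset.sum_update_of_mem (Finset.mem_univ i), ← Finset.add_sum_erase _ _
          (Finset.mem_univ i), Finset.sdiff_singleton_eq_erase]
        omega
      have := hmax V (Function.update j i (j i + 1)) ⟨fun i' => ?_, fun i' => hUV (hb i'), ?_,
        fun i' => ?_⟩
      · omega
      · rcases eq_or_ne i' i with rfl | hne
        · simpa using hJ
        · simpa [hne] using hj i'
      · rw [hsum, mul_add, mul_one]
        omega
      · rcases eq_or_ne i' i with rfl | hne
        · rw [Function.update_self, pow_succ']; exact hopV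
        · rw [Function.update_of_ne hne]; exact (hop i').mono hUV

end

section
variable {ι : Type*} [Fintype ι]

theorem frobSq_transpose (B : Matrix ι ι ℝ) : frobSq Bᵀ = frobSq B := by
  rw [frobSq, frobSq, Finset.sum_comm]; rfl

theorem frobSq_proj_mul_le {P : Matrix ι ι ℝ} (hP : Pᵀ = P) (hPP : P * P = P)
    (B : Matrix ι ι ℝ) : frobSq (P * B) ≤ frobSq B := by
  have e : ∀ B : Matrix ι ι ℝ, frobSq B = ∑ j, (B.col j) ⬝ᵥ (B.col j) := fun B => by
    rw [frobSq, Finset.sum_comm]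
    simp [dotProduct, Matrix.col, sq]
  rw [e, e]
  exact Finset.sum_le_sum fun j _ => proj_dotProduct_le hP hPP (B.col j)

theorem frobSq_add_le (B C : Matrix ι ι ℝ) : frobSq (B + C) ≤ 2 * frobSq B + 2 * frobSq C := by
  simp only [frobSq, Finset.mul_sum, ← Finset.sum_add_distrib]
  refine Finset.sum_le_sum fun i _ => Finset.sum_le_sum fun j _ => ?_
  rw [Matrix.add_apply]
  linarith [add_sq_le (a := B i j) (b := C i j)]

theorem OpLE.transpose {B : Matrix ι ι ℝ} {a : ℝ} (h : OpLE B a) : OpLE Bᵀ a := by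
  intro x
  set y := Bᵀ *ᵥ x with hy
  have h1 := dotProduct_sq_le x (B *ᵥ y)
  rw [dotProduct_mulVec_eq_transpose, ← hy] at h1
  have h2 := h1.trans (mul_le_mul_of_nonneg_left (h y) (dotProduct_self_nonneg' x))
  rcases (dotProduct_self_nonneg' y).eq_or_lt with h3 | h3
  · rw [← h3]
    exact mul_nonneg (sq_nonneg a) (dotProduct_self_nonneg' x)
  · rw [← mul_le_mul_iff_left₀ h3]
    linarith

theorem OpLE.add {B C : Matrix ι ι ℝ} {a : ℝ} (hB : OpLE B a) (hC : OpLE C a) :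
    OpLE (B + C) (2 * a) := by
  intro x
  have h := dotProduct_self_nonneg' (B *ᵥ x - C *ᵥ x)
  have h1 := hB x
  have h2 := hC x
  simp only [add_mulVec, sub_dotProduct, dotProduct_sub, add_dotProduct, dotProduct_add] at h ⊢
  rw [mul_pow]
  linarith

/-- An upper bound for the effect of rescaling along the range of `P`. -/
noncomputable def rescaleBound (A P : Matrix ι ι ℝ) (x : ι → ℝ) : ℝ :=
  3 * |chaos (P * A * P) x| + |chaos (P * A + A * P) x|

theorem trace_proj_mul {P : Matrix ι ι ℝ} (hPP : P * P = P) (A : Matrix ι ι ℝ) :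
    (P * A * P).trace = (P * A).trace := by
  rw [trace_mul_comm, ← Matrix.mul_assoc, hPP]

theorem linVar_eq {A P : Matrix ι ι ℝ} (hA : Aᵀ = A) (hP : Pᵀ = P) (hPP : P * P = P) {b : ι → ℝ}
    (hb : P *ᵥ b = 0) (x : ι → ℝ) :
    linVar A b P x = chaos (P * A + A * P) x - 2 * chaos (P * A * P) x := by
  rw [linVar_eq_qf, hA, hP, hb]
  have e : x ⬝ᵥ (P * A) *ᵥ x = x ⬝ᵥ (A * P) *ᵥ x := by
    rw [dotProduct_mulVec_eq_transpose, transpose_mul, hP, hA, dotProduct_comm]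
  simp only [chaos, qf, sub_mulVec, add_mulVec, smul_mulVec, dotProduct_sub, dotProduct_add,
    dotProduct_smul, smul_eq_mul, trace_add, trace_proj_mul hPP, trace_mul_comm A P, e,
    zero_dotProduct]
  ring

theorem le_rescaleBound {A P : Matrix ι ι ℝ} (hA : Aᵀ = A) (hP : Pᵀ = P) (hPP : P * P = P)
    {b : ι → ℝ} (hb : P *ᵥ b = 0) (x : ι → ℝ) :
    |chaos (P * A * P) x| + |linVar A b P x| ≤ rescaleBound A P x := by
  rw [linVar_eq hA hP hPP hb, rescaleBound]
  have := abs_sub (chaos (P * A + A * P) x) (2 * chaos (P * A * P) x)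
  rw [abs_mul, abs_two] at this
  linarith

@[fun_prop]
theorem continuous_rescaleBound (A P : Matrix ι ι ℝ) : Continuous (rescaleBound A P) := by
  unfold rescaleBound; fun_prop

theorem frobSq_mul_proj {A P : Matrix ι ι ℝ} (hA : Aᵀ = A) (hP : Pᵀ = P) (hPP : P * P = P) :
    frobSq (A * P) = (A * P * A).trace := by
  rw [frobSq_eq_trace, transpose_mul, hA, hP, Matrix.mul_assoc A P, ← Matrix.mul_assoc P P, hPP,
    Matrix.mul_assoc]

theorem frobSq_sandwich_le {A P : Matrix ι ι ℝ} (hA : Aᵀ = A) (hP : Pᵀ = P) (hPP : P * P = P) :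
    frobSq (P * A * P) ≤ (A * P * A).trace ∧
      frobSq (P * A + A * P) ≤ 4 * (A * P * A).trace := by
  have h := frobSq_mul_proj hA hP hPP
  refine ⟨?_, ?_⟩
  · rw [← h, Matrix.mul_assoc]
    exact frobSq_proj_mul_le hP hPP _
  · have e : frobSq (P * A) = frobSq (A * P) := by
      rw [← frobSq_transpose, transpose_mul, hA, hP]
    have := frobSq_add_le (P * A) (A * P)
    rw [e, h] at this
    linarith

theorem OpLE_sandwich {A P : Matrix ι ι ℝ} (hA : Aᵀ = A) (hP : Pᵀ = P) (hPP : P * P = P)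
    {a : ℝ} (h : OpLE (A * P) a) : OpLE (P * A * P) a ∧ OpLE (P * A + A * P) (2 * a) := by
  refine ⟨fun x => ?_, ?_⟩
  · rw [Matrix.mul_assoc, ← mulVec_mulVec]
    exact (proj_dotProduct_le hP hPP _).trans (h x)
  · have := h.transpose
    rw [transpose_mul, hA, hP] at this
    exact this.add h

theorem rescaleBound_tail {A P : Matrix ι ι ℝ} (hA : Aᵀ = A) (hP : Pᵀ = P) (hPP : P * P = P)
    {a w R : ℝ} (ha : 0 < a) (hop : OpLE (A * P) a) (hw : 0 < w) (hR : 0 < R)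
    (hS : (A * P * A).trace ≤ w ^ 2) (haw : R * a ^ 2 ≤ w ^ 2) {l : ℝ} (hl : 0 ≤ l) :
    (gaussPi ι).real {x | (6 * √R + 24 * l / √R) * w < rescaleBound A P x} ≤
      4 * Real.exp (-l) := by
  classical
  obtain ⟨f1, f2⟩ := frobSq_sandwich_le hA hP hPP
  obtain ⟨o1, o2⟩ := OpLE_sandwich hA hP hPP hop
  have s1 : (P * A * P)ᵀ = P * A * P := by
    rw [transpose_mul, transpose_mul, hA, hP, Matrix.mul_assoc]
  have s2 : (P * A + A * P)ᵀ = P * A + A * P := by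
    rw [transpose_add, transpose_mul, transpose_mul, hA, hP, add_comm]
  set r := √R with hr
  have hr0 : 0 < r := Real.sqrt_pos.mpr hR
  have hr2 : r ^ 2 = R := Real.sq_sqrt hR.le
  have hra : r * a ≤ w := by
    rw [← hr2, ← mul_pow] at haw
    exact (pow_le_pow_iff_left₀ (by positivity) hw.le two_ne_zero).mp haw
  have t1 := chaos_tail s1 ha.le o1 (t := r / (4 * w)) (X := (6 * r + 24 * l / r) * w / 6)
    (by positivity) (by rw [div_mul_eq_mul_div, div_le_iff₀ (by positivity)]; linarith)
    (f1.trans hS)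
  have t2 := chaos_tail s2 (by positivity) o2 (t := r / (8 * w))
    (X := (6 * r + 24 * l / r) * w / 2)
    (by positivity) (by rw [div_mul_eq_mul_div, div_le_iff₀ (by positivity)]; linarith)
    (f2.trans (mul_le_mul_of_nonneg_left hS (by norm_num : (0 : ℝ) ≤ 4)))
  have x1 : 4 * (r / (4 * w)) ^ 2 * w ^ 2 - r / (4 * w) * ((6 * r + 24 * l / r) * w / 6) = -l := by
    field_simp
    ring
  have x2 : 4 * (r / (8 * w)) ^ 2 * (4 * w ^ 2) - r / (8 * w) * ((6 * r + 24 * l / r) * w / 2) ≤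
      -l := by
    have : 4 * (r / (8 * w)) ^ 2 * (4 * w ^ 2) - r / (8 * w) * ((6 * r + 24 * l / r) * w / 2) =
      -(r ^ 2 / 8) - 3 / 2 * l := by
      field_simp
      ring
    rw [this]
    linarith [sq_nonneg r]
  rw [x1] at t1
  have t2' := t2.trans (mul_le_mul_of_nonneg_left (Real.exp_le_exp.mpr x2) zero_le_two)
  refine (measureReal_mono (s₂ := {x | (6 * r + 24 * l / r) * w / 6 ≤ |chaos (P * A * P) x|} ∪
    {x | (6 * r + 24 * l / r) * w / 2 ≤ |chaos (P * A + A * P) x|}) fun x hx => ?_).trans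
    ((measureReal_union_le _ _).trans (by linarith))
  simp only [Set.mem_ofPred_eq, rescaleBound] at hx
  simp only [Set.mem_union, Set.mem_ofPred_eq]
  by_contra! hcon
  linarith

theorem rescaleBound_pow_four {A P : Matrix ι ι ℝ} (hA : Aᵀ = A) (hP : Pᵀ = P)
    (hPP : P * P = P) {w : ℝ} (hw : 0 < w) (hS : (A * P * A).trace ≤ w ^ 2) :
    Integrable (fun x => (rescaleBound A P x / w) ^ 4) (gaussPi ι) ∧
      ∫ x, (rescaleBound A P x / w) ^ 4 ∂(gaussPi ι) ≤ 2 ^ 24 := by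
  classical
  obtain ⟨f1, f2⟩ := frobSq_sandwich_le hA hP hPP
  have s1 : (P * A * P)ᵀ = P * A * P := by
    rw [transpose_mul, transpose_mul, hA, hP, Matrix.mul_assoc]
  have s2 : (P * A + A * P)ᵀ = P * A + A * P := by
    rw [transpose_add, transpose_mul, transpose_mul, hA, hP, add_comm]
  obtain ⟨i1, e1⟩ := chaos_pow_four s1 hw (f1.trans hS)
  obtain ⟨i2, e2⟩ := chaos_pow_four s2 (F := 2 * w) (by positivity) (f2.trans (by
    rw [mul_pow]; linarith))
  set D : (ι → ℝ) → ℝ := fun x =>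
    (648 * chaos (P * A * P) x ^ 4 + 8 * chaos (P * A + A * P) x ^ 4) / w ^ 4 with hD
  have iD : Integrable D (gaussPi ι) := ((i1.const_mul _).add (i2.const_mul _)).div_const _
  have hle : ∀ x, (rescaleBound A P x / w) ^ 4 ≤ D x := fun x => by
    rw [div_pow]
    simp only [hD]
    gcongr
    rw [rescaleBound]
    have h4 : ∀ u : ℝ, u ^ 4 = |u| ^ 4 := fun u => (Even.pow_abs (by decide) u).symm
    rw [h4 (chaos (P * A * P) x), h4 (chaos (P * A + A * P) x)]
    have := add_pow_le (show 0 ≤ 3 * |chaos (P * A * P) x| by positivity)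
      (abs_nonneg (chaos (P * A + A * P) x)) 4
    rw [mul_pow] at this
    norm_num at this ⊢
    linarith
  have hnn : ∀ x, 0 ≤ (rescaleBound A P x / w) ^ 4 := fun x => by positivity
  have hInt : Integrable (fun x => (rescaleBound A P x / w) ^ 4) (gaussPi ι) :=
    iD.mono' (by fun_prop) (Filter.Eventually.of_forall fun x => by
      rw [Real.norm_eq_abs, abs_of_nonneg (hnn x)]; exact hle x)
  refine ⟨hInt, (integral_mono hInt iD hle).trans ?_⟩
  rw [hD, integral_div, integral_add (i1.const_mul _) (i2.const_mul _), integral_const_mul,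
    integral_const_mul, div_le_iff₀ (by positivity)]
  rw [mul_pow] at e2
  have : 0 < w ^ 4 := by positivity
  linarith

end

section
variable {ι : Type*} [Fintype ι]

theorem le_prod_of_le_sum {h : ι → ℝ} {a t : ℝ} (ha : 0 < a) (ht : 0 ≤ t)
    (hh : ∀ j, 0 ≤ h j ∧ h j ≤ a) {m : ℕ} (hm : 0 < m) (hS : m * a ≤ ∑ j, h j) :
    (1 + t * ((∑ j, h j) / m)) ^ m ≤ ∏ j, (1 + t * h j) := by
  set S := ∑ j, h j with hSd
  have hm' : (0 : ℝ) < m := Nat.cast_pos.mpr hm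
  have hta : 0 ≤ t * a := mul_nonneg ht ha.le
  have h1 : (1 + t * a) ^ (S / a) ≤ ∏ j, (1 + t * h j) := by
    rw [hSd, Finset.sum_div, Real.rpow_sum_of_pos (by linarith)]
    refine Finset.prod_le_prod (fun j _ => Real.rpow_nonneg (by linarith) _) fun j _ => ?_
    refine (rpow_one_add_le_one_add_mul_self (by linarith) (div_nonneg (hh j).1 ha.le)
      ((div_le_one ha).mpr (hh j).2)).trans_eq ?_
    field_simp
  have h2 : 1 + t * (S / m) ≤ (1 + t * a) ^ (S / (m * a)) := by
    refine Eq.trans_le ?_ (one_add_mul_self_le_rpow_one_add (by linarith)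
      ((one_le_div (by positivity)).mpr hS))
    field_simp
  have hS0 : 0 ≤ S := Finset.sum_nonneg fun j _ => (hh j).1
  refine ((pow_le_pow_left₀ (by positivity) h2 m).trans_eq ?_).trans h1
  rw [← Real.rpow_natCast, ← Real.rpow_mul (by linarith)]
  congr 1
  field_simp

theorem le_prod_of_le_card {h : ι → ℝ} {a t : ℝ} (ht : 0 ≤ t)
    (hh : ∀ j, 0 ≤ h j) (ha : 0 ≤ a) {m : ℕ}
    (hc : m ≤ (Finset.univ.filter fun l => a ≤ h l).card) :
    (1 + t * a) ^ m ≤ ∏ j, (1 + t * h j) := by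
  set F := Finset.univ.filter fun l => a ≤ h l with hF
  have hta : 0 ≤ t * a := mul_nonneg ht ha
  calc (1 + t * a) ^ m ≤ (1 + t * a) ^ F.card := pow_le_pow_right₀ (by linarith) hc
    _ = ∏ j ∈ F, (1 + t * a) := by rw [Finset.prod_const]
    _ ≤ ∏ j ∈ F, (1 + t * h j) := Finset.prod_le_prod (fun _ _ => by linarith) fun j hj => by
        have := mul_le_mul_of_nonneg_left (Finset.mem_filter.mp hj).2 ht
        linarith
    _ ≤ ∏ j, (1 + t * h j) := Finset.prod_le_prod_of_subset_of_one_le (Finset.subset_univ _)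
        (fun j _ => by have := mul_nonneg ht (hh j); linarith)
        fun j _ _ => by have := mul_nonneg ht (hh j); linarith

theorem flat_smallBall [DecidableEq ι] {O : Matrix ι ι ℝ} {h : ι → ℝ} (hO : Oᵀ * O = 1)
    {a κ : ℝ} (ha : 0 < a) (hκ : 0 < κ) (hκ1 : κ ≤ 1) (hh : ∀ l, 0 ≤ h l ∧ h l ≤ a ^ 2) {m : ℕ}
    (hm : 0 < m) (hflat : m * a ^ 2 ≤ ∑ l, h l ∨ ∑ l, h l < m * a ^ 2 ∧
      m ≤ (Finset.univ.filter fun l => (κ * a) ^ 2 ≤ h l).card) :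
    m * (κ * a) ^ 2 ≤ ∑ l, h l ∧
    (gaussPi ι).real {x | x ⬝ᵥ (O * diagonal h * Oᵀ) *ᵥ x ≤ κ ^ 3 * ∑ l, h l} ≤
      √((Real.exp 1 * κ) ^ m) := by
  set S := ∑ l, h l with hS
  have hm' : (0 : ℝ) < m := Nat.cast_pos.mpr hm
  have hκ2 : κ ^ 2 ≤ 1 := pow_le_one₀ hκ.le hκ1
  have hSm : m * (κ * a) ^ 2 ≤ S := by
    rcases hflat with h1 | ⟨-, h2⟩
    · refine le_trans ?_ h1
      rw [mul_pow]
      exact mul_le_mul_of_nonneg_left (mul_le_of_le_one_left (sq_nonneg a) hκ2) hm'.le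
    · calc m * (κ * a) ^ 2 ≤ ((Finset.univ.filter fun l => (κ * a) ^ 2 ≤ h l).card : ℝ) *
            (κ * a) ^ 2 := by gcongr
        _ = ∑ l ∈ Finset.univ.filter fun l => (κ * a) ^ 2 ≤ h l, (κ * a) ^ 2 := by
            rw [Finset.sum_const, nsmul_eq_mul]
        _ ≤ ∑ l ∈ Finset.univ.filter fun l => (κ * a) ^ 2 ≤ h l, h l :=
            Finset.sum_le_sum fun l hl => (Finset.mem_filter.mp hl).2
        _ ≤ S := Finset.sum_le_sum_of_subset_of_nonneg (Finset.subset_univ _)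
            fun l _ _ => (hh l).1
  refine ⟨hSm, ?_⟩
  have hS0 : 0 < S := lt_of_lt_of_le (by positivity) hSm
  set t := m / (2 * S * κ ^ 3) with ht
  have ht0 : 0 < t := by positivity
  have hprod : (1 + κ⁻¹) ^ m ≤ ∏ j, (1 + 2 * (t * h j)) := by
    have e : ∀ j, 1 + 2 * (t * h j) = 1 + (2 * t) * h j := fun j => by ring
    simp only [e]
    rcases hflat with h1 | ⟨h1, h2⟩
    · refine le_trans (pow_le_pow_left₀ (by positivity) ?_ m)
        (le_prod_of_le_sum (by positivity) (by positivity) hh hm h1)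
      have : 2 * t * (S / m) = κ⁻¹ * (κ ^ 2)⁻¹ := by rw [ht]; field_simp
      rw [← hS, this]
      have := le_mul_of_one_le_right (inv_nonneg.mpr hκ.le) ((one_le_inv₀ (by positivity)).mpr hκ2)
      linarith
    · refine le_trans (pow_le_pow_left₀ (by positivity) ?_ m)
        (le_prod_of_le_card (by positivity) (fun j => (hh j).1) (sq_nonneg _) h2)
      have : 2 * t * (κ * a) ^ 2 = κ⁻¹ * (m * a ^ 2 / S) := by rw [ht]; field_simp
      rw [this]
      have := le_mul_of_one_le_right (inv_nonneg.mpr hκ.le) ((one_le_div hS0).mpr h1.le)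
      linarith
  refine (quadForm_smallBall hO (fun j => (hh j).1) ht0.le _).trans ?_
  have e1 : Real.exp (t * (κ ^ 3 * S)) = √(Real.exp 1 ^ m) := by
    rw [Real.exp_one_pow, Real.sqrt_eq_rpow, ← Real.exp_mul, ht]
    congr 1
    field_simp
  rw [e1, mul_pow, Real.sqrt_mul (by positivity), ← Real.sqrt_inv]
  refine mul_le_mul_of_nonneg_left (Real.sqrt_le_sqrt ?_) (Real.sqrt_nonneg _)
  rw [inv_le_comm₀ (lt_of_lt_of_le (by positivity) hprod) (by positivity), ← inv_pow]
  refine le_trans (pow_le_pow_left₀ (by positivity) ?_ m) hprod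
  linarith

/-- After removing a small subspace, each rescaling error has a width `w` controlling its tails,
and either `w` is tiny or the gradient is unlikely to be small compared to `w`. -/
theorem exists_subspace_width [DecidableEq ι] {I : Type*} [Fintype I]
    {A : I → Matrix ι ι ℝ} (hA : ∀ i, (A i)ᵀ = A i) (hF : ∀ i, frobSq (A i) ≤ 1)
    (b : I → ι → ℝ) {κ : ℝ} (hκ : 0 < κ) (hκ1 : κ ≤ 1) {m : ℕ} (hm : 0 < m) (J : ℕ) :
    ∃ (d : ℕ) (E : Matrix ι (Fin d) ℝ), d ≤ Fintype.card I * (1 + m * J) ∧ Eᵀ * E = 1 ∧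
      ∀ i, (1 - E * Eᵀ) *ᵥ b i = 0 ∧ ∃ w : ℝ, 0 < w ∧ (A i * (1 - E * Eᵀ) * A i).trace ≤ w ^ 2 ∧
        (∀ l, 0 ≤ l → (gaussPi ι).real {x | (6 * √(m * κ ^ 2) + 24 * l / √(m * κ ^ 2)) * w <
          rescaleBound (A i) (1 - E * Eᵀ) x} ≤ 4 * Real.exp (-l)) ∧
        (w ≤ √m * κ ^ J ∨ (gaussPi ι).real {x | projGrad (A i) (b i) (1 - E * Eᵀ) x ⬝ᵥ
          projGrad (A i) (b i) (1 - E * Eᵀ) x ≤ 4 * κ ^ 3 * w ^ 2} ≤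
            √((Real.exp 1 * κ) ^ m)) := by
  obtain ⟨d, E, hd, hE, h⟩ := exists_subspace hA hF b hκ hκ1 m J
  refine ⟨d, E, hd, hE, fun i => ?_⟩
  obtain ⟨hb, a, O, v, ha, -, -, hO, hH, hop, hv, hor⟩ := h i
  obtain ⟨hP, hPP⟩ := proj_isSymm_idem hE
  set P := 1 - E * Eᵀ with hPd
  have hPb : P *ᵥ b i = 0 := by rw [hPd, sub_mulVec, one_mulVec, hb, sub_self]
  have hm' : (0 : ℝ) < m := Nat.cast_pos.mpr hm
  have htr : (A i * P * A i).trace = ∑ l, v l := by rw [hH, trace_diagonalized hO]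
  refine ⟨hPb, ?_⟩
  have key : (m * a ^ 2 ≤ ∑ l, v l ∨ ∑ l, v l < m * a ^ 2 ∧
      m ≤ (Finset.univ.filter fun l => (κ * a) ^ 2 ≤ v l).card) ∨
      (∑ l, v l < m * a ^ 2 ∧ a ≤ κ ^ J) := by
    rcases le_or_gt (m * a ^ 2) (∑ l, v l) with h1 | h1
    · exact Or.inl (Or.inl h1)
    · exact hor.imp (fun h2 => Or.inr ⟨h1, h2⟩) fun h2 => ⟨h1, h2⟩
  have hR : 0 < m * κ ^ 2 := by positivity
  rcases key with hflat | ⟨h1, h2⟩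
  · obtain ⟨g1, g2⟩ := flat_smallBall hO ha hκ hκ1 hv hm hflat
    have hS0 : 0 < ∑ l, v l := lt_of_lt_of_le (by positivity) g1
    have hsq : √(∑ l, v l) ^ 2 = ∑ l, v l := Real.sq_sqrt hS0.le
    refine ⟨√(∑ l, v l), Real.sqrt_pos.mpr hS0, (htr.trans hsq.symm).le, fun l hl => ?_,
      Or.inr ?_⟩
    · exact rescaleBound_tail (hA i) hP hPP ha hop (Real.sqrt_pos.mpr hS0) hR
        (htr.trans hsq.symm).le (by rw [hsq]; linarith [mul_pow κ a 2]) hl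
    · refine le_trans (measureReal_mono fun x hx => ?_) g2
      simp only [Set.mem_ofPred_eq, hsq, projGrad] at hx ⊢
      have e : (P *ᵥ ((2 : ℝ) • A i *ᵥ x + b i)) ⬝ᵥ (P *ᵥ ((2 : ℝ) • A i *ᵥ x + b i)) =
          4 * (x ⬝ᵥ (A i * P * A i) *ᵥ x) := by
        rw [mulVec_add, hPb, add_zero, mulVec_smul, smul_dotProduct, dotProduct_smul]
        have : A i * P * A i = (P * A i)ᵀ * (P * A i) := by
          rw [transpose_mul, hA, hP, ← Matrix.mul_assoc, Matrix.mul_assoc (A i) P P, hPP]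
        rw [this, ← mulVec_mulVec, dotProduct_mulVec_eq_transpose _ x, transpose_transpose,
          mulVec_mulVec]
        simp only [smul_eq_mul]
        ring
      rw [e] at hx
      rw [← hH]
      linarith
  · refine ⟨√m * κ ^ J, by positivity, ?_, fun l hl => ?_, Or.inl le_rfl⟩
    · rw [htr, mul_pow, Real.sq_sqrt hm'.le]
      exact h1.le.trans (by gcongr)
    · refine rescaleBound_tail (hA i) hP hPP ha hop (by positivity) hR ?_ ?_ hl
      · rw [htr, mul_pow, Real.sq_sqrt hm'.le]
        exact h1.le.trans (by gcongr)
      · rw [mul_pow, Real.sq_sqrt hm'.le, mul_assoc]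
        refine mul_le_mul_of_nonneg_left ?_ hm'.le
        calc κ ^ 2 * a ^ 2 ≤ 1 * a ^ 2 := by gcongr; exact pow_le_one₀ hκ.le hκ1
          _ ≤ (κ ^ J) ^ 2 := by rw [one_mul]; gcongr

end

section
variable {ι : Type*} [Fintype ι]

/-- The polynomial `qf A b c` evaluated with the range of `P` rescaled by `s`, recentred. -/
noncomputable def rescaled (A : Matrix ι ι ℝ) (b : ι → ℝ) (c : ℝ) (P : Matrix ι ι ℝ) (s : ℝ)
    (x : ι → ℝ) : ℝ :=
  qf A b c (x + (s - 1) • P *ᵥ x) - (s ^ 2 - 1) * (P * A).trace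

@[fun_prop]
theorem continuous_rescaled (A : Matrix ι ι ℝ) (b : ι → ℝ) (c : ℝ) (P : Matrix ι ι ℝ) (s : ℝ) :
    Continuous (rescaled A b c P s) := by
  unfold rescaled
  have := continuous_qf A b c
  fun_prop

theorem rescaled_sub_eq {A P : Matrix ι ι ℝ} (hA : Aᵀ = A) (hPP : P * P = P)
    (b : ι → ℝ) (c s : ℝ) (x : ι → ℝ) :
    rescaled A b c P s x - qf A b c x =
      (s - 1) * linVar A b P x + (s ^ 2 - 1) * chaos (P * A * P) x + (s ^ 2 - 1) *
        (P *ᵥ x ⬝ᵥ A *ᵥ P *ᵥ x - x ⬝ᵥ (P * A * P) *ᵥ x) := by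
  simp only [rescaled, qf_add hA, linVar, chaos, trace_proj_mul hPP, mulVec_smul, smul_dotProduct,
    dotProduct_smul, smul_eq_mul]
  ring

theorem abs_rescaled_sub_le {A P : Matrix ι ι ℝ} (hA : Aᵀ = A) (hP : Pᵀ = P) (hPP : P * P = P)
    {b : ι → ℝ} (hb : P *ᵥ b = 0) (c : ℝ) {s : ℝ} (hs : 0 ≤ s) (x : ι → ℝ) :
    |rescaled A b c P s x - qf A b c x| ≤ |s ^ 2 - 1| * rescaleBound A P x := by
  have e : P *ᵥ x ⬝ᵥ A *ᵥ P *ᵥ x = x ⬝ᵥ (P * A * P) *ᵥ x := by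
    rw [Matrix.mul_assoc, ← mulVec_mulVec, ← mulVec_mulVec, dotProduct_mulVec_eq_transpose P, hP]
  rw [rescaled_sub_eq hA hPP, e, sub_self, mul_zero, add_zero]
  have h1 : |s - 1| ≤ |s ^ 2 - 1| := by
    have : s ^ 2 - 1 = (s - 1) * (s + 1) := by ring
    rw [this, abs_mul]
    refine le_mul_of_one_le_right (abs_nonneg _) ?_
    rw [abs_of_nonneg (by linarith)]; linarith
  calc _ ≤ |s - 1| * |linVar A b P x| + |s ^ 2 - 1| * |chaos (P * A * P) x| := by
        rw [← abs_mul, ← abs_mul]; exact abs_add_le _ _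
    _ ≤ |s ^ 2 - 1| * |linVar A b P x| + |s ^ 2 - 1| * |chaos (P * A * P) x| := by gcongr
    _ = |s ^ 2 - 1| * (|chaos (P * A * P) x| + |linVar A b P x|) := by ring
    _ ≤ _ := mul_le_mul_of_nonneg_left (le_rescaleBound hA hP hPP hb x) (abs_nonneg _)

theorem le_add_pow_four_div {u q : ℝ} (hq : 0 < q) : u ≤ q + u ^ 4 / q ^ 3 := by
  rcases le_or_gt u q with h | h
  · have : 0 ≤ u ^ 4 / q ^ 3 := by positivity
    linarith
  · have : u ≤ u ^ 4 / q ^ 3 := by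
      rw [le_div_iff₀ (by positivity), pow_succ u 3, mul_comm]
      have := hq.trans h
      gcongr
    linarith

theorem linVar_smul (r : ℝ) (A : Matrix ι ι ℝ) (b : ι → ℝ) (P : Matrix ι ι ℝ) (x : ι → ℝ) :
    linVar (r • A) (r • b) P x = r * linVar A b P x := by
  simp only [linVar, smul_mulVec, smul_dotProduct, dotProduct_smul, add_dotProduct, smul_eq_mul]
  ring

theorem qf_smul (r : ℝ) (A : Matrix ι ι ℝ) (b : ι → ℝ) (c : ℝ) (x : ι → ℝ) :
    qf (r • A) (r • b) (r * c) x = r * qf A b c x := by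
  simp only [qf, smul_mulVec, smul_dotProduct, dotProduct_smul, smul_eq_mul]
  ring

theorem chaos_smul (r : ℝ) (B : Matrix ι ι ℝ) (x : ι → ℝ) :
    chaos (r • B) x = r * chaos B x := by
  simp only [chaos, smul_mulVec, dotProduct_smul, trace_smul, smul_eq_mul]
  ring

theorem projGrad_smul (r : ℝ) (A : Matrix ι ι ℝ) (b : ι → ℝ) (P : Matrix ι ι ℝ) (x : ι → ℝ) :
    projGrad (r • A) (r • b) P x = r • projGrad A b P x := by
  simp only [projGrad, smul_mulVec, mulVec_add, mulVec_smul, smul_add]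
  rw [smul_comm]

/-- A maximum of polynomials normalized by their rescaling widths is unlikely to be small. -/
theorem max_smallBall_width {I : Type*} [Fintype I] [Nonempty I] {A : I → Matrix ι ι ℝ}
    (hA : ∀ i, (A i)ᵀ = A i) {b : I → ι → ℝ} (c : I → ℝ) {P : Matrix ι ι ℝ} (hP : Pᵀ = P)
    (hPP : P * P = P) (hb : ∀ i, P *ᵥ b i = 0) {w : I → ℝ} (hw : ∀ i, 0 < w i)
    (htr : ∀ i, (A i * P * A i).trace ≤ w i ^ 2) {q : ℝ} (hq : 0 < q)
    (hI : (Fintype.card I : ℝ) ≤ q ^ 4) {y τ : ℝ} (hy : 0 < y) (hτ : 0 < τ) :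
    (gaussPi ι).real {x | (∀ i, qf (A i) (b i) (c i) x ≤ y * w i) ∧
      (∃ i, -(y * w i) ≤ qf (A i) (b i) (c i) x) ∧
      ∀ i, τ * w i ^ 2 ≤ projGrad (A i) (b i) P x ⬝ᵥ projGrad (A i) (b i) P x} ≤
      36 * 2 ^ 25 * q / τ * y := by
  have hyw : ∀ i, 0 < y * w i := fun i => mul_pos hy (hw i)
  have hI4 : ∀ i, Integrable (fun x => (rescaleBound (A i) P x / w i) ^ 4) (gaussPi ι) :=
    fun i => (rescaleBound_pow_four (hA i) hP hPP (hw i) (htr i)).1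
  set W : (ι → ℝ) → ℝ := fun x =>
    y⁻¹ * (q + (∑ i, (rescaleBound (A i) P x / w i) ^ 4) / q ^ 3) with hW
  have hWi : Integrable W (gaussPi ι) :=
    ((integrable_const q).add ((integrable_finsetSum _ fun i _ => hI4 i).div_const _)).const_mul _
  have hWint : ∫ x, W x ∂(gaussPi ι) ≤ y⁻¹ * (2 ^ 25 * q) := by
    rw [hW, integral_const_mul, integral_add (integrable_const q)
      ((integrable_finsetSum _ fun i _ => hI4 i).div_const _), integral_div,
      integral_finsetSum _ fun i _ => hI4 i]
    refine mul_le_mul_of_nonneg_left ?_ (by positivity)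
    have h1 : ∑ i, ∫ x, (rescaleBound (A i) P x / w i) ^ 4 ∂(gaussPi ι) ≤ q ^ 4 * 2 ^ 24 := by
      refine (Finset.sum_le_sum fun i _ =>
        (rescaleBound_pow_four (hA i) hP hPP (hw i) (htr i)).2).trans ?_
      rw [Finset.sum_const, nsmul_eq_mul]
      exact mul_le_mul_of_nonneg_right hI (by norm_num)
    have h2 : (∑ i, ∫ x, (rescaleBound (A i) P x / w i) ^ 4 ∂(gaussPi ι)) / q ^ 3 ≤
        q * 2 ^ 24 := by
      rw [div_le_iff₀ (by positivity)]
      exact h1.trans_eq (by ring)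
    simp only [integral_const, probReal_univ, smul_eq_mul, one_mul]
    norm_num at h2 ⊢
    linarith
  have key := max_smallBall (A := fun i => (y * w i)⁻¹ • A i)
    (fun i => by rw [transpose_smul, hA]) (fun i => (y * w i)⁻¹ • b i)
    (fun i => (y * w i)⁻¹ * c i) hP hPP hWi (fun i x => ?_) (τ / y ^ 2)
  · rw [div_mul_eq_mul_div, div_le_iff₀ (by positivity)] at key
    have hs : {x | (∀ i, qf (A i) (b i) (c i) x ≤ y * w i) ∧
        (∃ i, -(y * w i) ≤ qf (A i) (b i) (c i) x) ∧
        ∀ i, τ * w i ^ 2 ≤ projGrad (A i) (b i) P x ⬝ᵥ projGrad (A i) (b i) P x} =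
        {x | (∀ i, qf ((y * w i)⁻¹ • A i) ((y * w i)⁻¹ • b i) ((y * w i)⁻¹ * c i) x ≤ 1) ∧
          (∃ i, -1 ≤ qf ((y * w i)⁻¹ • A i) ((y * w i)⁻¹ • b i) ((y * w i)⁻¹ * c i) x) ∧
          ∀ i, τ / y ^ 2 ≤ projGrad ((y * w i)⁻¹ • A i) ((y * w i)⁻¹ • b i) P x ⬝ᵥ
            projGrad ((y * w i)⁻¹ • A i) ((y * w i)⁻¹ • b i) P x} := by
      ext x
      simp only [Set.mem_ofPred_eq, qf_smul, projGrad_smul, smul_dotProduct, dotProduct_smul,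
        smul_eq_mul]
      refine and_congr (forall_congr' fun i => ?_) (and_congr (exists_congr fun i => ?_)
        (forall_congr' fun i => ?_))
      · rw [inv_mul_le_iff₀ (hyw i), mul_one]
      · rw [le_inv_mul_iff₀ (hyw i), mul_neg_one]
      · rw [le_inv_mul_iff₀ (hyw i), le_inv_mul_iff₀ (hyw i)]
        have e : y * w i * (y * w i * (τ / y ^ 2)) = τ * w i ^ 2 := by field_simp
        rw [e]
    rw [hs]
    have k2 := key.trans (mul_le_mul_of_nonneg_right
      (mul_le_mul_of_nonneg_left hWint (by norm_num : (0 : ℝ) ≤ 36)) (sq_nonneg y))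
    have e : 36 * (y⁻¹ * (2 ^ 25 * q)) * y ^ 2 = 36 * 2 ^ 25 * q * y := by field_simp
    rw [e] at k2
    rw [div_mul_eq_mul_div, le_div_iff₀ hτ]
    linarith
  · have e1 : P * ((y * w i)⁻¹ • A i) * P = (y * w i)⁻¹ • (P * A i * P) := by
      rw [Matrix.mul_smul, Matrix.smul_mul]
    rw [e1, linVar_smul, chaos_smul, abs_mul, abs_mul, ← mul_add, abs_of_pos (inv_pos.mpr (hyw i))]
    refine (mul_le_mul_of_nonneg_left (le_rescaleBound (hA i) hP hPP (hb i) x)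
      (inv_pos.mpr (hyw i)).le).trans ?_
    have h1 := le_add_pow_four_div (u := rescaleBound (A i) P x / w i) hq
    have h2 : (rescaleBound (A i) P x / w i) ^ 4 ≤ ∑ i, (rescaleBound (A i) P x / w i) ^ 4 :=
      Finset.single_le_sum (f := fun i => (rescaleBound (A i) P x / w i) ^ 4)
        (fun i _ => by positivity) (Finset.mem_univ i)
    have e2 : (y * w i)⁻¹ * rescaleBound (A i) P x = y⁻¹ * (rescaleBound (A i) P x / w i) := by
      have := (hw i).ne'
      field_simp
    rw [e2]
    refine mul_le_mul_of_nonneg_left (h1.trans ?_) (by positivity)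
    gcongr

/-- Rescaling the range of `P` by a factor close to one barely changes the joint law. -/
theorem rescaled_comparison {I : Type*} [Fintype I] {A : I → Matrix ι ι ℝ}
    (hA : ∀ i, (A i)ᵀ = A i) {b : I → ι → ℝ} (c : I → ℝ) {P : Matrix ι ι ℝ} (hP : Pᵀ = P)
    (hPP : P * P = P) (hb : ∀ i, P *ᵥ b i = 0)
    (hvar : ∀ i, 2 * frobSq (A i) + b i ⬝ᵥ b i = 1) {w : I → ℝ} (hw : ∀ i, 0 < w i)
    (htr : ∀ i, (A i * P * A i).trace ≤ w i ^ 2) {q : ℝ} (hq : 0 < q)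
    (hI : (Fintype.card I : ℝ) ≤ q ^ 4) {X τ ω δ p₁ p₂ : ℝ} (hX : 0 < X) (hτ : 0 < τ)
    (hδ : 0 < δ) (hω : X * ω ≤ δ ^ 5) (hp₁ : 0 ≤ p₁) (hp₂ : 0 ≤ p₂)
    (h1 : ∀ i, (gaussPi ι).real {x | X * w i < rescaleBound (A i) P x} ≤ p₁)
    (h2 : ∀ i, w i ≤ ω ∨ (gaussPi ι).real {x | projGrad (A i) (b i) P x ⬝ᵥ
      projGrad (A i) (b i) P x ≤ τ * w i ^ 2} ≤ p₂)
    (hlarge : 1 ≤ 36 * 2 ^ 25 * q / τ * X) {s : ℝ} (hs : 0 ≤ s) :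
    |(gaussPi ι).real {x | ∀ i, rescaled (A i) (b i) (c i) P s x ≤ 0} -
      (gaussPi ι).real {x | ∀ i, qf (A i) (b i) (c i) x ≤ 0}| ≤
      Fintype.card I * (60 * δ + p₁ + p₂) + 36 * 2 ^ 25 * q / τ * X * |s ^ 2 - 1| := by
  classical
  set η := |s ^ 2 - 1| with hη
  have hη0 : 0 ≤ η := abs_nonneg _
  have hfirst : 0 ≤ Fintype.card I * (60 * δ + p₁ + p₂) := by positivity
  have hcl := fun i x => abs_rescaled_sub_le (hA i) hP hPP (hb i) (c i) hs x
  rcases hη0.eq_or_lt with hη1 | hη1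
  · have : ∀ i x, rescaled (A i) (b i) (c i) P s x = qf (A i) (b i) (c i) x := fun i x => by
      have := hcl i x
      rw [← hη, ← hη1, zero_mul] at this
      exact sub_eq_zero.mp (abs_nonpos_iff.mp this)
    simp only [this, sub_self, abs_zero]
    rw [← hη1]; linarith
  rcases lt_or_ge 1 η with hη2 | hη2
  · have g1 : |(gaussPi ι).real {x | ∀ i, rescaled (A i) (b i) (c i) P s x ≤ 0} -
        (gaussPi ι).real {x | ∀ i, qf (A i) (b i) (c i) x ≤ 0}| ≤ 1 :=
      abs_sub_le_of_le_of_le measureReal_nonneg measureReal_le_one measureReal_nonneg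
        measureReal_le_one |>.trans (by norm_num)
    have g2 := mul_le_mul hlarge hη2.le zero_le_one (zero_le_one.trans hlarge)
    linarith
  have hm1 : MeasurableSet {x | ∀ i, rescaled (A i) (b i) (c i) P s x ≤ 0} := by
    rw [Set.ofPred_forall]
    exact MeasurableSet.iInter fun i => measurableSet_le
      (continuous_rescaled _ _ _ _ _).measurable measurable_const
  have hm2 : MeasurableSet {x | ∀ i, qf (A i) (b i) (c i) x ≤ 0} := by
    rw [Set.ofPred_forall]
    exact MeasurableSet.iInter fun i => measurableSet_le
      (continuous_qf _ _ _).measurable measurable_const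
  refine (abs_measureReal_sub_le_measureReal_symmDiff hm1.nullMeasurableSet
    hm2.nullMeasurableSet).trans ?_
  set F : Finset I := Finset.univ.filter fun i => ω < w i with hF
  set y := η * X with hy
  have hy0 : 0 < y := mul_pos hη1 hX
  set G : Set (ι → ℝ) := {x | (∀ i : F, qf (A i) (b i) (c i) x ≤ y * w i) ∧
      (∃ i : F, -(y * w i) ≤ qf (A i) (b i) (c i) x) ∧
      ∀ i : F, τ * w i ^ 2 ≤ projGrad (A i) (b i) P x ⬝ᵥ projGrad (A i) (b i) P x} with hG
  set B1 : I → Set (ι → ℝ) := fun i => {x | |qf (A i) (b i) (c i) x| ≤ δ ^ 5} with hB1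
  set B2 : I → Set (ι → ℝ) := fun i => {x | X * w i < rescaleBound (A i) P x} with hB2
  set B3 : I → Set (ι → ℝ) := fun i => if ω < w i then {x | projGrad (A i) (b i) P x ⬝ᵥ
      projGrad (A i) (b i) P x ≤ τ * w i ^ 2} else ∅ with hB3
  have hGle : (gaussPi ι).real G ≤ 36 * 2 ^ 25 * q / τ * y := by
    rcases isEmpty_or_nonempty F with hE | hE
    · have : G = ∅ := by
        ext x; simp only [hG, Set.mem_ofPred_eq, Set.mem_empty_iff_false, iff_false]
        rintro ⟨-, ⟨i, -⟩, -⟩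
        exact hE.elim i
      rw [this, measureReal_empty]
      positivity
    · refine max_smallBall_width (I := F) (fun i => hA i) (fun i => c i) hP hPP (fun i => hb i)
        (fun i => hw i) (fun i => htr i) hq ?_ hy0 hτ
      refine le_trans ?_ hI
      rw [Fintype.card_coe]
      exact_mod_cast Finset.card_le_univ F
  have hsub : symmDiff {x | ∀ i, rescaled (A i) (b i) (c i) P s x ≤ 0}
      {x | ∀ i, qf (A i) (b i) (c i) x ≤ 0} ⊆ (⋃ i, (B1 i ∪ B2 i ∪ B3 i)) ∪ G := by
    intro x hx
    by_contra hcon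
    simp only [Set.mem_union, Set.mem_iUnion, not_or, not_exists] at hcon
    obtain ⟨hB, hnG⟩ := hcon
    have hclose : ∀ i, |rescaled (A i) (b i) (c i) P s x - qf (A i) (b i) (c i) x| ≤ y * w i :=
      fun i => by
        have h := (hB i).1.2
        simp only [hB2, Set.mem_ofPred_eq, not_lt] at h
        refine (hcl i x).trans ((mul_le_mul_of_nonneg_left h hη0).trans_eq ?_)
        rw [hy]; ring
    have hle : ∀ i, qf (A i) (b i) (c i) x ≤ y * w i := fun i => by
      have h := abs_le.mp (hclose i)
      have := mul_pos hy0 (hw i)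
      rcases hx with ⟨h', -⟩ | ⟨h', -⟩
      · have := h' i; linarith
      · have := h' i; linarith
    obtain ⟨j, hj⟩ : ∃ j, -(y * w j) ≤ qf (A j) (b j) (c j) x := by
      rcases hx with ⟨-, h'⟩ | ⟨-, h'⟩ <;>
        simp only [Set.mem_ofPred_eq, not_forall, not_le] at h' <;>
      obtain ⟨j, hj⟩ := h' <;> refine ⟨j, ?_⟩ <;> have h := abs_le.mp (hclose j) <;>
      have := mul_pos hy0 (hw j) <;> linarith
    have hjF : ω < w j := by
      by_contra! hjω
      refine (hB j).1.1 ?_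
      simp only [hB1, Set.mem_ofPred_eq]
      have h3 : y * w j ≤ δ ^ 5 := by
        refine le_trans ?_ hω
        rw [hy, mul_assoc]
        refine (mul_le_of_le_one_left (mul_pos hX (hw j)).le hη2).trans ?_
        exact mul_le_mul_of_nonneg_left hjω hX.le
      exact abs_le.mpr ⟨by linarith, (hle j).trans h3⟩
    refine hnG ⟨fun i => hle i, ⟨⟨j, Finset.mem_filter.mpr ⟨Finset.mem_univ j, hjF⟩⟩, hj⟩,
      fun i => ?_⟩
    have h := (hB i).2
    simp only [hB3, if_pos (Finset.mem_filter.mp i.2).2, Set.mem_ofPred_eq, not_le] at h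
    exact h.le
  refine (measureReal_mono hsub).trans ((measureReal_union_le _ _).trans ?_)
  have hB : (gaussPi ι).real (⋃ i, (B1 i ∪ B2 i ∪ B3 i)) ≤
      Fintype.card I * (60 * δ + p₁ + p₂) := by
    refine (measureReal_iUnion_fintype_le _).trans ?_
    rw [← nsmul_eq_mul, ← Finset.card_univ]
    refine Finset.sum_le_card_nsmul _ _ _ fun i _ => ?_
    refine (measureReal_union_le _ _).trans (add_le_add ((measureReal_union_le _ _).trans
      (add_le_add (smallBall_qf (hA i) (b i) (c i) (hvar i) hδ) (h1 i))) ?_)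
    by_cases hi : ω < w i
    · simp only [hB3, if_pos hi]
      exact (h2 i).resolve_left (not_le.mpr hi)
    · simp only [hB3, if_neg hi, measureReal_empty]
      exact hp₂
  have e : 36 * 2 ^ 25 * q / τ * X * η = 36 * 2 ^ 25 * q / τ * y := by rw [hy]; ring
  rw [e]
  exact add_le_add hB hGle

end

section

/-- The sign `±1` of a Boolean. -/
def boolSign (s : Bool) : ℝ := if s then -1 else 1

theorem sum_exp_signs {L : Type*} [Fintype L] [DecidableEq L] (v : L → ℝ) :
    ∑ s : L → Bool, Real.exp (∑ l, boolSign (s l) * v l) = ∏ l, (2 * Real.cosh (v l)) := by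
  simp only [Real.exp_sum]
  rw [← Fintype.piFinset_univ, ← Finset.prod_univ_sum (fun _ => Finset.univ)
    fun l s => Real.exp (boolSign s * v l)]
  refine Finset.prod_congr rfl fun l _ => ?_
  simp [boolSign, Real.cosh_eq, add_comm]
  ring

theorem sum_exp_abs_signs_le {L : Type*} [Fintype L] [DecidableEq L] {v : L → ℝ}
    (hv : ∀ l, |v l| ≤ 1) (t : ℝ) :
    ∑ s : L → Bool, Real.exp (t * |∑ l, boolSign (s l) * v l|) ≤
      2 ^ Fintype.card L * (2 * Real.exp (Fintype.card L * (t ^ 2 / 2))) := by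
  have key : ∀ u : ℝ, u ^ 2 = t ^ 2 → ∑ s : L → Bool, Real.exp (u * ∑ l, boolSign (s l) * v l) ≤
      2 ^ Fintype.card L * Real.exp (Fintype.card L * (t ^ 2 / 2)) := fun u hu => by
    have e : ∀ s : L → Bool, u * ∑ l, boolSign (s l) * v l = ∑ l, boolSign (s l) * (u * v l) :=
      fun s => by rw [Finset.mul_sum]; exact Finset.sum_congr rfl fun l _ => by ring
    simp only [e]
    rw [sum_exp_signs (fun l => u * v l), Finset.prod_mul_distrib, Finset.prod_const,
      Finset.card_univ]
    refine mul_le_mul_of_nonneg_left ?_ (by positivity)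
    rw [← nsmul_eq_mul, Real.exp_nsmul, ← Finset.card_univ, ← Finset.prod_const]
    refine Finset.prod_le_prod (fun l _ => (Real.cosh_pos _).le) fun l _ => ?_
    refine (Real.cosh_le_exp_half_sq _).trans (Real.exp_le_exp.mpr ?_)
    have : v l ^ 2 ≤ 1 := by rw [← sq_abs]; exact pow_le_one₀ (abs_nonneg _) (hv l)
    rw [mul_pow, hu]
    have := mul_le_mul_of_nonneg_left this (sq_nonneg t)
    linarith
  have h1 := key t rfl
  have h2 := key (-t) (by ring)
  calc _ ≤ ∑ s : L → Bool, (Real.exp (t * ∑ l, boolSign (s l) * v l) +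
        Real.exp (-t * ∑ l, boolSign (s l) * v l)) := Finset.sum_le_sum fun s _ => by
        rcases abs_choice (∑ l, boolSign (s l) * v l) with h | h <;> rw [h]
        · linarith [Real.exp_pos (-t * ∑ l, boolSign (s l) * v l)]
        · rw [mul_neg, ← neg_mul]
          linarith [Real.exp_pos (t * ∑ l, boolSign (s l) * v l)]
    _ ≤ _ := by rw [Finset.sum_add_distrib]; linarith

/-- Massart's finite class lemma. -/
theorem massart {L : Type*} [Fintype L] [Nonempty L] [DecidableEq L] {V : Finset (L → ℝ)}
    (hV : ∀ v ∈ V, ∀ l, |v l| ≤ 1) {N : ℝ} (hN : 1 ≤ N) (hVN : (V.card : ℝ) ≤ N)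
    {M : (L → Bool) → ℝ}
    (hM : ∀ s, ∃ v ∈ V, M s ≤ |∑ l, boolSign (s l) * v l|) :
    ∑ s, M s ≤ 2 ^ Fintype.card L * √(2 * Fintype.card L * Real.log (2 * N)) := by
  set n : ℝ := (Fintype.card L : ℝ) with hn
  have hn0 : 0 < n := Nat.cast_pos.mpr Fintype.card_pos
  have hlog : 0 < Real.log (2 * N) := Real.log_pos (by linarith)
  set D := √(2 * n * Real.log (2 * N)) with hD
  have hD0 : 0 < D := Real.sqrt_pos.mpr (by positivity)
  have hD2 : D ^ 2 = 2 * n * Real.log (2 * N) := Real.sq_sqrt (by positivity)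
  set t := D / n with ht
  have ht0 : 0 < t := by positivity
  set B := Real.log (2 * N) + n * (t ^ 2 / 2) with hB
  have hexpB : Real.exp B = N * (2 * Real.exp (n * (t ^ 2 / 2))) := by
    rw [hB, Real.exp_add, Real.exp_log (by linarith)]; ring
  have htD : t * D = B := by
    rw [hB, ht, div_pow, hD2]
    have : D / n * D = D ^ 2 / n := by ring
    rw [this, hD2]
    field_simp
    ring
  have h1 : ∑ s, Real.exp (t * M s) ≤ 2 ^ Fintype.card L * Real.exp B := by
    calc ∑ s, Real.exp (t * M s) ≤
        ∑ s : L → Bool, ∑ v ∈ V, Real.exp (t * |∑ l, boolSign (s l) * v l|) :=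
          Finset.sum_le_sum fun s _ => by
            obtain ⟨v, hv, h⟩ := hM s
            refine (Real.exp_le_exp.mpr (mul_le_mul_of_nonneg_left h ht0.le)).trans ?_
            exact Finset.single_le_sum
              (f := fun v : L → ℝ => Real.exp (t * |∑ l, boolSign (s l) * v l|))
              (fun v _ => (Real.exp_pos _).le) hv
      _ = ∑ v ∈ V, ∑ s : L → Bool, Real.exp (t * |∑ l, boolSign (s l) * v l|) :=
          Finset.sum_comm
      _ ≤ ∑ v ∈ V, 2 ^ Fintype.card L * (2 * Real.exp (n * (t ^ 2 / 2))) :=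
          Finset.sum_le_sum fun v hv => sum_exp_abs_signs_le (hV v hv) t
      _ ≤ 2 ^ Fintype.card L * Real.exp B := by
          rw [Finset.sum_const, nsmul_eq_mul, hexpB, mul_left_comm]
          gcongr
  have h2 : ∀ s, t * M s ≤ B - 1 + Real.exp (-B) * Real.exp (t * M s) := fun s => by
    rw [← Real.exp_add]
    linarith [Real.add_one_le_exp (-B + t * M s)]
  have h3 := Finset.sum_le_sum fun s (_ : s ∈ Finset.univ) => h2 s
  rw [← Finset.mul_sum, Finset.sum_add_distrib, ← Finset.mul_sum, Finset.sum_const,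
    Finset.card_univ, Fintype.card_fun, Fintype.card_bool, nsmul_eq_mul] at h3
  have h4 := mul_le_mul_of_nonneg_left h1 (Real.exp_pos (-B)).le
  have h5 : Real.exp (-B) * (2 ^ Fintype.card L * Real.exp B) = 2 ^ Fintype.card L := by
    rw [mul_left_comm, ← Real.exp_add, neg_add_cancel, Real.exp_zero, mul_one]
  rw [h5] at h4
  rw [← mul_le_mul_iff_right₀ ht0, mul_left_comm, htD]
  push_cast at h3
  linarith

/-- Sauer's lemma for orthants. -/
theorem card_orthant_traces_le {V : Type*} [Fintype V] [DecidableEq V] {k : ℕ}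
    (f : V → Fin k → ℝ) (Θ : Finset (Fin k → ℝ)) :
    (Θ.image fun θ => Finset.univ.filter fun v => ∀ i, f v i ≤ θ i).card ≤
      ∑ j ∈ Finset.Iic k, (Fintype.card V).choose j := by
  set 𝒜 := Θ.image fun θ => Finset.univ.filter fun v => ∀ i, f v i ≤ θ i with h𝒜
  have hd : 𝒜.vcDim ≤ k := by
    refine Finset.sup_le fun s hs => ?_
    rw [Finset.mem_shatterer] at hs
    by_contra! hk
    have hne : s.Nonempty := Finset.card_pos.mp (by lia)
    choose a ha hmax using fun i : Fin k => s.exists_max_image (fun v => f v i) hne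
    obtain ⟨u, hu, hsu⟩ := hs (t := Finset.univ.image a) (fun v hv => by
      obtain ⟨i, -, rfl⟩ := Finset.mem_image.mp hv
      exact ha i)
    obtain ⟨θ, -, rfl⟩ := Finset.mem_image.mp hu
    have hs_sub : s ⊆ Finset.univ.image a := by
      rw [← hsu]
      refine fun v hv => Finset.mem_inter.mpr ⟨hv, ?_⟩
      simp only [Finset.mem_filter, Finset.mem_univ, true_and]
      intro i
      have : a i ∈ s ∩ Finset.univ.filter fun v => ∀ i, f v i ≤ θ i := by
        rw [hsu]; exact Finset.mem_image_of_mem a (Finset.mem_univ i)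
      simp only [Finset.mem_inter, Finset.mem_filter, Finset.mem_univ, true_and] at this
      exact (hmax i v hv).trans (this.2 i)
    have := (Finset.card_le_card hs_sub).trans Finset.card_image_le
    rw [Finset.card_univ, Fintype.card_fin] at this
    lia
  refine 𝒜.card_le_card_shatterer.trans (Finset.card_shatterer_le_sum_vcDim.trans ?_)
  exact Finset.sum_le_sum_of_subset (Finset.Iic_subset_Iic.mpr hd)

theorem sum_choose_le {k N : ℕ} (hk : 0 < k) (hkN : k ≤ N) :
    ((∑ j ∈ Finset.Iic k, N.choose j : ℕ) : ℝ) ≤ (Real.exp 1 * N / k) ^ k := by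
  have hk' : (0 : ℝ) < k := Nat.cast_pos.mpr hk
  have hN' : (0 : ℝ) < N := Nat.cast_pos.mpr (hk.trans_le hkN)
  have hkN' : (k : ℝ) / N ≤ 1 := (div_le_one hN').mpr (Nat.cast_le.mpr hkN)
  have hx0 : (0 : ℝ) < k / N := by positivity
  have h1 : ((∑ j ∈ Finset.Iic k, N.choose j : ℕ) : ℝ) * (k / N : ℝ) ^ k ≤
      (1 + k / N : ℝ) ^ N := by
    push_cast
    rw [Finset.sum_mul, add_comm, add_pow]
    calc ∑ j ∈ Finset.Iic k, (N.choose j : ℝ) * (k / N : ℝ) ^ k ≤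
        ∑ j ∈ Finset.Iic k, (k / N : ℝ) ^ j * 1 ^ (N - j) * N.choose j :=
          Finset.sum_le_sum fun j hj => by
            rw [one_pow, mul_one, mul_comm]
            exact mul_le_mul_of_nonneg_right (pow_le_pow_of_le_one hx0.le hkN'
              (Finset.mem_Iic.mp hj)) (Nat.cast_nonneg _)
      _ ≤ _ := Finset.sum_le_sum_of_subset_of_nonneg (fun j hj => by
            simp only [Finset.mem_Iic, Finset.mem_range] at hj ⊢; lia)
            fun j _ _ => by positivity
  have h2 : (1 + k / N : ℝ) ^ N ≤ Real.exp 1 ^ k := by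
    rw [Real.exp_one_pow]
    calc (1 + k / N : ℝ) ^ N ≤ Real.exp (k / N) ^ N := by
          gcongr; linarith [Real.add_one_le_exp (k / N : ℝ)]
      _ = Real.exp k := by rw [← Real.exp_nat_mul]; congr 1; field_simp
  have h3 : (Real.exp 1 * N / k) ^ k = Real.exp 1 ^ k / (k / N : ℝ) ^ k := by
    rw [← div_pow]; congr 1; field_simp
  rw [h3, le_div_iff₀ (by positivity)]
  exact h1.trans h2

end

section
variable {Z : Type*} {L : Type*} [Fintype L] {I : Type*} [Fintype I]

open Classical in
/-- The fraction of the sample points in `S`. -/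
noncomputable def empirical (S : Set Z) (z : L → Z) : ℝ :=
  (∑ l, if z l ∈ S then 1 else 0) / Fintype.card L

theorem measurable_empirical [MeasurableSpace Z] {S : Set Z} (hS : MeasurableSet S) :
    Measurable (empirical S : (L → Z) → ℝ) := by
  classical
  unfold empirical
  refine Measurable.div_const (Finset.measurable_sum _ fun l _ => ?_) _
  exact Measurable.ite (measurable_pi_apply l hS) measurable_const measurable_const

theorem empirical_mem_Icc [Nonempty L] (S : Set Z) (z : L → Z) :
    0 ≤ empirical S z ∧ empirical S z ≤ 1 := by
  classical
  have hn : (0 : ℝ) < Fintype.card L := Nat.cast_pos.mpr Fintype.card_pos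
  unfold empirical
  refine ⟨div_nonneg (Finset.sum_nonneg fun l _ => by split_ifs <;> norm_num) hn.le, ?_⟩
  rw [div_le_one hn]
  refine (Finset.sum_le_card_nsmul _ _ 1 fun l _ => by split_ifs <;> norm_num).trans ?_
  simp

theorem integral_empirical [Nonempty L] [MeasurableSpace Z] (μ : Measure Z)
    [IsProbabilityMeasure μ] {S : Set Z} (hS : MeasurableSet S) :
    ∫ z, empirical S z ∂(Measure.pi fun _ : L => μ) = μ.real S := by
  classical
  have hn : (Fintype.card L : ℝ) ≠ 0 := Nat.cast_ne_zero.mpr Fintype.card_ne_zero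
  have hm : Measurable fun z : Z => if z ∈ S then (1 : ℝ) else 0 :=
    Measurable.ite hS measurable_const measurable_const
  have h1 : ∫ z, (if z ∈ S then (1 : ℝ) else 0) ∂μ = μ.real S := by
    have : (fun z => if z ∈ S then (1 : ℝ) else 0) = S.indicator 1 := by
      ext z; simp [Set.indicator]
    rw [this, integral_indicator_one hS]
  unfold empirical
  rw [integral_div, integral_finsetSum]
  · have : ∀ l : L, ∫ z : L → Z, (if z l ∈ S then (1 : ℝ) else 0) ∂(Measure.pi fun _ : L => μ) =
        μ.real S := fun l => by
      rw [← h1]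
      exact (measurePreserving_eval (fun _ : L => μ) l).integral_comp_of_aestronglyMeasurable
        (g := fun z => if z ∈ S then (1 : ℝ) else 0) hm.aestronglyMeasurable
    simp only [this, Finset.sum_const, Finset.card_univ, nsmul_eq_mul]
    field_simp
  · intro l _
    refine Integrable.of_bound (C := 1)
      (hm.comp (measurable_pi_apply l)).aestronglyMeasurable
        (Filter.Eventually.of_forall fun z => ?_)
    split_ifs <;> simp

theorem measurable_sup'_univ {X : Type*} [MeasurableSpace X] [Nonempty I] {f : I → X → ℝ}
    (hf : ∀ i, Measurable (f i)) :
    Measurable fun x => Finset.univ.sup' Finset.univ_nonempty fun i => f i x := by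
  have h := Finset.measurable_sup' (s := (Finset.univ : Finset I)) Finset.univ_nonempty
    (f := f) fun i _ => hf i
  convert h using 1
  ext x
  rw [Finset.sup'_apply]

theorem abs_sup'_univ_le [Nonempty I] {f : I → ℝ} {C : ℝ} (hf : ∀ i, |f i| ≤ C) :
    |Finset.univ.sup' Finset.univ_nonempty f| ≤ C := by
  obtain ⟨i, -, h⟩ := Finset.exists_mem_eq_sup' (Finset.univ_nonempty (α := I)) f
  rw [h]; exact hf i

open Classical in
theorem empirical_sub_empirical (S : Set Z) (z z' : L → Z) :
    empirical S z - empirical S z' =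
      (∑ l, ((if z l ∈ S then (1 : ℝ) else 0) - if z' l ∈ S then 1 else 0)) / Fintype.card L := by
  unfold empirical
  rw [← sub_div, ← Finset.sum_sub_distrib]

variable [MeasurableSpace Z] (μ : Measure Z) [IsProbabilityMeasure μ]

theorem empirical_symmetrization [Nonempty L] [Nonempty I] {S : I → Set Z}
    (hS : ∀ i, MeasurableSet (S i)) :
    ∫ z, (Finset.univ.sup' Finset.univ_nonempty fun i => |empirical (S i) z - μ.real (S i)|)
      ∂(Measure.pi fun _ : L => μ) ≤
    ∫ w, (Finset.univ.sup' Finset.univ_nonempty fun i =>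
      |empirical (S i) (fun l => (w l).1) - empirical (S i) (fun l => (w l).2)|)
      ∂(Measure.pi fun _ : L => μ.prod μ) := by
  have hme : ∀ i, Measurable (empirical (S i) : (L → Z) → ℝ) := fun i => measurable_empirical (hS i)
  have hb : ∀ i (z z' : L → Z), |empirical (S i) z - empirical (S i) z'| ≤ 1 := fun i z z' =>
    (abs_sub_le_of_le_of_le (empirical_mem_Icc (S i) z).1 (empirical_mem_Icc (S i) z).2
      (empirical_mem_Icc (S i) z').1 (empirical_mem_Icc (S i) z').2).trans (by norm_num)
  set g : (L → Z) × (L → Z) → ℝ := fun p => Finset.univ.sup' Finset.univ_nonempty fun i =>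
    |empirical (S i) p.1 - empirical (S i) p.2| with hg
  have hgm : Measurable g := measurable_sup'_univ fun i =>
    (((hme i).comp measurable_fst).sub ((hme i).comp measurable_snd)).abs
  have hgb : ∀ p, |g p| ≤ 1 := fun p => abs_sup'_univ_le fun i => by
    rw [abs_abs]; exact hb i _ _
  have hgi : Integrable g ((Measure.pi fun _ : L => μ).prod (Measure.pi fun _ : L => μ)) :=
    Integrable.of_bound hgm.aestronglyMeasurable 1 (Filter.Eventually.of_forall hgb)
  have h1 : ∫ w, (Finset.univ.sup' Finset.univ_nonempty fun i =>
      |empirical (S i) (fun l => (w l).1) - empirical (S i) (fun l => (w l).2)|)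
      ∂(Measure.pi fun _ : L => μ.prod μ) =
      ∫ p, g p ∂((Measure.pi fun _ : L => μ).prod (Measure.pi fun _ : L => μ)) :=
    (measurePreserving_arrowProdEquivProdArrow Z Z L (fun _ => μ)
      (fun _ => μ)).integral_comp_of_aestronglyMeasurable (g := g) hgm.aestronglyMeasurable
  rw [h1, integral_prod _ hgi]
  refine integral_mono_of_nonneg (Filter.Eventually.of_forall fun z => ?_)
    hgi.integral_prod_left (Filter.Eventually.of_forall fun z => ?_)
  · obtain ⟨i⟩ := ‹Nonempty I›
    exact (abs_nonneg _).trans (Finset.le_sup' (fun i => |empirical (S i) z - μ.real (S i)|)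
      (Finset.mem_univ i))
  · refine Finset.sup'_le _ _ fun i _ => ?_
    have hi : Integrable (empirical (S i)) (Measure.pi fun _ : L => μ) :=
      Integrable.of_bound (hme i).aestronglyMeasurable 1 (Filter.Eventually.of_forall fun z => by
        rw [Real.norm_eq_abs, abs_of_nonneg (empirical_mem_Icc _ z).1]
        exact (empirical_mem_Icc _ z).2)
    have e : empirical (S i) z - μ.real (S i) =
        ∫ z', (empirical (S i) z - empirical (S i) z') ∂(Measure.pi fun _ : L => μ) := by
      rw [integral_sub (integrable_const _) hi, integral_empirical μ (hS i)]
      simp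
    simp only [e]
    refine abs_integral_le_integral_abs.trans ?_
    refine integral_mono ((integrable_const _).sub hi).abs ?_ fun z' => ?_
    · exact Integrable.of_bound (hgm.comp measurable_prodMk_left).aestronglyMeasurable 1
        (Filter.Eventually.of_forall fun z' => hgb _)
    · exact Finset.le_sup' (fun i => |empirical (S i) z - empirical (S i) z'|) (Finset.mem_univ i)

open Classical in
/-- A uniform law of large numbers for classes of sets with few traces on finite samples. -/
theorem integral_sup_empirical_le [Nonempty L] [Nonempty I] {S : I → Set Z}
    (hS : ∀ i, MeasurableSet (S i)) {N : ℝ} (hN : 1 ≤ N)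
    (htr : ∀ w : L ⊕ L → Z,
      ((Finset.univ.image fun i => Finset.univ.filter fun v => w v ∈ S i).card : ℝ) ≤ N) :
    ∫ z, (Finset.univ.sup' Finset.univ_nonempty fun i => |empirical (S i) z - μ.real (S i)|)
      ∂(Measure.pi fun _ : L => μ) ≤ √(2 * Real.log (2 * N) / Fintype.card L) := by
  refine (empirical_symmetrization μ hS).trans ?_
  set n : ℝ := (Fintype.card L : ℝ) with hn
  have hn0 : 0 < n := Nat.cast_pos.mpr Fintype.card_pos
  have hme : ∀ i, Measurable (empirical (S i) : (L → Z) → ℝ) := fun i => measurable_empirical (hS i)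
  set g : (L → Z × Z) → ℝ := fun w => Finset.univ.sup' Finset.univ_nonempty fun i =>
    |empirical (S i) (fun l => (w l).1) - empirical (S i) (fun l => (w l).2)| with hg
  have hgm : Measurable g := measurable_sup'_univ fun i =>
    (((hme i).comp (measurable_pi_lambda _ fun l =>
      measurable_fst.comp (measurable_pi_apply l))).sub
      ((hme i).comp (measurable_pi_lambda _ fun l =>
        measurable_snd.comp (measurable_pi_apply l)))).abs
  have hgb : ∀ w, |g w| ≤ 1 := fun p => abs_sup'_univ_le fun i => by
    rw [abs_abs]
    exact (abs_sub_le_of_le_of_le (empirical_mem_Icc (S i) _).1 (empirical_mem_Icc (S i) _).2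
      (empirical_mem_Icc (S i) _).1 (empirical_mem_Icc (S i) _).2).trans (by norm_num)
  have hgi : Integrable g (Measure.pi fun _ : L => μ.prod μ) :=
    Integrable.of_bound hgm.aestronglyMeasurable 1 (Filter.Eventually.of_forall hgb)
  let T : (L → Bool) → (L → Z × Z) → L → Z × Z := fun s w l => if s l then (w l).swap else w l
  have hT : ∀ s, MeasurePreserving (T s) (Measure.pi fun _ : L => μ.prod μ)
      (Measure.pi fun _ : L => μ.prod μ) := fun s => by
    refine measurePreserving_pi (fun _ : L => μ.prod μ) (fun _ : L => μ.prod μ)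
      (f := fun l p => if s l then p.swap else p) fun l => ?_
    cases h : s l
    · simp only [Bool.false_eq_true, if_false]
      exact MeasurePreserving.id (μ.prod μ)
    · simpa [h] using Measure.measurePreserving_swap (μ := μ) (ν := μ)
  have hInt : ∀ s, ∫ w, g (T s w) ∂(Measure.pi fun _ : L => μ.prod μ) =
      ∫ w, g w ∂(Measure.pi fun _ : L => μ.prod μ) := fun s =>
    (hT s).integral_comp_of_aestronglyMeasurable (g := g) hgm.aestronglyMeasurable
  have hpt : ∀ w, ∑ s, g (T s w) ≤
      2 ^ Fintype.card L * √(2 * Real.log (2 * N) / n) := fun w => by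
    let W : L ⊕ L → Z := Sum.elim (fun l => (w l).1) fun l => (w l).2
    let V : Finset (L → ℝ) := (Finset.univ.image fun i =>
      Finset.univ.filter fun v => W v ∈ S i).image
      fun p l => (if Sum.inl l ∈ p then (1 : ℝ) else 0) - if Sum.inr l ∈ p then 1 else 0
    have hV : ∀ v ∈ V, ∀ l, |v l| ≤ 1 := fun v hv l => by
      obtain ⟨p, -, rfl⟩ := Finset.mem_image.mp hv
      dsimp only
      split_ifs <;> norm_num
    have key := massart (L := L) hV hN ((Nat.cast_le.mpr Finset.card_image_le).trans (htr W))
      (M := fun s => n * g (T s w)) fun s => ?_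
    · rw [← Finset.mul_sum] at key
      have e : √(2 * n * Real.log (2 * N)) = n * √(2 * Real.log (2 * N) / n) := by
        have : 2 * n * Real.log (2 * N) = n ^ 2 * (2 * Real.log (2 * N) / n) := by field_simp
        rw [this, Real.sqrt_mul (sq_nonneg n), Real.sqrt_sq hn0.le]
      rw [← hn, e, mul_left_comm] at key
      exact le_of_mul_le_mul_left key hn0
    · obtain ⟨i, -, hi⟩ := Finset.exists_mem_eq_sup' (Finset.univ_nonempty (α := I)) fun i =>
        |empirical (S i) (fun l => (T s w l).1) - empirical (S i) (fun l => (T s w l).2)|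
      refine ⟨fun l => (if (w l).1 ∈ S i then (1 : ℝ) else 0) - if (w l).2 ∈ S i then 1 else 0,
        Finset.mem_image.mpr ⟨_, Finset.mem_image_of_mem _ (Finset.mem_univ i), ?_⟩, ?_⟩
      · ext l; simp [W]
      · simp only [hg]
        rw [hi, empirical_sub_empirical, abs_div, abs_of_pos hn0, mul_div_cancel₀ _ hn0.ne']
        refine le_of_eq (congrArg abs (Finset.sum_congr rfl fun l _ => ?_))
        simp only [T, boolSign]
        rcases Bool.eq_false_or_eq_true (s l) with h | h <;> simp [h]
  have h2 : 2 ^ Fintype.card L * ∫ w, g w ∂(Measure.pi fun _ : L => μ.prod μ) ≤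
      2 ^ Fintype.card L * √(2 * Real.log (2 * N) / n) := by
    have e : 2 ^ Fintype.card L * ∫ w, g w ∂(Measure.pi fun _ : L => μ.prod μ) =
        ∫ w, ∑ s, g (T s w) ∂(Measure.pi fun _ : L => μ.prod μ) := by
      rw [integral_finsetSum]
      · simp [hInt]
      · exact fun s _ => (hT s).integrable_comp_of_integrable hgi
    rw [e]
    refine (integral_mono (integrable_finsetSum _ fun s _ =>
      (hT s).integrable_comp_of_integrable hgi) (integrable_const _) hpt).trans_eq ?_
    simp
  exact le_of_mul_le_mul_left h2 (by positivity)

end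

section
variable {Z : Type*} [MeasurableSpace Z] (μ : Measure Z) [IsProbabilityMeasure μ]

/-- Uniform convergence of empirical distribution functions of random vectors, with the optimal
dimension dependence. -/
theorem integral_sup_orthant_le {L I : Type*} [Fintype L] [Nonempty L] [Fintype I] [Nonempty I]
    {k : ℕ} (hk : 0 < k) (hkL : k ≤ Fintype.card L) {φ : Z → Fin k → ℝ} (hφ : Measurable φ)
    (θ : I → Fin k → ℝ) :
    ∫ z, (Finset.univ.sup' Finset.univ_nonempty fun i =>
      |empirical {z | ∀ j, φ z j ≤ θ i j} z - μ.real {z | ∀ j, φ z j ≤ θ i j}|)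
      ∂(Measure.pi fun _ : L => μ) ≤
    √(2 * (k * Real.log (2 * Real.exp 1 * Fintype.card L / k) + Real.log 2) /
      Fintype.card L) := by
  classical
  have hk' : (0 : ℝ) < k := Nat.cast_pos.mpr hk
  have hn : (k : ℝ) ≤ Fintype.card L := Nat.cast_le.mpr hkL
  have hbase : 1 ≤ 2 * Real.exp 1 * Fintype.card L / k := by
    rw [one_le_div hk']
    have := Real.add_one_le_exp (1 : ℝ)
    have h3 : 1 * (k : ℝ) ≤ (2 * Real.exp 1) * Fintype.card L :=
      mul_le_mul (by linarith) hn hk'.le (by linarith)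
    linarith
  have h := integral_sup_empirical_le μ (L := L) (S := fun i => {z | ∀ j, φ z j ≤ θ i j})
    (N := (2 * Real.exp 1 * Fintype.card L / k) ^ k) (fun i => ?_) (one_le_pow₀ hbase) fun w => ?_
  · refine h.trans (le_of_eq ?_)
    rw [Real.log_mul two_ne_zero (by positivity), Real.log_pow]
    congr 3
    ring
  · rw [Set.ofPred_forall]
    exact MeasurableSet.iInter fun j => measurableSet_le
      ((measurable_pi_apply j).comp hφ) measurable_const
  · have h1 := card_orthant_traces_le (fun v => φ (w v)) (Finset.univ.image θ)
    rw [Finset.image_image] at h1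
    have h2 := sum_choose_le (N := Fintype.card (L ⊕ L)) hk (by rw [Fintype.card_sum]; lia)
    rw [Fintype.card_sum] at h1 h2
    refine (Nat.cast_le.mpr (le_trans (le_of_eq ?_) h1)).trans (h2.trans (le_of_eq ?_))
    · congr 2
      ext i v
      simp
    · push_cast
      congr 2
      ring

end

section
variable {L ι : Type*} [Fintype L] [Fintype ι]

theorem measurePreserving_curry_gaussPi (L ι : Type*) [Fintype L] [Fintype ι] :
    MeasurePreserving (MeasurableEquiv.curry L ι ℝ) (gaussPi (L × ι))
      (Measure.pi fun _ : L => gaussPi ι) := by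
  refine ⟨(MeasurableEquiv.curry L ι ℝ).measurable, ?_⟩
  have h := Measure.infinitePi_map_curry (fun (_ : L) (_ : ι) => gaussianReal 0 1)
  simp_rw [Measure.infinitePi_eq_pi] at h
  exact h

theorem measurePreserving_rotate (O : Matrix L L ℝ) [DecidableEq L] (hO : O * Oᵀ = 1) :
    MeasurePreserving (fun (G : L → ι → ℝ) l => ∑ m, O l m • G m)
      (Measure.pi fun _ : L => gaussPi ι) (Measure.pi fun _ : L => gaussPi ι) := by
  classical
  have h1 : (kroneckerMap (· * ·) O (1 : Matrix ι ι ℝ)) *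
      (kroneckerMap (· * ·) O (1 : Matrix ι ι ℝ))ᵀ = 1 := by
    rw [← kroneckerMap_transpose, ← mul_kronecker_mul, hO, transpose_one, one_mul,
      one_kronecker_one]
  have h2 := (measurePreserving_curry_gaussPi L ι).comp
    ((measurePreserving_mulVec_gaussPi _ h1).comp
      ((measurePreserving_curry_gaussPi L ι).symm))
  convert h2 using 1
  ext G l a
  simp [mulVec, dotProduct, Fintype.sum_prod_type, one_apply, MeasurableEquiv.curry]

theorem exists_reflection [DecidableEq L] (y : L → ℝ) (l : L) :
    ∃ O : Matrix L L ℝ, Oᵀ = O ∧ O * O = 1 ∧ O *ᵥ y = √(y ⬝ᵥ y) • Pi.single l 1 := by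
  have hs : √(y ⬝ᵥ y) * √(y ⬝ᵥ y) = y ⬝ᵥ y := Real.mul_self_sqrt (dotProduct_self_nonneg' y)
  set z : L → ℝ := y - √(y ⬝ᵥ y) • Pi.single l 1 with hz
  by_cases h0 : z = 0
  · exact ⟨1, transpose_one, one_mul 1, by rw [one_mulVec]; exact sub_eq_zero.mp h0⟩
  have hzz : z ⬝ᵥ z ≠ 0 := fun h => h0 (dotProduct_self_eq_zero.mp h)
  have hzy : 2 * (z ⬝ᵥ y) = z ⬝ᵥ z := by
    simp only [hz, sub_dotProduct, dotProduct_sub, smul_dotProduct, dotProduct_smul,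
      single_dotProduct, dotProduct_single, smul_eq_mul]
    simp only [Pi.sub_apply, Pi.smul_apply, Pi.single_eq_same, smul_eq_mul]
    linear_combination -hs
  refine ⟨1 - (2 / (z ⬝ᵥ z)) • vecMulVec z z, ?_, ?_, ?_⟩
  · rw [transpose_sub, transpose_smul, transpose_vecMulVec, transpose_one]
  · have h2 : ((2 / (z ⬝ᵥ z)) • vecMulVec z z) * ((2 / (z ⬝ᵥ z)) • vecMulVec z z) =
        (2 : ℝ) • ((2 / (z ⬝ᵥ z)) • vecMulVec z z) := by
      rw [smul_mul_smul_comm, vecMulVec_mul_vecMulVec, smul_smul, vecMulVec_smul, smul_smul]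
      congr 1
      field_simp
    rw [sub_mul, one_mul, mul_sub, mul_one, h2, two_smul]
    abel
  · have h2 : 2 / (z ⬝ᵥ z) * (z ⬝ᵥ y) = 1 := by
      rw [div_mul_eq_mul_div, hzy, div_self hzz]
    rw [sub_mulVec, one_mulVec, smul_mulVec, vecMulVec_mulVec, op_smul_eq_smul, smul_smul, h2,
      one_smul, hz]
    abel
end

section
variable {I : Type*} [Fintype I] [LinearOrder I]

/-- The signed indicator of the first coordinate of maximal absolute value. -/
noncomputable def argmaxSign (i : I) (a : I → ℝ) : ℝ :=
  open Classical in
  if (∀ j, |a j| ≤ |a i|) ∧ ∀ j < i, |a j| < |a i| then (if 0 ≤ a i then 1 else -1) else 0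

theorem measurable_argmaxSign (i : I) : Measurable (argmaxSign i) := by
  classical
  unfold argmaxSign
  refine Measurable.ite ?_ ?_ measurable_const
  · measurability
  · exact Measurable.ite (measurableSet_le measurable_const (measurable_pi_apply i))
      measurable_const measurable_const

theorem abs_argmaxSign_le (i : I) (a : I → ℝ) : |argmaxSign i a| ≤ 1 := by
  unfold argmaxSign
  split_ifs <;> simp

variable [Nonempty I]

theorem exists_argmaxSign_eq (a : I → ℝ) :
    ∃ i₀ e, |e| = 1 ∧ e * a i₀ = |a i₀| ∧ (∀ j, |a j| ≤ |a i₀|) ∧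
      ∀ i, argmaxSign i a = if i = i₀ then e else 0 := by
  classical
  have hne : (Finset.univ.filter fun i => ∀ j, |a j| ≤ |a i|).Nonempty := by
    obtain ⟨i, hi⟩ := Finite.exists_max fun i => |a i|
    exact ⟨i, by simpa using hi⟩
  set i₀ := Finset.min' _ hne
  have hm : ∀ j, |a j| ≤ |a i₀| := (Finset.mem_filter.mp (Finset.min'_mem _ hne)).2
  have hlt : ∀ j < i₀, |a j| < |a i₀| := fun j hj => by
    by_contra! h
    exact absurd (Finset.min'_le _ j (Finset.mem_filter.mpr
      ⟨Finset.mem_univ j, fun l => (hm l).trans h⟩)) (not_le.mpr hj)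
  refine ⟨i₀, if 0 ≤ a i₀ then 1 else -1, ?_, ?_, hm, fun i => ?_⟩
  · split_ifs <;> simp
  · split_ifs with h
    · rw [one_mul, abs_of_nonneg h]
    · rw [neg_one_mul, abs_of_neg (not_le.mp h)]
  · unfold argmaxSign
    by_cases hi : i = i₀
    · subst hi
      rw [if_pos ⟨hm, hlt⟩, if_pos rfl]
    · rw [if_neg hi, if_neg]
      rintro ⟨h1, h2⟩
      rcases lt_or_gt_of_ne hi with h | h
      · exact absurd (h1 i₀) (not_le.mpr (hlt i h))
      · exact absurd (hm i) (not_le.mpr (h2 i₀ h))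

theorem sum_argmaxSign_mul_le (a c : I → ℝ) :
    ∑ i, argmaxSign i a * c i ≤ Finset.univ.sup' Finset.univ_nonempty fun i => |c i| := by
  obtain ⟨i₀, e, he, -, -, h⟩ := exists_argmaxSign_eq a
  simp_rw [h, ite_mul, zero_mul]
  rw [Finset.sum_ite_eq' Finset.univ i₀, if_pos (Finset.mem_univ _)]
  refine le_trans ?_ (Finset.le_sup' (fun i => |c i|) (Finset.mem_univ i₀))
  calc e * c i₀ ≤ |e * c i₀| := le_abs_self _
    _ = |c i₀| := by rw [abs_mul, he, one_mul]

theorem sum_argmaxSign_mul_self (a : I → ℝ) :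
    ∑ i, argmaxSign i a * a i = Finset.univ.sup' Finset.univ_nonempty fun i => |a i| := by
  refine le_antisymm (sum_argmaxSign_mul_le a a) ?_
  obtain ⟨i₀, e, -, he, hm, h⟩ := exists_argmaxSign_eq a
  simp_rw [h, ite_mul, zero_mul]
  rw [Finset.sum_ite_eq' Finset.univ i₀, if_pos (Finset.mem_univ _), he]
  exact Finset.sup'_le _ _ fun i _ => hm i

end

section
variable {L ι I : Type*} [Fintype L] [DecidableEq L] [Nonempty L] [Fintype ι] [Fintype I]
  [Nonempty I]
  [LinearOrder I]

theorem integral_rotate_eq_average {f : ℝ → (ι → ℝ) → ℝ}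
    (hf : Measurable fun p : ℝ × (ι → ℝ) => f p.1 p.2) {C : ℝ} (hC : ∀ s v, |f s v| ≤ C)
    {σ : (L → ι → ℝ) → ℝ} (hσ : Measurable σ) (hσ1 : ∀ G, |σ G| ≤ 1)
    (hinv : ∀ (O : Matrix L L ℝ), Oᵀ = O → O * O = 1 →
      ∀ G, σ (fun l => ∑ m, O l m • G m) = σ G) (s : ℝ) (y : L → ℝ) :
    ∫ G, σ G * f s (∑ l, (y l / √(Fintype.card L)) • G l) ∂(Measure.pi fun _ : L => gaussPi ι) =
    ∫ G, σ G * ((1 / Fintype.card L) *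
      ∑ l, f s ((√(y ⬝ᵥ y) / √(Fintype.card L)) • G l))
      ∂(Measure.pi fun _ : L => gaussPi ι) := by
  have hfs : Measurable (f s) := hf.comp (by fun_prop : Measurable fun v : ι → ℝ => (s, v))
  set c : ℝ := √(Fintype.card L)
  have key : ∀ l, ∫ G, σ G * f s (∑ l, (y l / c) • G l)
      ∂(Measure.pi fun _ : L => gaussPi ι) =
      ∫ G, σ G * f s ((√(y ⬝ᵥ y) / c) • G l) ∂(Measure.pi fun _ : L => gaussPi ι) := fun l => by
    obtain ⟨O, h1, h2, h3⟩ := exists_reflection y l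
    have hp := measurePreserving_rotate (ι := ι) O (by rw [h1, h2])
    rw [← hp.integral_comp_of_aestronglyMeasurable
      (g := fun G => σ G * f s (∑ l, (y l / c) • G l))
      (hσ.mul (hfs.comp (by fun_prop))).aestronglyMeasurable]
    refine integral_congr_ae (.of_forall fun G => ?_)
    simp only [hinv O h1 h2]
    congr 2
    simp_rw [Finset.smul_sum, smul_smul]
    rw [Finset.sum_comm]
    simp_rw [← Finset.sum_smul]
    have h4 : ∀ m, ∑ l, y l / c * O l m = (√(y ⬝ᵥ y) / c) * (Pi.single l 1 : L → ℝ) m :=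
      fun m => by
      have h5 : ∑ l, O m l * y l = √(y ⬝ᵥ y) * (Pi.single l 1 : L → ℝ) m := congrFun h3 m
      rw [div_mul_eq_mul_div, ← h5, Finset.sum_div]
      refine Finset.sum_congr rfl fun i _ => ?_
      rw [show O m i = O i m from congrFun (congrFun h1 i) m]
      ring
    simp_rw [h4]
    rw [Finset.sum_eq_single l]
    · simp
    · intro m _ hm
      simp [hm]
    · simp
  have hInt : ∀ l, Integrable (fun G : L → ι → ℝ => σ G * f s ((√(y ⬝ᵥ y) / c) • G l))
      (Measure.pi fun _ : L => gaussPi ι) := fun l => by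
    refine Integrable.of_bound (C := C)
      (hσ.mul (hfs.comp (by fun_prop))).aestronglyMeasurable (.of_forall fun G => ?_)
    rw [Real.norm_eq_abs, abs_mul]
    calc _ ≤ 1 * C := mul_le_mul (hσ1 G) (hC _ _) (abs_nonneg _) zero_le_one
      _ = C := one_mul C
  have hN : (Fintype.card L : ℝ) ≠ 0 := Nat.cast_ne_zero.mpr Fintype.card_ne_zero
  simp_rw [mul_left_comm (σ _), Finset.mul_sum]
  rw [integral_finsetSum _ fun l _ => (hInt l).const_mul _]
  simp_rw [integral_const_mul, ← key]
  rw [Finset.sum_const, Finset.card_univ, nsmul_eq_mul, ← mul_assoc, mul_one_div_cancel hN,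
    one_mul]

/-- Averaging over random directions is controlled by the empirical process of the rows: the
rotation invariance of a Gaussian matrix together with convexity. -/
theorem integral_sup_average_le {f : I → ℝ → (ι → ℝ) → ℝ}
    (hf : ∀ i, Measurable fun p : ℝ × (ι → ℝ) => f i p.1 p.2) {C B : ℝ}
    (hC : ∀ i s v, |f i s v| ≤ C)
    (hB : ∀ s, ∫ G, (Finset.univ.sup' Finset.univ_nonempty fun i =>
      |(1 / Fintype.card L) * ∑ l, f i s (s • G l)|)
      ∂(Measure.pi fun _ : L => gaussPi ι) ≤ B) :
    ∫ G, (Finset.univ.sup' Finset.univ_nonempty fun i =>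
      |∫ y, f i (√(y ⬝ᵥ y) / √(Fintype.card L)) (∑ l, (y l / √(Fintype.card L)) • G l)
        ∂(gaussPi L)|) ∂(Measure.pi fun _ : L => gaussPi ι) ≤ B := by
  set c : ℝ := √(Fintype.card L) with hc
  set Γ := (Measure.pi fun _ : L => gaussPi ι) with hΓ
  set h : I → (L → ι → ℝ) → (L → ℝ) → ℝ := fun i G y =>
    f i (√(y ⬝ᵥ y) / c) (∑ l, (y l / c) • G l) with hh
  have hhm : ∀ i, Measurable fun p : (L → ι → ℝ) × (L → ℝ) => h i p.1 p.2 := fun i =>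
    (hf i).comp (Continuous.measurable (by fun_prop) : Measurable fun p : (L → ι → ℝ) × (L → ℝ) =>
      (√(p.2 ⬝ᵥ p.2) / c, ∑ l, (p.2 l / c) • p.1 l))
  have hhb : ∀ i G y, |h i G y| ≤ C := fun i G y => hC _ _ _
  set a : (L → ι → ℝ) → I → ℝ := fun G i => ∫ y, h i G y ∂(gaussPi L) with ha
  have ham : Measurable a := measurable_pi_lambda _ fun i =>
    (StronglyMeasurable.integral_prod_right (hhm i).stronglyMeasurable).measurable
  have hinv : ∀ (O : Matrix L L ℝ), Oᵀ = O → O * O = 1 →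
      ∀ G : L → ι → ℝ, a (fun l => ∑ m, O l m • G m) = a G := fun O h1 h2 G => by
    ext i
    have hp := measurePreserving_mulVec_gaussPi O (by rw [h1, h2])
    have h3 := hp.integral_comp_of_aestronglyMeasurable (g := fun y => h i G y)
      ((hhm i).comp (by fun_prop : Measurable fun y : L → ℝ => (G, y))).aestronglyMeasurable
    rw [ha]
    simp only
    rw [← h3]
    refine integral_congr_ae (.of_forall fun y => ?_)
    simp only [hh]
    congr 1
    · rw [dotProduct_mulVec_eq_transpose, mulVec_mulVec, h1, h2, one_mulVec]
    · simp_rw [Finset.smul_sum, smul_smul]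
      rw [Finset.sum_comm]
      simp_rw [← Finset.sum_smul]
      refine Finset.sum_congr rfl fun m _ => ?_
      congr 1
      simp only [mulVec, dotProduct]
      rw [Finset.sum_div]
      refine Finset.sum_congr rfl fun l _ => ?_
      rw [show O l m = O m l from congrFun (congrFun h1 m) l]
      ring
  have hσm : ∀ i, Measurable fun G => argmaxSign i (a G) := fun i =>
    (measurable_argmaxSign i).comp ham
  have hbd : ∀ {x z : ℝ}, |x| ≤ 1 → |z| ≤ C → ‖x * z‖ ≤ C := fun {x z} hx hz => by
    rw [Real.norm_eq_abs, abs_mul]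
    calc _ ≤ 1 * C := mul_le_mul hx hz (abs_nonneg _) zero_le_one
      _ = C := one_mul C
  have hjoint : ∀ i, Integrable (fun p : (L → ι → ℝ) × (L → ℝ) =>
      argmaxSign i (a p.1) * h i p.1 p.2) (Γ.prod (gaussPi L)) := fun i =>
    Integrable.of_bound (C := C)
      (((hσm i).comp measurable_fst).mul (hhm i)).aestronglyMeasurable
      (.of_forall fun p => hbd (abs_argmaxSign_le i _) (hhb i _ _))
  have hstep : ∀ y, ∑ i, ∫ G, argmaxSign i (a G) * h i G y ∂Γ ≤ B := fun y => by
    set s := √(y ⬝ᵥ y) / c with hs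
    have havgm : ∀ i, Measurable fun G : L → ι → ℝ =>
        (1 / Fintype.card L : ℝ) * ∑ l, f i s (s • G l) := fun i =>
      (Finset.measurable_sum _ fun l _ => (hf i).comp
        (by fun_prop : Measurable fun G : L → ι → ℝ => (s, s • G l))).const_mul _
    have havgb : ∀ i, ∀ G : L → ι → ℝ, |(1 / Fintype.card L : ℝ) * ∑ l, f i s (s • G l)| ≤ C :=
      fun i G => by
      have hN : (0 : ℝ) < Fintype.card L := Nat.cast_pos.mpr Fintype.card_pos
      rw [abs_mul, abs_of_pos (one_div_pos.mpr hN), one_div_mul_eq_div, div_le_iff₀ hN]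
      refine (Finset.abs_sum_le_sum_abs _ _).trans
        ((Finset.sum_le_sum fun l _ => hC i s (s • G l)).trans (le_of_eq ?_))
      rw [Finset.sum_const, Finset.card_univ, nsmul_eq_mul, mul_comm]
    have h1 : ∀ i, ∫ G, argmaxSign i (a G) * h i G y ∂Γ =
        ∫ G, argmaxSign i (a G) * ((1 / Fintype.card L) * ∑ l, f i s (s • G l)) ∂Γ := fun i =>
      integral_rotate_eq_average (hf i) (hC i) (hσm i) (fun G => abs_argmaxSign_le i _)
        (fun O h1 h2 G => by rw [hinv O h1 h2]) s y
    simp_rw [h1]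
    have hInt : ∀ i ∈ (Finset.univ : Finset I), Integrable (fun G =>
        argmaxSign i (a G) * ((1 / Fintype.card L) * ∑ l, f i s (s • G l))) Γ := fun i _ =>
      Integrable.of_bound (C := C) ((hσm i).mul (havgm i)).aestronglyMeasurable
        (.of_forall fun G => hbd (abs_argmaxSign_le i _) (havgb i G))
    rw [← integral_finsetSum _ hInt]
    refine le_trans (integral_mono (integrable_finsetSum _ hInt)
      (Integrable.of_bound (C := C) (measurable_sup'_univ fun i =>
        (havgm i).abs).aestronglyMeasurable (.of_forall fun G => ?_))
      fun G => sum_argmaxSign_mul_le _ _) (hB s)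
    exact abs_sup'_univ_le fun i => by rw [abs_abs]; exact havgb i G
  calc ∫ G, (Finset.univ.sup' Finset.univ_nonempty fun i => |a G i|) ∂Γ
      = ∫ G, ∑ i, ∫ y, argmaxSign i (a G) * h i G y ∂(gaussPi L) ∂Γ := by
        refine integral_congr_ae (.of_forall fun G => ?_)
        simp only
        rw [← sum_argmaxSign_mul_self]
        simp_rw [integral_const_mul]
        rfl
    _ = ∑ i, ∫ y, ∫ G, argmaxSign i (a G) * h i G y ∂Γ ∂(gaussPi L) := by
        rw [integral_finsetSum _ fun i _ => (hjoint i).integral_prod_left]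
        exact Finset.sum_congr rfl fun i _ => integral_integral_swap (hjoint i)
    _ = ∫ y, ∑ i, ∫ G, argmaxSign i (a G) * h i G y ∂Γ ∂(gaussPi L) :=
        (integral_finsetSum _ fun i _ => (hjoint i).integral_prod_right).symm
    _ ≤ ∫ _, B ∂(gaussPi L) := integral_mono
        (integrable_finsetSum _ fun i _ => (hjoint i).integral_prod_right)
        (integrable_const B) hstep
    _ = B := by simp
end

section
variable {U V : Type*} [MeasurableSpace U] [MeasurableSpace V] (ν : Measure U) (ρ : Measure V)
  [IsProbabilityMeasure ν] [IsProbabilityMeasure ρ]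

theorem measurable_real_section {S : Set (U × V)} (hS : MeasurableSet S) :
    Measurable fun v => ν.real {u | (u, v) ∈ S} :=
  (measurable_measure_prodMk_right hS).ennreal_toReal

theorem prod_real_eq_integral_section {S : Set (U × V)} (hS : MeasurableSet S) :
    (ν.prod ρ).real S = ∫ v, ν.real {u | (u, v) ∈ S} ∂ρ := by
  rw [measureReal_def, Measure.prod_apply_symm hS, ← integral_toReal]
  · rfl
  · exact (measurable_measure_prodMk_right hS).aemeasurable
  · exact .of_forall fun v => measure_lt_top _ _

theorem integral_sup_section_le {L I : Type*} [Fintype L] [Nonempty L] [Fintype I] [Nonempty I]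
    {S : I → Set (U × V)} (hS : ∀ i, MeasurableSet (S i)) :
    ∫ G : L → V, (Finset.univ.sup' Finset.univ_nonempty fun i =>
      |(1 / Fintype.card L) * ∑ l, (ν.real {u | (u, G l) ∈ S i} - (ν.prod ρ).real (S i))|)
      ∂(Measure.pi fun _ : L => ρ) ≤
    ∫ z, (Finset.univ.sup' Finset.univ_nonempty fun i =>
      |empirical (S i) z - (ν.prod ρ).real (S i)|) ∂(Measure.pi fun _ : L => ν.prod ρ) := by
  classical
  have hn : (Fintype.card L : ℝ) ≠ 0 := Nat.cast_ne_zero.mpr Fintype.card_ne_zero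
  have hp := (measurePreserving_arrowProdEquivProdArrow U V L (fun _ => ν) (fun _ => ρ)).symm
  have hpm : Measurable fun q : (L → U) × (L → V) => fun l => (q.1 l, q.2 l) := by fun_prop
  have hemp : ∀ i, Measurable (empirical (S i) : (L → U × V) → ℝ) := fun i =>
    measurable_empirical (hS i)
  have hb : ∀ i (z : L → U × V), |empirical (S i) z - (ν.prod ρ).real (S i)| ≤ 1 := fun i z => by
    have h1 := empirical_mem_Icc (S i) z
    have h2 : (ν.prod ρ).real (S i) ≤ 1 := measureReal_le_one
    have h3 : 0 ≤ (ν.prod ρ).real (S i) := measureReal_nonneg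
    rw [abs_le]; constructor <;> linarith
  set g : (L → U × V) → ℝ := fun z => Finset.univ.sup' Finset.univ_nonempty fun i =>
      |empirical (S i) z - (ν.prod ρ).real (S i)| with hg
  have hgm : Measurable g := measurable_sup'_univ fun i => ((hemp i).sub_const _).abs
  have hgb : ∀ z, ‖g z‖ ≤ 1 := fun z => abs_sup'_univ_le fun i => by rw [abs_abs]; exact hb i z
  have h1 : ∫ z, g z ∂(Measure.pi fun _ : L => ν.prod ρ) =
      ∫ G : L → V, ∫ u : L → U, g (fun l => (u l, G l)) ∂(Measure.pi fun _ : L => ν)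
        ∂(Measure.pi fun _ : L => ρ) := by
    rw [← hp.integral_comp_of_aestronglyMeasurable hgm.aestronglyMeasurable, integral_prod_symm]
    · rfl
    · exact Integrable.of_bound (C := 1) (hgm.comp hpm).aestronglyMeasurable
        (.of_forall fun q => hgb _)
  rw [h1]
  have hgj : Integrable (fun q : (L → U) × (L → V) => g (fun l => (q.1 l, q.2 l)))
      ((Measure.pi fun _ : L => ν).prod (Measure.pi fun _ : L => ρ)) :=
    Integrable.of_bound (C := 1) (hgm.comp hpm).aestronglyMeasurable (.of_forall fun q => hgb _)
  have hsec : ∀ (G : L → V) i, Integrable (fun u : L → U =>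
      empirical (S i) (fun l => (u l, G l)) - (ν.prod ρ).real (S i))
      (Measure.pi fun _ : L => ν) := fun G i =>
    Integrable.of_bound (C := 1) (((hemp i).comp
      (by fun_prop : Measurable fun u : L → U => fun l => (u l, G l))).sub_const
        _).aestronglyMeasurable (.of_forall fun u => hb i _)
  have hval : ∀ (G : L → V) i, (1 / Fintype.card L : ℝ) *
      ∑ l, (ν.real {u | (u, G l) ∈ S i} - (ν.prod ρ).real (S i)) =
      ∫ u : L → U, (empirical (S i) (fun l => (u l, G l)) - (ν.prod ρ).real (S i))
        ∂(Measure.pi fun _ : L => ν) := fun G i => by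
    have hSl : ∀ l, MeasurableSet {u | (u, G l) ∈ S i} := fun l =>
      measurable_prodMk_right (hS i)
    have hml : ∀ l, Measurable fun u => if (u, G l) ∈ S i then (1 : ℝ) else 0 := fun l =>
      Measurable.ite (hSl l) measurable_const measurable_const
    have hl : ∀ l, ∫ u : L → U, (if (u l, G l) ∈ S i then (1 : ℝ) else 0)
        ∂(Measure.pi fun _ : L => ν) = ν.real {u | (u, G l) ∈ S i} := fun l => by
      have h2 := (measurePreserving_eval (fun _ : L => ν) l).integral_comp_of_aestronglyMeasurable
        (hml l).aestronglyMeasurable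
      refine h2.trans ?_
      rw [← integral_indicator_one (hSl l)]
      refine integral_congr_ae (.of_forall fun u => ?_)
      simp [Set.indicator]
    have hil : ∀ l ∈ (Finset.univ : Finset L), Integrable (fun u : L → U =>
        if (u l, G l) ∈ S i then (1 : ℝ) else 0) (Measure.pi fun _ : L => ν) := fun l _ =>
      Integrable.of_bound (C := 1) ((hml l).comp (measurable_pi_apply l)).aestronglyMeasurable
        (.of_forall fun u => by split_ifs <;> simp)
    unfold empirical
    rw [integral_sub ((integrable_finsetSum _ hil).div_const _) (integrable_const _), integral_div,
      integral_finsetSum _ hil]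
    simp_rw [hl]
    rw [Finset.sum_sub_distrib, Finset.sum_const, Finset.card_univ, nsmul_eq_mul]
    simp
    field_simp
  refine integral_mono_of_nonneg (.of_forall fun G => ?_) hgj.integral_prod_right
    (.of_forall fun G => ?_)
  · obtain ⟨i⟩ := ‹Nonempty I›
    exact (abs_nonneg _).trans (Finset.le_sup' (fun i => |(1 / Fintype.card L : ℝ) *
      ∑ l, (ν.real {u | (u, G l) ∈ S i} - (ν.prod ρ).real (S i))|) (Finset.mem_univ i))
  · refine Finset.sup'_le _ _ fun i _ => ?_
    rw [hval]
    refine abs_integral_le_integral_abs.trans (integral_mono (hsec G i).abs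
      (Integrable.of_bound (C := 1) (hgm.comp
        (by fun_prop : Measurable fun u : L → U => fun l => (u l, G l))).aestronglyMeasurable
        (.of_forall fun u => hgb _)) fun u => ?_)
    exact Finset.le_sup' (fun i => |empirical (S i) (fun l => (u l, G l)) - (ν.prod ρ).real (S i)|)
      (Finset.mem_univ i)

theorem measurableSet_orthant {Z : Type*} [MeasurableSpace Z] {k : ℕ} {Ψ : Z → Fin k → ℝ}
    (hΨ : Measurable Ψ) (t : Fin k → ℝ) : MeasurableSet {z | ∀ j, Ψ z j ≤ t j} := by
  rw [Set.ofPred_forall]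
  exact MeasurableSet.iInter fun j => measurableSet_le
    ((measurable_pi_apply j).comp hΨ) measurable_const

theorem tendsto_real_orthant {Z : Type*} [MeasurableSpace Z] (μ : Measure Z) [IsFiniteMeasure μ]
    {k : ℕ} {Ψ : Z → Fin k → ℝ} (hΨ : Measurable Ψ) {θ : Fin k → ℝ} {θ' : ℕ → Fin k → ℝ}
    (h1 : ∀ n j, θ j ≤ θ' n j) (h2 : ∀ j, Filter.Tendsto (fun n => θ' n j) .atTop (nhds (θ j))) :
    Filter.Tendsto (fun n => μ.real {z | ∀ j, Ψ z j ≤ θ' n j}) .atTop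
      (nhds (μ.real {z | ∀ j, Ψ z j ≤ θ j})) := by
  have h := tendsto_measure_of_tendsto_indicator_of_isFiniteMeasure (A := {z | ∀ j, Ψ z j ≤ θ j})
    Filter.atTop μ (fun n => measurableSet_orthant hΨ (θ' n)) fun z => ?_
  · exact (ENNReal.tendsto_toReal (measure_ne_top _ _)).comp h
  · by_cases hz : ∀ j, Ψ z j ≤ θ j
    · exact .of_forall fun n => iff_of_true (fun j => (hz j).trans (h1 n j)) hz
    · push Not at hz
      obtain ⟨j, hj⟩ := hz
      filter_upwards [(h2 j).eventually_lt_const hj] with n hn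
      exact iff_of_false (fun h => absurd (h j) (not_le.mpr hn))
        (fun h => absurd (h j) (not_le.mpr hj))
end

section
variable {U : Type*} [MeasurableSpace U] (ν : Measure U) [IsProbabilityMeasure ν]
  {L ι : Type*} [Fintype L] [Fintype ι] {k : ℕ}

/-- The discrepancy at the threshold `θ` between the law obtained from the sketch with rows `G`
and its average over `G`. -/
noncomputable def sketchDiscrepancy (φ : ℝ → U → (ι → ℝ) → Fin k → ℝ) (G : L → ι → ℝ)
    (θ : Fin k → ℝ) : ℝ :=
  (ν.prod (gaussPi L)).real {p | ∀ j, φ (√(p.2 ⬝ᵥ p.2) / √(Fintype.card L)) p.1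
      (∑ l, (p.2 l / √(Fintype.card L)) • G l) j ≤ θ j} -
    ((ν.prod (gaussPi ι)).prod (gaussPi L)).real
      {q | ∀ j, φ (√(q.2 ⬝ᵥ q.2) / √(Fintype.card L)) q.1.1
        ((√(q.2 ⬝ᵥ q.2) / √(Fintype.card L)) • q.1.2) j ≤ θ j}

theorem integral_sup_sketchDiscrepancy_le [DecidableEq L] [Nonempty L] {I : Type*} [Fintype I]
    [Nonempty I] [LinearOrder I] (hk : 0 < k) (hkL : k ≤ Fintype.card L)
    {φ : ℝ → U → (ι → ℝ) → Fin k → ℝ}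
    (hφ : Measurable fun p : U × ℝ × (ι → ℝ) => φ p.2.1 p.1 p.2.2) (θ : I → Fin k → ℝ) :
    ∫ G : L → ι → ℝ, (Finset.univ.sup' Finset.univ_nonempty fun i =>
      |sketchDiscrepancy ν φ G (θ i)|) ∂(Measure.pi fun _ : L => gaussPi ι) ≤
    √(2 * (k * Real.log (2 * Real.exp 1 * Fintype.card L / k) + Real.log 2) /
      Fintype.card L) := by
  set c : ℝ := √(Fintype.card L)
  set f : I → ℝ → (ι → ℝ) → ℝ := fun i s v => ν.real {u | ∀ j, φ s u v j ≤ θ i j} -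
    (ν.prod (gaussPi ι)).real {p | ∀ j, φ s p.1 (s • p.2) j ≤ θ i j} with hf
  have hlen : Measurable fun y : L → ℝ => √(y ⬝ᵥ y) / c := Continuous.measurable (by fun_prop)
  have hdir : ∀ G : L → ι → ℝ, Measurable fun y : L → ℝ => ∑ l, (y l / c) • G l := fun G =>
    Continuous.measurable (by fun_prop)
  have hsc : Measurable fun q : (U × (ι → ℝ)) × ℝ => φ q.2 q.1.1 (q.2 • q.1.2) :=
    hφ.comp (by fun_prop : Measurable fun q : (U × (ι → ℝ)) × ℝ => (q.1.1, q.2, q.2 • q.1.2))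
  have hm1 : ∀ i, Measurable fun p : ℝ × (ι → ℝ) => ν.real {u | ∀ j, φ p.1 u p.2 j ≤ θ i j} :=
    fun i => measurable_real_section ν (measurableSet_orthant hφ (θ i))
  have hm2 : ∀ i, Measurable fun s =>
      (ν.prod (gaussPi ι)).real {p | ∀ j, φ s p.1 (s • p.2) j ≤ θ i j} :=
    fun i => measurable_real_section _ (measurableSet_orthant hsc (θ i))
  have h01 : ∀ {a b : ℝ}, 0 ≤ a → a ≤ 1 → 0 ≤ b → b ≤ 1 → |a - b| ≤ 1 := fun h1 h2 h3 h4 => by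
    rw [abs_le]; constructor <;> linarith
  have hD : ∀ G i, sketchDiscrepancy ν φ G (θ i) =
      ∫ y, f i (√(y ⬝ᵥ y) / c) (∑ l, (y l / c) • G l) ∂(gaussPi L) := fun G i => by
    have hx : Measurable fun p : U × (L → ℝ) =>
        φ (√(p.2 ⬝ᵥ p.2) / c) p.1 (∑ l, (p.2 l / c) • G l) :=
      hφ.comp (measurable_fst.prodMk
        ((hlen.comp measurable_snd).prodMk ((hdir G).comp measurable_snd)))
    have hy : Measurable fun q : (U × (ι → ℝ)) × (L → ℝ) =>
        φ (√(q.2 ⬝ᵥ q.2) / c) q.1.1 ((√(q.2 ⬝ᵥ q.2) / c) • q.1.2) :=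
      hsc.comp (measurable_fst.prodMk (hlen.comp measurable_snd))
    rw [sketchDiscrepancy, prod_real_eq_integral_section _ _ (measurableSet_orthant hx (θ i)),
      prod_real_eq_integral_section _ _ (measurableSet_orthant hy (θ i)), ← integral_sub]
    · rfl
    · exact Integrable.of_bound (C := 1)
        (measurable_real_section _ (measurableSet_orthant hx (θ i))).aestronglyMeasurable
        (.of_forall fun y => by
          rw [Real.norm_of_nonneg measureReal_nonneg]; exact measureReal_le_one)
    · exact Integrable.of_bound (C := 1)
        (measurable_real_section _ (measurableSet_orthant hy (θ i))).aestronglyMeasurable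
        (.of_forall fun y => by
          rw [Real.norm_of_nonneg measureReal_nonneg]; exact measureReal_le_one)
  simp_rw [hD]
  refine integral_sup_average_le (C := 1)
    (fun i => (hm1 i).sub ((hm2 i).comp measurable_fst)) (fun i s v =>
      h01 measureReal_nonneg measureReal_le_one measureReal_nonneg measureReal_le_one) fun s => ?_
  have hs : Measurable fun p : U × (ι → ℝ) => φ s p.1 (s • p.2) :=
    hsc.comp (by fun_prop : Measurable fun p : U × (ι → ℝ) => (p, s))
  exact (integral_sup_section_le ν (gaussPi ι) (fun i => measurableSet_orthant hs (θ i))).trans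
    (integral_sup_orthant_le (ν.prod (gaussPi ι)) hk hkL hs θ)

theorem measurable_sketchDiscrepancy {φ : ℝ → U → (ι → ℝ) → Fin k → ℝ}
    (hφ : Measurable fun p : U × ℝ × (ι → ℝ) => φ p.2.1 p.1 p.2.2) (θ : Fin k → ℝ) :
    Measurable fun G : L → ι → ℝ => sketchDiscrepancy ν φ G θ := by
  refine Measurable.sub_const (measurable_real_section _
    (S := {q : (U × (L → ℝ)) × (L → ι → ℝ) | ∀ j, φ (√(q.1.2 ⬝ᵥ q.1.2) / √(Fintype.card L)) q.1.1
      (∑ l, (q.1.2 l / √(Fintype.card L)) • q.2 l) j ≤ θ j}) ?_) _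
  refine measurableSet_orthant (hφ.comp (g := fun q : (U × ℝ × (ι → ℝ)) => φ q.2.1 q.1 q.2.2)
    (f := fun q : (U × (L → ℝ)) × (L → ι → ℝ) => (q.1.1, √(q.1.2 ⬝ᵥ q.1.2) / √(Fintype.card L),
      ∑ l, (q.1.2 l / √(Fintype.card L)) • q.2 l)) ?_) θ
  refine measurable_fst.fst.prodMk (Measurable.prodMk ?_ ?_)
  · exact (Continuous.measurable (by fun_prop) : Measurable fun y : L → ℝ =>
      √(y ⬝ᵥ y) / √(Fintype.card L)).comp measurable_fst.snd
  · exact (Continuous.measurable (by fun_prop) : Measurable fun y : (L → ℝ) × (L → ι → ℝ) =>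
      ∑ l, (y.1 l / √(Fintype.card L)) • y.2 l).comp (measurable_fst.snd.prodMk measurable_snd)

theorem sketchDiscrepancy_le_of_rat [DecidableEq L] {φ : ℝ → U → (ι → ℝ) → Fin k → ℝ}
    (hφ : Measurable fun p : U × ℝ × (ι → ℝ) => φ p.2.1 p.1 p.2.2) {G : L → ι → ℝ} {B : ℝ}
    (h : ∀ θ : Fin k → ℚ, |sketchDiscrepancy ν φ G (fun j => θ j)| ≤ B) (θ : Fin k → ℝ) :
    |sketchDiscrepancy ν φ G θ| ≤ B := by
  have hq : ∀ (n : ℕ) j, ∃ q : ℚ, θ j < q ∧ (q : ℝ) < θ j + 1 / (n + 1) := fun n j =>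
    exists_rat_btwn (lt_add_of_pos_right _ Nat.one_div_pos_of_nat)
  choose q hq1 hq2 using hq
  have hlim : ∀ j, Filter.Tendsto (fun n => (q n j : ℝ)) .atTop (nhds (θ j)) := fun j => by
    refine tendsto_of_tendsto_of_tendsto_of_le_of_le tendsto_const_nhds ?_
      (fun n => (hq1 n j).le) (fun n => (hq2 n j).le)
    simpa using (tendsto_one_div_add_atTop_nhds_zero_nat (𝕜 := ℝ)).const_add (θ j)
  have hlen : Measurable fun y : L → ℝ => √(y ⬝ᵥ y) / √(Fintype.card L) :=
    Continuous.measurable (by fun_prop)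
  have hdir : Measurable fun y : L → ℝ => ∑ l, (y l / √(Fintype.card L)) • G l :=
    Continuous.measurable (by fun_prop)
  have hx : Measurable fun p : U × (L → ℝ) =>
      φ (√(p.2 ⬝ᵥ p.2) / √(Fintype.card L)) p.1 (∑ l, (p.2 l / √(Fintype.card L)) • G l) :=
    hφ.comp (measurable_fst.prodMk
      ((hlen.comp measurable_snd).prodMk (hdir.comp measurable_snd)))
  have hy : Measurable fun q : (U × (ι → ℝ)) × (L → ℝ) =>
      φ (√(q.2 ⬝ᵥ q.2) / √(Fintype.card L)) q.1.1
        ((√(q.2 ⬝ᵥ q.2) / √(Fintype.card L)) • q.1.2) :=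
    hφ.comp (measurable_fst.fst.prodMk ((hlen.comp measurable_snd).prodMk
      ((hlen.comp measurable_snd).smul measurable_fst.snd)))
  have ht := ((tendsto_real_orthant (ν.prod (gaussPi L)) hx (fun n j => (hq1 n j).le) hlim).sub
    (tendsto_real_orthant ((ν.prod (gaussPi ι)).prod (gaussPi L)) hy
      (fun n j => (hq1 n j).le) hlim)).abs
  exact le_of_tendsto ht (.of_forall fun n => h (q n))

/-- A fixed matrix of `|L|` rows reproduces the average law of a random Gaussian sketch, uniformly
over all thresholds. -/
theorem exists_sketch [DecidableEq L] [Nonempty L] (hk : 0 < k) (hkL : k ≤ Fintype.card L)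
    {φ : ℝ → U → (ι → ℝ) → Fin k → ℝ}
    (hφ : Measurable fun p : U × ℝ × (ι → ℝ) => φ p.2.1 p.1 p.2.2) :
    ∃ G : L → ι → ℝ, ∀ θ, |sketchDiscrepancy ν φ G θ| ≤
      2 * √(2 * (k * Real.log (2 * Real.exp 1 * Fintype.card L / k) + Real.log 2) /
        Fintype.card L) := by
  have hk' : (0 : ℝ) < k := Nat.cast_pos.mpr hk
  have hn : (k : ℝ) ≤ Fintype.card L := Nat.cast_le.mpr hkL
  have hbase : 1 ≤ 2 * Real.exp 1 * Fintype.card L / k := by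
    rw [one_le_div hk']
    have := Real.add_one_le_exp (1 : ℝ)
    have h3 : 1 * (k : ℝ) ≤ (2 * Real.exp 1) * Fintype.card L :=
      mul_le_mul (by linarith) hn hk'.le (by linarith)
    linarith
  set B : ℝ := √(2 * (k * Real.log (2 * Real.exp 1 * Fintype.card L / k) + Real.log 2) /
        Fintype.card L) with hB
  have hBpos : 0 < B := Real.sqrt_pos.mpr (div_pos (mul_pos two_pos
    (add_pos_of_nonneg_of_pos (mul_nonneg hk'.le (Real.log_nonneg hbase))
      (Real.log_pos one_lt_two))) (hk'.trans_le hn))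
  obtain ⟨e, he⟩ := exists_surjective_nat (Fin k → ℚ)
  set Γ := Measure.pi fun _ : L => gaussPi ι
  set D : (L → ι → ℝ) → ℕ → ℝ := fun G n => |sketchDiscrepancy ν φ G fun j => e n j| with hD
  have hDm : ∀ n, Measurable fun G => D G n := fun n =>
    (measurable_sketchDiscrepancy ν hφ _).abs
  have hD1 : ∀ G n, D G n ≤ 1 := fun G n => by
    have h1 := measureReal_nonneg (μ := ν.prod (gaussPi L)) (s := {p | ∀ j,
      φ (√(p.2 ⬝ᵥ p.2) / √(Fintype.card L)) p.1
      (∑ l, (p.2 l / √(Fintype.card L)) • G l) j ≤ e n j})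
    have h2 := measureReal_le_one (μ := ν.prod (gaussPi L)) (s := {p | ∀ j,
      φ (√(p.2 ⬝ᵥ p.2) / √(Fintype.card L)) p.1
      (∑ l, (p.2 l / √(Fintype.card L)) • G l) j ≤ e n j})
    have h3 := measureReal_nonneg (μ := (ν.prod (gaussPi ι)).prod (gaussPi L)) (s :=
      {q | ∀ j, φ (√(q.2 ⬝ᵥ q.2) / √(Fintype.card L)) q.1.1
        ((√(q.2 ⬝ᵥ q.2) / √(Fintype.card L)) • q.1.2) j ≤ e n j})
    have h4 := measureReal_le_one (μ := (ν.prod (gaussPi ι)).prod (gaussPi L)) (s :=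
      {q | ∀ j, φ (√(q.2 ⬝ᵥ q.2) / √(Fintype.card L)) q.1.1
        ((√(q.2 ⬝ᵥ q.2) / √(Fintype.card L)) • q.1.2) j ≤ e n j})
    simp only [hD, sketchDiscrepancy]
    rw [abs_le]; constructor <;> linarith
  set S : ℕ → Set (L → ι → ℝ) := fun N => {G | ∃ n ≤ N, 2 * B < D G n} with hS
  have hSm : Monotone S := fun N M hNM G ⟨n, hn, h⟩ => ⟨n, hn.trans hNM, h⟩
  have hSb : ∀ N, Γ.real (S N) ≤ 1 / 2 := fun N => by
    have h1 := integral_sup_sketchDiscrepancy_le (L := L) ν hk hkL hφ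
      (fun i : Fin (N + 1) => fun j => (e i j : ℝ))
    set g : (L → ι → ℝ) → ℝ := fun G => Finset.univ.sup' Finset.univ_nonempty
      fun i : Fin (N + 1) => |sketchDiscrepancy ν φ G fun j => (e i j : ℝ)|
    have hgm : Measurable g := measurable_sup'_univ fun i : Fin (N + 1) => hDm i
    have hg0 : ∀ G, 0 ≤ g G := fun G => (abs_nonneg _).trans (Finset.le_sup'
      (fun i : Fin (N + 1) => |sketchDiscrepancy ν φ G fun j => (e i j : ℝ)|) (Finset.mem_univ 0))
    have hgi : Integrable g Γ := Integrable.of_bound (C := 1) hgm.aestronglyMeasurable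
      (.of_forall fun G => abs_sup'_univ_le fun i => by rw [abs_abs]; exact hD1 G i)
    have h2 := mul_meas_ge_le_integral_of_nonneg (.of_forall hg0) hgi (2 * B)
    have h3 : Γ.real (S N) ≤ Γ.real {G | 2 * B ≤ g G} := measureReal_mono (fun G ⟨n, hn, h⟩ =>
      h.le.trans (Finset.le_sup' (fun i : Fin (N + 1) =>
        |sketchDiscrepancy ν φ G fun j => (e i j : ℝ)|)
        (Finset.mem_univ (⟨n, Nat.lt_succ_of_le hn⟩ : Fin (N + 1)))))
    have h4 : 2 * B * Γ.real {G | 2 * B ≤ g G} ≤ B := h2.trans h1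
    have h5 : Γ.real {G | 2 * B ≤ g G} ≤ 1 / 2 := by
      by_contra! h
      have := mul_lt_mul_of_pos_left h (mul_pos two_pos hBpos)
      linarith
    exact h3.trans h5
  have hU : Γ (⋃ N, S N) ≤ ENNReal.ofReal (1 / 2) := by
    rw [hSm.measure_iUnion]
    exact iSup_le fun N => (ENNReal.le_ofReal_iff_toReal_le (measure_ne_top _ _)
      (by norm_num)).mpr (hSb N)
  have hne : (⋃ N, S N) ≠ Set.univ := fun h => by
    rw [h, measure_univ] at hU
    rw [ENNReal.one_le_ofReal] at hU
    norm_num at hU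
  obtain ⟨G, hG⟩ := (Set.ne_univ_iff_exists_notMem _).mp hne
  refine ⟨G, fun θ => sketchDiscrepancy_le_of_rat ν hφ (fun t => ?_) θ⟩
  obtain ⟨n, rfl⟩ := he t
  by_contra! h
  exact hG (Set.mem_iUnion.mpr ⟨n, n, le_rfl, h⟩)
end

section
variable {ι L : Type*} [Fintype ι] [Fintype L]

theorem integral_abs_sq_norm_sub_one_le [Nonempty L] :
    Integrable (fun y : L → ℝ => |(√(y ⬝ᵥ y) / √(Fintype.card L)) ^ 2 - 1|) (gaussPi L) ∧
    ∫ y : L → ℝ, |(√(y ⬝ᵥ y) / √(Fintype.card L)) ^ 2 - 1| ∂(gaussPi L) ≤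
      √(2 / Fintype.card L) := by
  classical
  have hT : (0 : ℝ) < Fintype.card L := Nat.cast_pos.mpr Fintype.card_pos
  set B : Matrix L L ℝ := (1 / Fintype.card L : ℝ) • 1 with hB
  have htr : B.trace = 1 := by
    rw [hB, trace_smul, trace_one, smul_eq_mul, one_div_mul_cancel hT.ne']
  have hfr : frobSq B = 1 / Fintype.card L := by
    rw [frobSq_eq_trace, hB, transpose_smul, transpose_one, smul_mul_smul_comm, one_mul, trace_smul,
      trace_one, smul_eq_mul, mul_assoc, one_div_mul_cancel hT.ne', mul_one]
  obtain ⟨h1, h2⟩ := integral_chaos_sq (A := B) (by rw [hB, transpose_smul, transpose_one])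
  have h3 : ∀ y : L → ℝ, (√(y ⬝ᵥ y) / √(Fintype.card L)) ^ 2 - 1 = chaos B y := fun y => by
    rw [chaos, htr, div_pow, Real.sq_sqrt (dotProduct_self_nonneg' y), Real.sq_sqrt hT.le, hB,
      smul_mulVec, one_mulVec, dotProduct_smul, smul_eq_mul, one_div_mul_eq_div]
  simp_rw [h3]
  set D : ℝ := √(2 / Fintype.card L)
  have hD : 0 < D := Real.sqrt_pos.mpr (by positivity)
  have hDD : D * D = 2 / Fintype.card L := Real.mul_self_sqrt (by positivity)
  have hle : ∀ y, |chaos B y| ≤ chaos B y ^ 2 * (1 / (2 * D)) + D / 2 := fun y => by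
    rw [← sub_nonneg]
    have : chaos B y ^ 2 * (1 / (2 * D)) + D / 2 - |chaos B y| =
        (|chaos B y| - D) ^ 2 / (2 * D) := by
      rw [← sq_abs]
      field_simp
      ring
    rw [this]
    positivity
  have hi : Integrable (fun y => chaos B y ^ 2 * (1 / (2 * D)) + D / 2) (gaussPi L) :=
    (h1.mul_const _).add (integrable_const _)
  have hc : Continuous fun y : L → ℝ => |chaos B y| := by unfold chaos; fun_prop
  have hi' : Integrable (fun y => |chaos B y|) (gaussPi L) :=
    hi.mono' hc.aestronglyMeasurable (.of_forall fun y => by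
      rw [Real.norm_eq_abs, abs_abs]; exact hle y)
  refine ⟨hi', (integral_mono hi' hi hle).trans (le_of_eq ?_)⟩
  rw [integral_add (h1.mul_const _) (integrable_const _), integral_mul_const, h2, hfr]
  simp
  field_simp
  field_simp at hDD
  linarith

variable {d k : ℕ}

/-- The quadratic polynomial in the kept coordinates `u` and the sketched direction `v`. -/
noncomputable def sketchPoly (A : Fin k → Matrix ι ι ℝ) (b : Fin k → ι → ℝ) (c : Fin k → ℝ)
    (E : Matrix ι (Fin d) ℝ) (P : Matrix ι ι ℝ) (s : ℝ) (u : Fin d → ℝ) (v : ι → ℝ)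
    (j : Fin k) : ℝ :=
  qf (A j) (b j) (c j) (E *ᵥ u + P *ᵥ v) - (s ^ 2 - 1) * (P * A j).trace

theorem continuous_sketchPoly (A : Fin k → Matrix ι ι ℝ) (b : Fin k → ι → ℝ) (c : Fin k → ℝ)
    (E : Matrix ι (Fin d) ℝ) (P : Matrix ι ι ℝ) :
    Continuous fun p : (Fin d → ℝ) × ℝ × (ι → ℝ) => sketchPoly A b c E P p.2.1 p.1 p.2.2 := by
  refine continuous_pi fun j => ?_
  simp only [sketchPoly, qf]
  fun_prop

theorem sketchPoly_real_eq_rescaled [DecidableEq ι] (A : Fin k → Matrix ι ι ℝ)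
    (b : Fin k → ι → ℝ) (c : Fin k → ℝ) {E : Matrix ι (Fin d) ℝ} (hE : Eᵀ * E = 1) (s : ℝ)
    (θ : Fin k → ℝ) :
    ((gaussPi (Fin d)).prod (gaussPi ι)).real
      {p | ∀ j, sketchPoly A b c E (1 - E * Eᵀ) s p.1 (s • p.2) j ≤ θ j} =
    (gaussPi ι).real {x | ∀ j, rescaled (A j) (b j) (c j - θ j) (1 - E * Eᵀ) s x ≤ 0} := by
  obtain ⟨hP, hPP⟩ := proj_isSymm_idem hE
  have hPE : (1 - E * Eᵀ) * E = 0 := by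
    rw [Matrix.sub_mul, Matrix.one_mul, Matrix.mul_assoc, hE, Matrix.mul_one, sub_self]
  have hmp := measurePreserving_mulVec_add_gaussPi E (1 - E * Eᵀ) (by rw [hP, hPP]; abel)
  have hm : MeasurableSet
      {x | ∀ j, rescaled (A j) (b j) (c j - θ j) (1 - E * Eᵀ) s x ≤ 0} :=
    measurableSet_orthant (Ψ := fun x j => rescaled (A j) (b j) (c j - θ j) (1 - E * Eᵀ) s x)
      (Continuous.measurable (by fun_prop)) fun _ => 0
  rw [← hmp.measureReal_preimage hm.nullMeasurableSet]
  congr 1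
  ext p
  simp only [Set.mem_preimage, Set.mem_ofPred_eq]
  refine forall_congr' fun j => ?_
  rw [sketchPoly, rescaled]
  have h1 : E *ᵥ p.1 + (1 - E * Eᵀ) *ᵥ p.2 +
      (s - 1) • (1 - E * Eᵀ) *ᵥ (E *ᵥ p.1 + (1 - E * Eᵀ) *ᵥ p.2) =
      E *ᵥ p.1 + (1 - E * Eᵀ) *ᵥ (s • p.2) := by
    rw [mulVec_add, mulVec_mulVec, mulVec_mulVec, hPE, hPP, zero_mulVec, zero_add, mulVec_smul,
      sub_smul, one_smul]
    abel
  rw [h1, qf, qf, ← sub_nonneg, ← neg_nonneg (a := _ - _)]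
  have : ∀ {a b : ℝ}, a = b → (0 ≤ a ↔ 0 ≤ b) := fun h => by rw [h]
  exact this (by ring)

theorem measurable_sketchPoly_scaled [DecidableEq ι] (A : Fin k → Matrix ι ι ℝ)
    (b : Fin k → ι → ℝ) (c : Fin k → ℝ) (E : Matrix ι (Fin d) ℝ) :
    Measurable fun q : ((Fin d → ℝ) × (ι → ℝ)) × (L → ℝ) =>
      sketchPoly A b c E (1 - E * Eᵀ) (√(q.2 ⬝ᵥ q.2) / √(Fintype.card L)) q.1.1
        ((√(q.2 ⬝ᵥ q.2) / √(Fintype.card L)) • q.1.2) := by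
  refine Continuous.measurable (continuous_pi fun j => ?_)
  simp only [sketchPoly, qf]
  fun_prop

/-- The orthant probability of the rescaled polynomials, averaged over the length of `y`. -/
theorem integrable_rescaled_real [DecidableEq ι] (A : Fin k → Matrix ι ι ℝ)
    (b : Fin k → ι → ℝ) (c : Fin k → ℝ) {E : Matrix ι (Fin d) ℝ} (hE : Eᵀ * E = 1)
    (θ : Fin k → ℝ) :
    Integrable (fun y : L → ℝ => (gaussPi ι).real {x | ∀ j, rescaled (A j) (b j)
      (c j - θ j) (1 - E * Eᵀ) (√(y ⬝ᵥ y) / √(Fintype.card L)) x ≤ 0}) (gaussPi L) := by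
  have hm : Measurable fun y : L → ℝ => (gaussPi ι).real {x | ∀ j, rescaled (A j) (b j)
      (c j - θ j) (1 - E * Eᵀ) (√(y ⬝ᵥ y) / √(Fintype.card L)) x ≤ 0} := by
    simp_rw [← sketchPoly_real_eq_rescaled A b c hE]
    exact measurable_real_section _ (measurableSet_orthant
      (measurable_sketchPoly_scaled A b c E) θ)
  exact Integrable.of_bound (C := 1) hm.aestronglyMeasurable (.of_forall fun y => by
    rw [Real.norm_of_nonneg measureReal_nonneg]; exact measureReal_le_one)

theorem abs_integral_rescaled_real_sub_le [DecidableEq ι] [Nonempty L]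
    (A : Fin k → Matrix ι ι ℝ) (b : Fin k → ι → ℝ) (c : Fin k → ℝ) {E : Matrix ι (Fin d) ℝ}
    (hE : Eᵀ * E = 1) {e₁ e₂ : ℝ} (h2 : 0 ≤ e₂)
    (h : ∀ s, 0 ≤ s → ∀ c : Fin k → ℝ,
      |(gaussPi ι).real {x | ∀ j, rescaled (A j) (b j) (c j) (1 - E * Eᵀ) s x ≤ 0} -
        (gaussPi ι).real {x | ∀ j, qf (A j) (b j) (c j) x ≤ 0}| ≤ e₁ + e₂ * |s ^ 2 - 1|)
    (θ : Fin k → ℝ) :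
    |(∫ y : L → ℝ, (gaussPi ι).real {x | ∀ j, rescaled (A j) (b j)
      (c j - θ j) (1 - E * Eᵀ) (√(y ⬝ᵥ y) / √(Fintype.card L)) x ≤ 0} ∂(gaussPi L)) -
      (gaussPi ι).real {x | ∀ j, qf (A j) (b j) (c j) x ≤ θ j}| ≤
      e₁ + e₂ * √(2 / Fintype.card L) := by
  have hY : (gaussPi ι).real {x | ∀ j, qf (A j) (b j) (c j) x ≤ θ j} =
      (gaussPi ι).real {x | ∀ j, qf (A j) (b j) (c j - θ j) x ≤ 0} := by
    congr 1
    ext x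
    refine forall_congr' fun j => ?_
    rw [qf, qf, ← add_sub_assoc, sub_nonpos]
  have hi := integrable_rescaled_real (L := L) A b c hE θ
  have hf : ∀ y : L → ℝ, |(gaussPi ι).real {x | ∀ j, rescaled (A j) (b j)
      (c j - θ j) (1 - E * Eᵀ) (√(y ⬝ᵥ y) / √(Fintype.card L)) x ≤ 0} -
      (gaussPi ι).real {x | ∀ j, qf (A j) (b j) (c j) x ≤ θ j}| ≤
      e₁ + e₂ * |(√(y ⬝ᵥ y) / √(Fintype.card L)) ^ 2 - 1| := fun y => by
    rw [hY]
    exact h _ (div_nonneg (Real.sqrt_nonneg _) (Real.sqrt_nonneg _)) fun j => c j - θ j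
  obtain ⟨hi1, hi2⟩ := integral_abs_sq_norm_sub_one_le (L := L)
  generalize (gaussPi ι).real {x | ∀ j, qf (A j) (b j) (c j) x ≤ θ j} = Y at hf ⊢
  set g : (L → ℝ) → ℝ := fun y => (gaussPi ι).real {x | ∀ j, rescaled (A j) (b j)
      (c j - θ j) (1 - E * Eᵀ) (√(y ⬝ᵥ y) / √(Fintype.card L)) x ≤ 0}
  replace hf : ∀ y, |g y - Y| ≤ e₁ + e₂ * |(√(y ⬝ᵥ y) / √(Fintype.card L)) ^ 2 - 1| := hf
  clear_value g
  clear hY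
  rw [show (∫ y, g y ∂(gaussPi L)) - Y = ∫ y, (g y - Y) ∂(gaussPi L) by
    rw [integral_sub hi (integrable_const _)]; simp]
  refine abs_integral_le_integral_abs.trans ((integral_mono (hi.sub (integrable_const Y)).abs
    ((integrable_const e₁).add (hi1.const_mul e₂)) hf).trans ?_)
  rw [integral_add' (integrable_const _) (hi1.const_mul _), integral_const_mul]
  simp only [integral_const, probReal_univ, one_smul]
  exact add_le_add_right (mul_le_mul_of_nonneg_left hi2 h2) _

theorem exists_sketchPoly_close [DecidableEq ι] [DecidableEq L] [Nonempty L] (hk : 0 < k)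
    (hkL : k ≤ Fintype.card L)
    (A : Fin k → Matrix ι ι ℝ) (b : Fin k → ι → ℝ) (c : Fin k → ℝ) {E : Matrix ι (Fin d) ℝ}
    (hE : Eᵀ * E = 1) {e₁ e₂ : ℝ} (h2 : 0 ≤ e₂)
    (h : ∀ s, 0 ≤ s → ∀ c : Fin k → ℝ,
      |(gaussPi ι).real {x | ∀ j, rescaled (A j) (b j) (c j) (1 - E * Eᵀ) s x ≤ 0} -
        (gaussPi ι).real {x | ∀ j, qf (A j) (b j) (c j) x ≤ 0}| ≤ e₁ + e₂ * |s ^ 2 - 1|) :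
    ∃ G : L → ι → ℝ, ∀ θ : Fin k → ℝ,
      |(gaussPi ι).real {x | ∀ j, qf (A j) (b j) (c j) x ≤ θ j} -
        ((gaussPi (Fin d)).prod (gaussPi L)).real {p | ∀ j, sketchPoly A b c E (1 - E * Eᵀ)
          (√(p.2 ⬝ᵥ p.2) / √(Fintype.card L)) p.1
            (∑ l, (p.2 l / √(Fintype.card L)) • G l) j ≤ θ j}| ≤
      2 * √(2 * (k * Real.log (2 * Real.exp 1 * Fintype.card L / k) + Real.log 2) /
        Fintype.card L) + (e₁ + e₂ * √(2 / Fintype.card L)) := by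
  obtain ⟨G, hG⟩ := exists_sketch (gaussPi (Fin d)) (L := L) hk hkL
    (continuous_sketchPoly A b c E (1 - E * Eᵀ)).measurable
  refine ⟨G, fun θ => ?_⟩
  have hG' := hG θ
  rw [sketchDiscrepancy, prod_real_eq_integral_section _ _
    (measurableSet_orthant (measurable_sketchPoly_scaled A b c E) θ)] at hG'
  simp only [Set.mem_ofPred_eq, sketchPoly_real_eq_rescaled A b c hE] at hG'
  have hfin := abs_integral_rescaled_real_sub_le (L := L) A b c hE h2 h θ
  rw [abs_sub_comm] at hG' hfin
  rw [add_comm (2 * _)]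
  exact (abs_sub_le _ _ _).trans (add_le_add hfin hG')
end

section
variable {β : Type*} [Fintype β]

theorem submatrix_one_mulVec {γ : Type*} [DecidableEq β] (σ : γ → β) (x : β → ℝ) :
    (1 : Matrix β β ℝ).submatrix σ id *ᵥ x = x ∘ σ := by
  ext a
  simp [mulVec, dotProduct, one_apply]

variable {ι α : Type*} [Fintype ι] [Fintype α]

theorem measurePreserving_comp_gaussPi {σ : α → β} (hσ : Function.Injective σ) :
    MeasurePreserving (fun x : β → ℝ => x ∘ σ) (gaussPi β) (gaussPi α) := by
  classical
  simp_rw [← submatrix_one_mulVec σ]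
  refine measurePreserving_mulVec_gaussPi _ ?_
  rw [transpose_submatrix, transpose_one, ← submatrix_mul _ _ _ _ _ Function.bijective_id,
    Matrix.one_mul, submatrix_one σ hσ]

theorem measurePreserving_comp_prod_gaussPi {σ : α ⊕ β → ι} (hσ : Function.Injective σ) :
    MeasurePreserving (fun x : ι → ℝ => (fun a => x (σ (.inl a)), fun b => x (σ (.inr b))))
      (gaussPi ι) ((gaussPi α).prod (gaussPi β)) :=
  (measurePreserving_sumPiEquivProdPi_symm fun _ : α ⊕ β => gaussianReal 0 1).symm.comp
    (measurePreserving_comp_gaussPi hσ)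

theorem qf_mulVec (A : Matrix ι ι ℝ) (b : ι → ℝ) (c : ℝ) (N : Matrix ι α ℝ) (x : α → ℝ) :
    qf A b c (N *ᵥ x) = qf (Nᵀ * A * N) (Nᵀ *ᵥ b) c x := by
  rw [qf, qf, ← mulVec_mulVec, ← mulVec_mulVec, dotProduct_mulVec_eq_transpose Nᵀ,
    transpose_transpose, dotProduct_comm b, dotProduct_comm (Nᵀ *ᵥ b),
    dotProduct_mulVec_eq_transpose Nᵀ, transpose_transpose]

variable {d k T n : ℕ}

/-- A sketched polynomial is realised by a quadratic polynomial in the first `d + T` of `n`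
standard Gaussian coordinates. -/
theorem exists_qf_of_sketchPoly (hT : 0 < T) (hn : d + T ≤ n) (A : Fin k → Matrix ι ι ℝ)
    (b : Fin k → ι → ℝ) (c : Fin k → ℝ) (E : Matrix ι (Fin d) ℝ) (P : Matrix ι ι ℝ)
    (G : Fin T → ι → ℝ) :
    ∃ (A' : Fin k → Matrix (Fin n) (Fin n) ℝ) (b' : Fin k → Fin n → ℝ) (c' : Fin k → ℝ),
      (∀ θ : Fin k → ℝ, (gaussPi (Fin n)).real {x | ∀ j, qf (A' j) (b' j) (c' j) x ≤ θ j} =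
        ((gaussPi (Fin d)).prod (gaussPi (Fin T))).real {p | ∀ j, sketchPoly A b c E P
          (√(p.2 ⬝ᵥ p.2) / √(Fintype.card (Fin T))) p.1
            (∑ l, (p.2 l / √(Fintype.card (Fin T))) • G l) j ≤ θ j}) ∧
      ∀ j x y, (∀ l : Fin n, (l : ℕ) < d + T → x l = y l) →
        qf (A' j) (b' j) (c' j) x = qf (A' j) (b' j) (c' j) y := by
  set σ : Fin d ⊕ Fin T → Fin n := Fin.castLE hn ∘ finSumFinEquiv with hσdef
  have hσ : Function.Injective σ :=
    (Fin.castLE_injective hn).comp finSumFinEquiv.injective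
  set r : Fin k → (Fin n → ℝ) → ℝ := fun j x => sketchPoly A b c E P
    (√((fun l => x (σ (.inr l))) ⬝ᵥ fun l => x (σ (.inr l))) / √(Fintype.card (Fin T)))
      (fun a => x (σ (.inl a)))
      (∑ l, (x (σ (.inr l)) / √(Fintype.card (Fin T))) • G l) j with hr
  set U := (1 : Matrix (Fin n) (Fin n) ℝ).submatrix (fun a => σ (.inl a)) id
  set V := (1 : Matrix (Fin n) (Fin n) ℝ).submatrix (fun a => σ (.inr a)) id
  set N : Matrix ι (Fin n) ℝ :=
    E * U + P * ((1 / √(Fintype.card (Fin T))) • ((of G)ᵀ * V)) with hN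
  have hU : ∀ x, U *ᵥ x = fun a => x (σ (.inl a)) := fun x => submatrix_one_mulVec _ x
  have hV : ∀ x, V *ᵥ x = fun a => x (σ (.inr a)) := fun x => submatrix_one_mulVec _ x
  have hT' : (0 : ℝ) < Fintype.card (Fin T) := by simpa using hT
  have hq : ∀ j x, r j x = qf
      (Nᵀ * A j * N - ((P * A j).trace / Fintype.card (Fin T)) • (Vᵀ * V))
      (Nᵀ *ᵥ b j) (c j + (P * A j).trace) x := fun j x => by
    have h1 : N *ᵥ x = E *ᵥ (fun a => x (σ (.inl a))) +
        P *ᵥ (∑ l, (x (σ (.inr l)) / √(Fintype.card (Fin T))) • G l) := by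
      rw [hN, add_mulVec, ← mulVec_mulVec, ← mulVec_mulVec, hU, smul_mulVec, ← mulVec_mulVec, hV]
      congr 2
      ext i
      simp only [Pi.smul_apply, mulVec, dotProduct, transpose_apply, of_apply, smul_eq_mul,
        Finset.sum_apply, Finset.mul_sum]
      exact Finset.sum_congr rfl fun l _ => by ring
    have h2 : (√((fun l => x (σ (.inr l))) ⬝ᵥ fun l => x (σ (.inr l))) /
        √(Fintype.card (Fin T))) ^ 2 =
        (x ⬝ᵥ (Vᵀ * V) *ᵥ x) / Fintype.card (Fin T) := by
      rw [div_pow, Real.sq_sqrt (dotProduct_self_nonneg' _), Real.sq_sqrt hT'.le, ← mulVec_mulVec,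
        dotProduct_mulVec_eq_transpose, transpose_transpose, hV]
    have h3 := qf_mulVec (A j) (b j) (c j) N x
    rw [hr]
    simp only [sketchPoly]
    rw [h2, ← h1, h3, qf, qf, sub_mulVec, dotProduct_sub, smul_mulVec, dotProduct_smul,
      smul_eq_mul]
    ring
  refine ⟨fun j => Nᵀ * A j * N - ((P * A j).trace / Fintype.card (Fin T)) • (Vᵀ * V),
    fun j => Nᵀ *ᵥ b j, fun j => c j + (P * A j).trace, fun θ => ?_, fun j x y hxy => ?_⟩
  rotate_left
  · rw [← hq, ← hq]
    have hσ' : ∀ a, x (σ a) = y (σ a) := fun a => hxy _ (by simp [hσdef])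
    simp only [hr, hσ']
  · simp_rw [← hq]
    have hm : MeasurableSet {p : (Fin d → ℝ) × (Fin T → ℝ) | ∀ j, sketchPoly A b c E P
          (√(p.2 ⬝ᵥ p.2) / √(Fintype.card (Fin T))) p.1
            (∑ l, (p.2 l / √(Fintype.card (Fin T))) • G l) j ≤ θ j} := by
      refine measurableSet_orthant (Ψ := fun p : (Fin d → ℝ) × (Fin T → ℝ) => sketchPoly A b c E P
          (√(p.2 ⬝ᵥ p.2) / √(Fintype.card (Fin T))) p.1
            (∑ l, (p.2 l / √(Fintype.card (Fin T))) • G l))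
        (Continuous.measurable (continuous_pi fun j => ?_)) θ
      simp only [sketchPoly, qf]
      fun_prop
    rw [← (measurePreserving_comp_prod_gaussPi hσ).measureReal_preimage hm.nullMeasurableSet]
    rfl

/-- A matrix with `B Bᵀ = 0` vanishes. -/
theorem eq_zero_of_mul_transpose_eq_zero {B : Matrix α α ℝ} (h : B * Bᵀ = 0) : B = 0 := by
  rwa [← conjTranspose_eq_transpose_of_trivial, self_mul_conjTranspose_eq_zero] at h

end

section
variable {n k : ℕ}

/-- Replacing a tuple of quadratic polynomials by one that depends on few coordinates, with the
parameters of the construction left free. -/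
theorem exists_close_junta (hk : 0 < k) {A : Fin k → Matrix (Fin n) (Fin n) ℝ}
    (hA : ∀ i, (A i)ᵀ = A i) (b : Fin k → Fin n → ℝ) (c : Fin k → ℝ)
    (hvar : ∀ i, 2 * frobSq (A i) + b i ⬝ᵥ b i = 1) {κ l δ q X : ℝ} {m J T : ℕ}
    (hκ : 0 < κ) (hκ1 : κ ≤ 1) (hm : 0 < m) (hl : 0 ≤ l) (hδ : 0 < δ) (hq : 0 < q)
    (hkq : (k : ℝ) ≤ q ^ 4) (hkT : k ≤ T)
    (hX : X = 6 * √(m * κ ^ 2) + 24 * l / √(m * κ ^ 2))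
    (hω : X * (√m * κ ^ J) ≤ δ ^ 5) (hlarge : 1 ≤ 36 * 2 ^ 25 * q / (4 * κ ^ 3) * X) :
    ∃ (A' : Fin k → Matrix (Fin n) (Fin n) ℝ) (b' : Fin k → Fin n → ℝ) (c' : Fin k → ℝ) (t : ℕ),
      t ≤ k * (1 + m * J) + T ∧
      (∀ θ : Fin k → ℝ, |(gaussPi (Fin n)).real {x | ∀ j, qf (A j) (b j) (c j) x ≤ θ j} -
        (gaussPi (Fin n)).real {x | ∀ j, qf (A' j) (b' j) (c' j) x ≤ θ j}| ≤
        2 * √(2 * (k * Real.log (2 * Real.exp 1 * T / k) + Real.log 2) / T) +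
          (k * (60 * δ + 4 * Real.exp (-l) + √((Real.exp 1 * κ) ^ m)) +
            36 * 2 ^ 25 * q / (4 * κ ^ 3) * X * √(2 / T))) ∧
      ∀ j x y, (∀ i : Fin n, (i : ℕ) < t → x i = y i) →
        qf (A' j) (b' j) (c' j) x = qf (A' j) (b' j) (c' j) y := by
  have hT : 0 < T := hk.trans_le hkT
  have hF : ∀ i, frobSq (A i) ≤ 1 := fun i => by
    have h1 := hvar i
    have h2 := dotProduct_self_nonneg' (b i)
    have h3 := frobSq_nonneg (A i)
    linarith
  have hm' : (0 : ℝ) < m := Nat.cast_pos.mpr hm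
  have hX0 : 0 < X := by rw [hX]; positivity
  obtain ⟨d, E, hd, hE, h⟩ := exists_subspace_width hA hF b hκ hκ1 hm J
  rw [Fintype.card_fin] at hd
  have hdt : d + T ≤ k * (1 + m * J) + T := Nat.add_le_add_right hd T
  choose hPb w hw htr h1 h2 using h
  rcases le_or_gt (d + T) n with hn | hn
  · obtain ⟨hP, hPP⟩ := proj_isSymm_idem hE
    have : Nonempty (Fin T) := ⟨⟨0, hT⟩⟩
    obtain ⟨G, hG⟩ := exists_sketchPoly_close (L := Fin T) hk (by rwa [Fintype.card_fin]) A b c hE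
      (e₁ := Fintype.card (Fin k) * (60 * δ + 4 * Real.exp (-l) + √((Real.exp 1 * κ) ^ m)))
      (e₂ := 36 * 2 ^ 25 * q / (4 * κ ^ 3) * X) (by positivity)
      fun s hs c => rescaled_comparison hA c hP hPP hPb hvar hw htr hq
        (by rwa [Fintype.card_fin]) hX0 (by positivity) hδ hω (by positivity) (by positivity)
        (fun i => by rw [hX]; exact h1 i l hl) h2 hlarge hs
    obtain ⟨A', b', c', hreal, hdep⟩ := exists_qf_of_sketchPoly hT hn A b c E (1 - E * Eᵀ) G
    refine ⟨A', b', c', d + T, hdt, fun θ => ?_, hdep⟩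
    rw [hreal]
    simpa only [Fintype.card_fin] using hG θ
  · refine ⟨A, b, c, d + T, hdt, fun θ => ?_, fun j x y hxy => ?_⟩
    · rw [sub_self, abs_zero]
      positivity
    · rw [show x = y from funext fun i => hxy i (i.2.trans hn)]

end

section

theorem natCeil_le_two_mul {x : ℝ} (hx : 1 ≤ x) : (⌈x⌉₊ : ℝ) ≤ 2 * x := by
  have := Nat.ceil_lt_add_one (zero_le_one.trans hx)
  linarith

/-- Sampling error of the sketch. -/
theorem sketch_error_le {k T : ℕ} (hk : 0 < k) {ε L : ℝ} (hε : 0 < ε) (hL : 1 ≤ L)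
    (hεL : Real.log (1 / ε) = L) (hT1 : k * L / ε ^ 2 ≤ T) (hT2 : T ≤ 2 * (k * L / ε ^ 2)) :
    2 * √(2 * (k * Real.log (2 * Real.exp 1 * T / k) + Real.log 2) / T) ≤ 8 * ε := by
  have hk' : (1 : ℝ) ≤ k := Nat.one_le_cast.mpr hk
  have hk0 : (0 : ℝ) < k := zero_lt_one.trans_le hk'
  have hL0 : 0 < L := zero_lt_one.trans_le hL
  have hTpos : (0 : ℝ) < T := lt_of_lt_of_le (by positivity) hT1
  have hle : 2 * Real.exp 1 * T / k ≤ 4 * Real.exp 1 * L * (1 / ε) ^ 2 := by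
    rw [div_le_iff₀ hk0]
    calc 2 * Real.exp 1 * T ≤ 2 * Real.exp 1 * (2 * (k * L / ε ^ 2)) := by gcongr
      _ = 4 * Real.exp 1 * L * (1 / ε) ^ 2 * k := by field_simp; ring
  have hlog2 : Real.log 2 ≤ 1 := by linarith [Real.log_two_lt_d9]
  have hlog : Real.log (2 * Real.exp 1 * T / k) ≤ 6 * L := by
    refine (Real.log_le_log (by positivity) hle).trans ?_
    rw [Real.log_mul (by positivity) (by positivity), Real.log_mul (by positivity) (by positivity),
      Real.log_mul (by positivity) (by positivity), Real.log_exp, Real.log_pow, hεL,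
      show (4 : ℝ) = 2 ^ 2 by norm_num, Real.log_pow]
    have := Real.log_le_sub_one_of_pos hL0
    push_cast
    linarith
  have hsq : 2 * (k * Real.log (2 * Real.exp 1 * T / k) + Real.log 2) / T ≤ (4 * ε) ^ 2 := by
    rw [div_le_iff₀ hTpos]
    have h1 : k * Real.log (2 * Real.exp 1 * T / k) ≤ k * (6 * L) := by gcongr
    have h2 : 1 ≤ k * L := one_le_mul_of_one_le_of_one_le hk' hL
    have h3 : k * L ≤ ε ^ 2 * T := by
      rw [div_le_iff₀ (by positivity)] at hT1; linarith
    linarith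
  linarith [Real.sqrt_le_iff.mpr ⟨by positivity, hsq⟩]

/-- Error caused by the fluctuation of the length of the sketched vector. -/
theorem length_error_le {lam ε L κ q X T k : ℝ} (hlam : 0 ≤ lam) (hε : 0 < ε) (hL : 1 ≤ L)
    (hk : k = Real.exp lam) (hκ : κ = Real.exp (-3 - lam / 40)) (hq : q = Real.exp (lam / 4))
    (hX : X ≤ 78 * √L * (1 + lam) / κ) (hT1 : k * L / ε ^ 2 ≤ T) :
    36 * 2 ^ 25 * q / (4 * κ ^ 3) * X * √(2 / T) ≤ 9 * 2 ^ 25 * 78 * 2 * 7 * Real.exp 12 * ε := by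
  have hL0 : 0 < L := zero_lt_one.trans_le hL
  have hκ0 : 0 < κ := hκ ▸ Real.exp_pos _
  have hq0 : 0 < q := hq ▸ Real.exp_pos _
  have hk0 : 0 < k := hk ▸ Real.exp_pos _
  have hT0 : 0 < T := lt_of_lt_of_le (by positivity) hT1
  set u := Real.exp (lam / 2) with hu
  have hu0 : 0 < u := Real.exp_pos _
  have hku : k = u ^ 2 := by rw [hk, hu, ← Real.exp_nat_mul]; congr 1; push_cast; ring
  have h1 : √(2 / T) ≤ 2 * ε / (u * √L) := by
    refine Real.sqrt_le_iff.mpr ⟨by positivity, ?_⟩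
    rw [div_pow, mul_pow, mul_pow, Real.sq_sqrt hL0.le, ← hku]
    rw [div_le_div_iff₀ hT0 (by positivity)]
    rw [div_le_iff₀ (by positivity)] at hT1
    have : 0 < k * L := by positivity
    linarith
  have h2 : 1 + lam ≤ 7 * Real.exp (3 * lam / 20) := by
    linarith [Real.add_one_le_exp (3 * lam / 20)]
  have h3 : q * Real.exp (3 * lam / 20) / (κ ^ 4 * u) = Real.exp 12 := by
    rw [div_eq_iff (by positivity), hq, hκ, hu, ← Real.exp_nat_mul, ← Real.exp_add,
      ← Real.exp_add, ← Real.exp_add]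
    congr 1
    push_cast
    ring
  have hsL : 0 < √L := Real.sqrt_pos.mpr hL0
  calc 36 * 2 ^ 25 * q / (4 * κ ^ 3) * X * √(2 / T)
      ≤ 36 * 2 ^ 25 * q / (4 * κ ^ 3) * (78 * √L * (1 + lam) / κ) * (2 * ε / (u * √L)) := by
        gcongr
    _ = 9 * 2 ^ 25 * 78 * 2 * ε * (q * (1 + lam) / (κ ^ 4 * u)) := by
        field_simp
        ring
    _ ≤ 9 * 2 ^ 25 * 78 * 2 * ε * (q * (7 * Real.exp (3 * lam / 20)) / (κ ^ 4 * u)) := by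
        gcongr
    _ = 9 * 2 ^ 25 * 78 * 2 * 7 * ε * (q * Real.exp (3 * lam / 20) / (κ ^ 4 * u)) := by ring
    _ = _ := by rw [h3]; ring

/-- Bounds on the Lipschitz scale for the chosen parameters. -/
theorem scale_bounds {lam L κ : ℝ} {m : ℕ} (hlam : 0 ≤ lam) (hL : 1 ≤ L)
    (hκ0 : 0 < κ) (hκ1 : κ ≤ 1) (hm1 : 80 * L ≤ m) (hm2 : m ≤ 81 * L) :
    1 ≤ 6 * √(m * κ ^ 2) + 24 * (lam + L) / √(m * κ ^ 2) ∧
    6 * √(m * κ ^ 2) + 24 * (lam + L) / √(m * κ ^ 2) ≤ 78 * √L * (1 + lam) / κ ∧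
    (6 * √(m * κ ^ 2) + 24 * (lam + L) / √(m * κ ^ 2)) * √m ≤ 510 * (lam + L) / κ := by
  have hL0 : 0 < L := zero_lt_one.trans_le hL
  have hm0 : (0 : ℝ) < m := lt_of_lt_of_le (by positivity) hm1
  have hs : √(m * κ ^ 2) = √m * κ := by rw [Real.sqrt_mul hm0.le, Real.sqrt_sq hκ0.le]
  have hsm : 0 < √(m : ℝ) := Real.sqrt_pos.mpr hm0
  have hsL : 0 < √L := Real.sqrt_pos.mpr hL0
  have hsLL : √L * √L = L := Real.mul_self_sqrt hL0.le
  have hmm : √(m : ℝ) * √m = m := Real.mul_self_sqrt hm0.le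
  have hlow : √L ≤ √(m : ℝ) := Real.sqrt_le_sqrt (by linarith)
  have hup : √(m : ℝ) ≤ 9 * √L := by
    refine Real.sqrt_le_iff.mpr ⟨by positivity, ?_⟩
    rw [mul_pow, Real.sq_sqrt hL0.le]
    linarith
  have hsL1 : 1 ≤ √L := Real.one_le_sqrt.mpr hL
  rw [hs]
  refine ⟨?_, ?_, ?_⟩
  · have : 1 ≤ 24 * (lam + L) / (√m * κ) := by
      rw [one_le_div (by positivity)]
      calc √m * κ ≤ √m * 1 := by gcongr
        _ ≤ 9 * √L := by linarith
        _ ≤ 9 * (√L * √L) := by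
          have := mul_le_mul_of_nonneg_left hsL1 hsL.le
          linarith
        _ ≤ 24 * (lam + L) := by rw [hsLL]; linarith
    have : 0 ≤ 6 * (√m * κ) := by positivity
    linarith
  · have h1 : 6 * (√m * κ) ≤ 54 * √L * (1 + lam) / κ := by
      rw [le_div_iff₀ hκ0]
      calc 6 * (√m * κ) * κ ≤ 6 * (9 * √L * 1) * 1 := by gcongr
        _ = 54 * √L * 1 := by ring
        _ ≤ 54 * √L * (1 + lam) := by gcongr; linarith
    have h2 : 24 * (lam + L) / (√m * κ) ≤ 24 * √L * (1 + lam) / κ := by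
      rw [div_le_div_iff₀ (by positivity) hκ0]
      have h3 : lam + L ≤ L * (1 + lam) := by
        have := mul_le_mul_of_nonneg_right hL hlam
        linarith
      calc 24 * (lam + L) * κ ≤ 24 * (L * (1 + lam)) * κ := by gcongr
        _ = 24 * √L * (1 + lam) * (√L * κ) := by
          linear_combination (-24 * (1 + lam) * κ) * hsLL
        _ ≤ 24 * √L * (1 + lam) * (√m * κ) := by gcongr
    calc _ ≤ 54 * √L * (1 + lam) / κ + 24 * √L * (1 + lam) / κ := add_le_add h1 h2
      _ = _ := by ring
  · have h1 : (6 * (√m * κ) + 24 * (lam + L) / (√m * κ)) * √m = 6 * m * κ +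
        24 * (lam + L) / κ := by
      field_simp
      linear_combination (6 * κ ^ 2) * hmm
    rw [h1, le_div_iff₀ hκ0, add_mul, div_mul_cancel₀ _ hκ0.ne']
    have : 6 * m * κ * κ ≤ 6 * (81 * L) * 1 * 1 := by gcongr
    linarith

end

section

/-- The truncation level `κ ^ J` beats every polynomial in `k / ε`. -/
theorem truncation_le {lam L κ Y : ℝ} {J : ℕ} (hlam : 0 ≤ lam) (hL : 1 ≤ L)
    (hκ : κ = Real.exp (-3 - lam / 40)) (hJ : 240 * L ≤ J) (hY : Y ≤ 510 * (lam + L) / κ) :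
    Y * κ ^ (J + 1) ≤ Real.exp (-(lam + L)) ^ 5 := by
  have hκ0 : 0 < κ := hκ ▸ Real.exp_pos _
  have h510 : (510 : ℝ) ≤ Real.exp 7 := by
    have := Real.exp_one_gt_d9
    calc (510 : ℝ) ≤ 2.7 ^ 7 := by norm_num
      _ ≤ Real.exp 1 ^ 7 := by gcongr; linarith
      _ = Real.exp 7 := by rw [← Real.exp_nat_mul]; norm_num
  have hll : lam + L ≤ Real.exp (lam + L) := by linarith [Real.add_one_le_exp (lam + L)]
  calc Y * κ ^ (J + 1) ≤ 510 * (lam + L) / κ * κ ^ (J + 1) := by gcongr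
    _ = 510 * (lam + L) * κ ^ J := by rw [pow_succ]; field_simp
    _ ≤ Real.exp 7 * Real.exp (lam + L) * κ ^ J := by gcongr
    _ ≤ Real.exp (-(lam + L)) ^ 5 := by
      rw [hκ, ← Real.exp_nat_mul, ← Real.exp_nat_mul, ← Real.exp_add, ← Real.exp_add,
        Real.exp_le_exp]
      have h1 : 240 * L * (3 + lam / 40) ≤ J * (3 + lam / 40) := by gcongr
      have h2 : lam ≤ L * lam := le_mul_of_one_le_left hlam hL
      push_cast
      linarith

theorem sqrt_exp_mul_pow_le {lam L κ : ℝ} {m : ℕ} (hlam : 0 ≤ lam) (hL : 1 ≤ L)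
    (hκ : κ = Real.exp (-3 - lam / 40)) (hm : 80 * L ≤ m) :
    √((Real.exp 1 * κ) ^ m) ≤ Real.exp (-(lam + L)) := by
  refine Real.sqrt_le_iff.mpr ⟨(Real.exp_pos _).le, ?_⟩
  rw [hκ, ← Real.exp_add, ← Real.exp_nat_mul, ← Real.exp_nat_mul, Real.exp_le_exp]
  have h1 : 80 * L * (2 + lam / 40) ≤ m * (2 + lam / 40) := by gcongr
  have h2 : lam ≤ L * lam := le_mul_of_one_le_left hlam hL
  push_cast
  linarith

/-- Number of coordinates used, for the chosen parameters. -/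
theorem junta_size_le {k m J T : ℕ} {ε L : ℝ} (hL : 1 ≤ L)
    (hLε : L ≤ 1 / ε ^ 2) (hm : m ≤ 81 * L) (hJ : J ≤ 241 * L)
    (hT : T ≤ 2 * (k * L / ε ^ 2)) :
    ((k * (1 + m * (J + 1)) + T : ℕ) : ℝ) ≤ 20000 * (k * L / ε ^ 2) := by
  have hL0 : 0 < L := zero_lt_one.trans_le hL
  have h1 : (1 + m * (J + 1) : ℝ) ≤ 19998 * (L * (1 / ε ^ 2)) := by
    have h2 : (m * (J + 1) : ℝ) ≤ 81 * L * (242 * L) := by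
      gcongr
      linarith
    have h3 : L * L ≤ L * (1 / ε ^ 2) := by gcongr
    have h4 : 1 ≤ L * L := one_le_mul_of_one_le_of_one_le hL hL
    linarith
  push_cast
  calc (k : ℝ) * (1 + m * (J + 1)) + T
      ≤ k * (19998 * (L * (1 / ε ^ 2))) + 2 * (k * L / ε ^ 2) := by gcongr
    _ = _ := by ring

/-- Every tuple of quadratic polynomials of unit variance is `O(ε)`-close to one that depends on
`O(k log(1/ε) / ε²)` coordinates. -/
theorem exists_close_junta_of_variance :
    ∃ K : ℝ, 0 < K ∧ ∀ (n k : ℕ), 0 < k → ∀ A : Fin k → Matrix (Fin n) (Fin n) ℝ,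
      (∀ i, (A i)ᵀ = A i) → ∀ (b : Fin k → Fin n → ℝ) (c : Fin k → ℝ) (ε : ℝ), 0 < ε → ε < 1 / 4 →
      (∀ i, 2 * frobSq (A i) + b i ⬝ᵥ b i = 1) →
      ∃ (A' : Fin k → Matrix (Fin n) (Fin n) ℝ) (b' : Fin k → Fin n → ℝ) (c' : Fin k → ℝ) (t : ℕ),
        (t : ℝ) ≤ K * k * Real.log (1 / ε) / ε ^ 2 ∧
        (∀ θ : Fin k → ℝ, |(gaussPi (Fin n)).real {x | ∀ j, qf (A j) (b j) (c j) x ≤ θ j} -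
          (gaussPi (Fin n)).real {x | ∀ j, qf (A' j) (b' j) (c' j) x ≤ θ j}| ≤ K * ε) ∧
        ∀ j x y, (∀ i : Fin n, (i : ℕ) < t → x i = y i) →
          qf (A' j) (b' j) (c' j) x = qf (A' j) (b' j) (c' j) y := by
  refine ⟨20000 + 9 * 2 ^ 25 * 78 * 2 * 7 * Real.exp 12, by positivity,
    fun n k hk A hA b c ε hε hε4 hvar => ?_⟩
  have hk' : (1 : ℝ) ≤ k := Nat.one_le_cast.mpr hk
  have hk0 : (0 : ℝ) < k := zero_lt_one.trans_le hk'
  set lam : ℝ := Real.log k with hlamdef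
  set L : ℝ := Real.log (1 / ε) with hLdef
  have hlam : 0 ≤ lam := Real.log_nonneg hk'
  have hklam : (k : ℝ) = Real.exp lam := (Real.exp_log hk0).symm
  have hεL : Real.exp (-L) = ε := by
    rw [hLdef, Real.exp_neg, Real.exp_log (by positivity), one_div, inv_inv]
  have hL : 1 ≤ L := by
    rw [hLdef, Real.le_log_iff_exp_le (by positivity), le_div_iff₀ hε]
    calc Real.exp 1 * ε ≤ 4 * (1 / 4) := by
          gcongr
          linarith [Real.exp_one_lt_d9]
      _ = 1 := by norm_num
  have hL0 : 0 < L := zero_lt_one.trans_le hL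
  have hLε : L ≤ 1 / ε ^ 2 := by
    have h1 : L ≤ 1 / ε := (Real.log_le_sub_one_of_pos (by positivity)).trans (by linarith)
    refine h1.trans (one_div_le_one_div_of_le (by positivity) ?_)
    rw [pow_two]
    exact mul_le_of_le_one_left hε.le (by linarith)
  set κ : ℝ := Real.exp (-3 - lam / 40) with hκ
  set m : ℕ := ⌈80 * L⌉₊ with hmdef
  set J : ℕ := ⌈240 * L⌉₊ with hJdef
  set T : ℕ := ⌈k * L / ε ^ 2⌉₊ with hTdef
  have hκ0 : 0 < κ := Real.exp_pos _
  have hκ1 : κ ≤ 1 := Real.exp_le_one_iff.mpr (by linarith)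
  have hm1 : 80 * L ≤ m := Nat.le_ceil _
  have hm2 : (m : ℝ) ≤ 81 * L := by linarith [Nat.ceil_lt_add_one (a := 80 * L) (by positivity)]
  have hJ1 : 240 * L ≤ J := Nat.le_ceil _
  have hJ2 : (J : ℝ) ≤ 241 * L := by linarith [Nat.ceil_lt_add_one (a := 240 * L) (by positivity)]
  have hkT : (k : ℝ) ≤ k * L / ε ^ 2 := by
    rw [le_div_iff₀ (by positivity), mul_le_mul_iff_right₀ hk0]
    exact (pow_le_one₀ hε.le (by linarith)).trans hL
  have hT1 : k * L / ε ^ 2 ≤ T := Nat.le_ceil _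
  have hT2 : (T : ℝ) ≤ 2 * (k * L / ε ^ 2) := natCeil_le_two_mul (hk'.trans hkT)
  obtain ⟨hX1, hX2, hX3⟩ := scale_bounds hlam hL hκ0 hκ1 hm1 hm2
  have hm0 : (0 : ℝ) < m := lt_of_lt_of_le (by positivity) hm1
  set X : ℝ := 6 * √(m * κ ^ 2) + 24 * (lam + L) / √(m * κ ^ 2) with hX
  have hq1 : 1 ≤ Real.exp (lam / 4) := Real.one_le_exp (by positivity)
  have hlarge : 1 ≤ 36 * 2 ^ 25 * Real.exp (lam / 4) / (4 * κ ^ 3) * X := by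
    refine one_le_mul_of_one_le_of_one_le ?_ hX1
    rw [one_le_div (by positivity)]
    have : κ ^ 3 ≤ 1 := pow_le_one₀ hκ0.le hκ1
    linarith
  obtain ⟨A', b', c', t, ht, hclose, hdep⟩ := exists_close_junta hk hA b c hvar (κ := κ)
    (l := lam + L) (δ := Real.exp (-(lam + L))) (q := Real.exp (lam / 4)) (X := X) (m := m)
    (J := J + 1) (T := T) hκ0 hκ1 (Nat.cast_pos.mp hm0) (by positivity) (Real.exp_pos _)
    (Real.exp_pos _)
    (by rw [hklam, ← Real.exp_nat_mul]; exact Real.exp_le_exp.mpr (by push_cast; linarith))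
    (Nat.cast_le.mp (hkT.trans hT1)) hX
    (by rw [← mul_assoc]; exact truncation_le hlam hL hκ hJ1 hX3) hlarge
  have hlen := length_error_le hlam hε hL hklam hκ rfl hX2 hT1
  have hsk := sketch_error_le hk hε hL hLdef.symm hT1 hT2
  refine ⟨A', b', c', t, ?_, fun θ => (hclose θ).trans ?_, hdep⟩
  · calc (t : ℝ) ≤ ((k * (1 + m * (J + 1)) + T : ℕ) : ℝ) := Nat.cast_le.mpr ht
      _ ≤ 20000 * (k * L / ε ^ 2) := junta_size_le hL hLε hm2 hJ2 hT2
      _ ≤ (20000 + 9 * 2 ^ 25 * 78 * 2 * 7 * Real.exp 12) * (k * L / ε ^ 2) := by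
        gcongr
        exact le_add_of_nonneg_right (by positivity)
      _ = _ := by ring
  · have hke : k * Real.exp (-(lam + L)) = ε := by
      rw [hklam, ← Real.exp_add, ← hεL]; congr 1; ring
    have hse := sqrt_exp_mul_pow_le hlam hL hκ hm1
    have hmid : k * (60 * Real.exp (-(lam + L)) + 4 * Real.exp (-(lam + L)) +
        √((Real.exp 1 * κ) ^ m)) ≤ 65 * ε := by
      calc _ ≤ k * (60 * Real.exp (-(lam + L)) + 4 * Real.exp (-(lam + L)) +
            Real.exp (-(lam + L))) := by gcongr
        _ = 65 * (k * Real.exp (-(lam + L))) := by ring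
        _ = 65 * ε := by rw [hke]
    linarith

end

section

/-- Symmetrising the matrix does not change the polynomial. -/
theorem qf_symmetrise {ι : Type*} [Fintype ι] (A : Matrix ι ι ℝ) (b : ι → ℝ) (c : ℝ) :
    qf ((1 / 2 : ℝ) • (A + Aᵀ)) b c = qf A b c := by
  ext x
  have h : x ⬝ᵥ Aᵀ *ᵥ x = x ⬝ᵥ A *ᵥ x := by
    rw [dotProduct_mulVec_eq_transpose, transpose_transpose, dotProduct_comm]
  rw [qf, qf, smul_mulVec, dotProduct_smul, add_mulVec, dotProduct_add, h, smul_eq_mul]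
  ring

theorem covar_const {α : Type*} [MeasurableSpace α] (μ : Measure α) [IsProbabilityMeasure μ]
    (a b : ℝ) : covar μ (fun _ => a) (fun _ => b) = 0 := by
  simp [covar]

instance isProbabilityMeasure_stdGaussian (n : ℕ) : IsProbabilityMeasure (stdGaussian n) :=
  inferInstanceAs (IsProbabilityMeasure (gaussPi (Fin n)))

/-- A tuple that is constant is exactly Gaussian with covariance zero. -/
theorem real_const_eq_gaussian {n k : ℕ} (v : Fin k → ℝ) {B : Matrix (Fin k) (Fin k) ℝ}
    (hB : ∀ i j, (B * Bᵀ) i j = covar (stdGaussian n) (fun _ => v i) (fun _ => v j))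
    (θ : Fin k → ℝ) :
    ((stdGaussian n) {_y | ∀ i, v i ≤ θ i}).toReal = ((stdGaussian k) {z | ∀ i,
      (∫ _, v i ∂(stdGaussian n)) + B.mulVec z i ≤ θ i}).toReal := by
  have hB0 : B = 0 := eq_zero_of_mul_transpose_eq_zero (by
    ext i j
    rw [hB, covar_const, Matrix.zero_apply])
  subst hB0
  by_cases h : ∀ i, v i ≤ θ i <;> simp [h]

end

/-- the `Transform` theorem.  Given any `k`-tuple of degree-2 polynomials
`q i = quadPoly (A i) (b i) (c i)` of unit variance under `N(0,1)^n`, there is a `k`-tuple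
`r i = quadPoly (A' i) (b' i) (c' i)` and `0 ≤ t ≤ K k ln(1/ε)/ε²` such that (i) `q` and `r`
are `K ε`-close in `k`-dimensional Kolmogorov distance, and (ii) for every restriction `ρ` of
the first `t` variables, the restricted tuple `r|_ρ` is `ε`-close in Kolmogorov distance to
the `k`-dimensional Gaussian with the matching mean vector and covariance matrix `Σ(r|_ρ)`
(realized as `μ(r|_ρ) + B z`, `z ∼ N(0,1)^k`, for any `B` with `B Bᵀ = Σ(r|_ρ)`). -/
theorem stmt_4 :
    ∃ K : ℝ, 0 < K ∧
      ∀ (n k : ℕ) (A : Fin k → Matrix (Fin n) (Fin n) ℝ) (b : Fin k → (Fin n → ℝ))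
        (c : Fin k → ℝ) (ε : ℝ), 0 < ε → ε < 1 / 4 →
        (∀ i, variance (quadPoly (A i) (b i) (c i)) (stdGaussian n) = 1) →
        ∃ (A' : Fin k → Matrix (Fin n) (Fin n) ℝ) (b' : Fin k → (Fin n → ℝ))
          (c' : Fin k → ℝ) (t : ℕ),
          (t : ℝ) ≤ K * k * Real.log (1 / ε) / ε ^ 2 ∧
          (∀ θ : Fin k → ℝ,
            |((stdGaussian n) {x | ∀ i, quadPoly (A i) (b i) (c i) x ≤ θ i}).toReal -
                ((stdGaussian n) {y | ∀ i, quadPoly (A' i) (b' i) (c' i) y ≤ θ i}).toReal|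
              ≤ K * ε) ∧
          (∀ ρ : Fin n → ℝ, ∀ B : Matrix (Fin k) (Fin k) ℝ,
            (∀ i j, (B * Bᵀ) i j =
              covar (stdGaussian n)
                (fun y => quadPoly (A' i) (b' i) (c' i) (splice t ρ y))
                (fun y => quadPoly (A' j) (b' j) (c' j) (splice t ρ y))) →
            ∀ θ : Fin k → ℝ,
              |((stdGaussian n)
                    {y | ∀ i, quadPoly (A' i) (b' i) (c' i) (splice t ρ y) ≤ θ i}).toReal -
                  ((stdGaussian k) {z | ∀ i,
                    (∫ y, quadPoly (A' i) (b' i) (c' i) (splice t ρ y) ∂(stdGaussian n)) +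
                      B.mulVec z i ≤ θ i}).toReal|
                ≤ ε) := by
  obtain ⟨K, hK, hmain⟩ := exists_close_junta_of_variance
  refine ⟨K, hK, fun n k A b c ε hε hε4 hvar => ?_⟩
  have hjunta : ∃ (A' : Fin k → Matrix (Fin n) (Fin n) ℝ) (b' : Fin k → Fin n → ℝ)
      (c' : Fin k → ℝ) (t : ℕ), (t : ℝ) ≤ K * k * Real.log (1 / ε) / ε ^ 2 ∧
      (∀ θ : Fin k → ℝ, |(stdGaussian n).real {x | ∀ j, quadPoly (A j) (b j) (c j) x ≤ θ j} -
        (stdGaussian n).real {x | ∀ j, quadPoly (A' j) (b' j) (c' j) x ≤ θ j}| ≤ K * ε) ∧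
      ∀ j x y, (∀ i : Fin n, (i : ℕ) < t → x i = y i) →
        quadPoly (A' j) (b' j) (c' j) x = quadPoly (A' j) (b' j) (c' j) y := by
    rcases Nat.eq_zero_or_pos k with rfl | hk
    · refine ⟨A, b, c, 0, by simp, fun θ => ?_, fun j => j.elim0⟩
      rw [sub_self, abs_zero]
      positivity
    · have hsymm : ∀ i, ((1 / 2 : ℝ) • (A i + (A i)ᵀ))ᵀ = (1 / 2 : ℝ) • (A i + (A i)ᵀ) :=
        fun i => by rw [transpose_smul, transpose_add, transpose_transpose, add_comm]
      have h := hmain n k hk (fun i => (1 / 2 : ℝ) • (A i + (A i)ᵀ)) hsymm b c ε hε hε4 fun i => by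
        rw [← variance_qf (hsymm i) (b i) (c i), qf_symmetrise]
        exact hvar i
      simp only [qf_symmetrise] at h
      exact h
  obtain ⟨A', b', c', t, ht, hclose, hdep⟩ := hjunta
  refine ⟨A', b', c', t, ht, hclose, fun ρ B hB θ => ?_⟩
  have hconst : ∀ i y, quadPoly (A' i) (b' i) (c' i) (splice t ρ y) =
      quadPoly (A' i) (b' i) (c' i) ρ := fun i y => hdep i _ _ fun l hl => if_pos hl
  simp only [hconst] at hB ⊢
  rw [real_const_eq_gaussian _ hB, sub_self, abs_zero]
  exact hε.le
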